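/- arXiv:0902.4842 — 6 statements merged into one kernel-verified Lean document; each statement's English description precedes it below -/
import Mathlib

section
/- (Lemma 1, direct-observation part.) Let (U_i,V_i)_{i=1,…,n}, n ≥ 2, be i.i.d. [0,1]²-valued random vectors with bounded density c, and let c_λ be another bounded function in L²([0,1]²). Set c_{j,k} = ∫ φ_{j,k} c, c_{j,k}(λ) = ∫ φ_{j,k} c_λ, T_j(λ) = Σ_k (c_{j,k} − c_{j,k}(λ))², and define the U-statistic T̂_j(λ) = Σ_k (n(n−1))^{−1} Σ_{i₁≠i₂} (φ_{j,k}(U_{i₁},V_{i₁}) − c_{j,k}(λ)) (φ_{j,k}(U_{i₂},V_{i₂}) − c_{j,k}(λ)). Then E[T̂_j(λ)] = T_j(λ), and there exists a constant κ > 0, depending only on ‖φ‖_∞, L, ‖c‖_∞ and ‖c_λ‖_∞, such that Var(T̂_j(λ)) ≤ κ ( (2^{j}/n)² + (2^{j}/n) T_j(λ) ). -/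
open MeasureTheory

noncomputable section

/-- The unit square `[0,1]² ⊆ ℝ²`. -/
def unitSq : Set (ℝ × ℝ) := Set.Icc (0 : ℝ) 1 ×ˢ Set.Icc (0 : ℝ) 1

/-- The tensor-product scaling family `φ_{j,k}(u,v) = 2^j φ(2^j u − k₁) φ(2^j v − k₂)`. -/
def phiJK (φ : ℝ → ℝ) (j : ℕ) (k : ℤ × ℤ) (z : ℝ × ℝ) : ℝ :=
  2 ^ j * φ (2 ^ j * z.1 - k.1) * φ (2 ^ j * z.2 - k.2)

/-- Measurable real functions that are uniformly bounded. -/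
def BddMeas {X : Type*} [MeasurableSpace X] (f : X → ℝ) : Prop :=
  Measurable f ∧ ∃ C, ∀ x, |f x| ≤ C

namespace BddMeas

variable {X : Type*} [MeasurableSpace X] {f g : X → ℝ}

theorem const (a : ℝ) : BddMeas fun _ : X => a := ⟨measurable_const, |a|, fun _ => le_rfl⟩

theorem add (hf : BddMeas f) (hg : BddMeas g) : BddMeas fun x => f x + g x := by
  obtain ⟨hf, C, hC⟩ := hf
  obtain ⟨hg, D, hD⟩ := hg
  exact ⟨hf.add hg, C + D, fun x => (abs_add_le _ _).trans (add_le_add (hC x) (hD x))⟩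

theorem mul (hf : BddMeas f) (hg : BddMeas g) : BddMeas fun x => f x * g x := by
  obtain ⟨hf, C, hC⟩ := hf
  obtain ⟨hg, D, hD⟩ := hg
  refine ⟨hf.mul hg, C * D, fun x => ?_⟩
  rw [abs_mul]
  exact mul_le_mul (hC x) (hD x) (abs_nonneg _) ((abs_nonneg _).trans (hC x))

theorem const_mul (a : ℝ) (hf : BddMeas f) : BddMeas fun x => a * f x := (const a).mul hf

theorem sub_const (hf : BddMeas f) (a : ℝ) : BddMeas fun x => f x - a := by
  simpa [sub_eq_add_neg] using hf.add (const (-a))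

theorem sq (hf : BddMeas f) : BddMeas fun x => f x ^ 2 := by
  simpa [pow_two] using hf.mul hf

theorem sum {K : Type*} {s : Finset K} {F : K → X → ℝ} (hF : ∀ k ∈ s, BddMeas (F k)) :
    BddMeas fun x => ∑ k ∈ s, F k x := by
  classical
  induction s using Finset.induction_on with
  | empty => simpa using const (X := X) 0
  | insert a s ha ih =>
    simp only [Finset.sum_insert ha]
    exact (hF a (by simp)).add (ih fun k hk => hF k (by simp [hk]))

theorem comp {Y : Type*} [MeasurableSpace Y] {u : Y → X} (hf : BddMeas f) (hu : Measurable u) :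
    BddMeas fun y => f (u y) := by
  obtain ⟨hf, C, hC⟩ := hf
  exact ⟨hf.comp hu, C, fun y => hC _⟩

theorem eval {ι : Type*} (hf : BddMeas f) (i : ι) : BddMeas fun ω : ι → X => f (ω i) :=
  hf.comp (measurable_pi_apply i)

theorem integrable (hf : BddMeas f) (μ : Measure X) [IsFiniteMeasure μ] : Integrable f μ := by
  obtain ⟨hf, C, hC⟩ := hf
  exact Integrable.of_bound hf.aestronglyMeasurable C (ae_of_all _ hC)

end BddMeas

section Product

variable {X : Type*} [MeasurableSpace X] (ν : Measure X) [IsProbabilityMeasure ν] {n : ℕ}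

theorem integral_pi_eval {f : X → ℝ} (hf : Measurable f) (i : Fin n) :
    ∫ ω, f (ω i) ∂(Measure.pi fun _ : Fin n => ν) = ∫ x, f x ∂ν :=
  integral_comp_eval (μ := fun _ : Fin n => ν) hf.aestronglyMeasurable

theorem integral_pi_eval_mul_eval {f g : X → ℝ} (hf : Measurable f) (hg : Measurable g)
    {i l : Fin n} (hil : i ≠ l) :
    ∫ ω, f (ω i) * g (ω l) ∂(Measure.pi fun _ : Fin n => ν) = (∫ x, f x ∂ν) * ∫ x, g x ∂ν := by
  have hind := (ProbabilityTheory.iIndepFun_pi (μ := fun _ : Fin n => ν)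
    (X := fun _ x => x) fun _ => aemeasurable_id).indepFun hil
  rw [← integral_pi_eval ν hf i, ← integral_pi_eval ν hg l]
  exact (hind.comp hf hg).integral_fun_mul_eq_mul_integral
    (hf.comp (measurable_pi_apply i)).aestronglyMeasurable
    (hg.comp (measurable_pi_apply l)).aestronglyMeasurable

theorem integral_pi_four_eq_zero {f g p q : X → ℝ} (hf : ∫ x, f x ∂ν = 0) {i i' l l' : Fin n}
    (h₁ : i ≠ i') (h₂ : i ≠ l) (h₃ : i ≠ l') :
    ∫ ω, f (ω i) * g (ω i') * (p (ω l) * q (ω l')) ∂(Measure.pi fun _ : Fin n => ν) = 0 := by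
  let F : Fin n → X → ℝ := fun m x =>
    (if m = i then f x else 1) * (if m = i' then g x else 1) *
      ((if m = l then p x else 1) * (if m = l' then q x else 1))
  have hF : ∀ ω : Fin n → X,
      f (ω i) * g (ω i') * (p (ω l) * q (ω l')) = ∏ m, F m (ω m) := fun ω => by
    simp only [F, Finset.prod_mul_distrib]
    simp
  simp only [hF]
  rw [integral_fintype_prod_eq_prod]
  refine Finset.prod_eq_zero (Finset.mem_univ i) ?_
  simpa [F, h₁, h₂, h₃] using hf

/-- Second moment of a sum of independent centered copies. -/
theorem integral_sq_sum_eval {f : X → ℝ} (hf : BddMeas f) (hf0 : ∫ x, f x ∂ν = 0) :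
    ∫ ω, (∑ i, f (ω i)) ^ 2 ∂(Measure.pi fun _ : Fin n => ν) = n * ∫ x, f x ^ 2 ∂ν := by
  simp only [pow_two, Finset.sum_mul_sum]
  rw [integral_finsetSum _ fun i _ =>
    (BddMeas.sum fun l _ => (hf.eval i).mul (hf.eval l)).integrable _]
  have hrow : ∀ i : Fin n, ∫ ω, ∑ l, f (ω i) * f (ω l) ∂(Measure.pi fun _ : Fin n => ν)
      = ∫ x, f x * f x ∂ν := fun i => by
    rw [integral_finsetSum _ fun l _ => ((hf.eval i).mul (hf.eval l)).integrable _,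
      Finset.sum_eq_single i]
    · exact integral_pi_eval ν (hf.mul hf).1 i
    · intro l _ hl
      rw [integral_pi_eval_mul_eval ν hf.1 hf.1 hl.symm, hf0, zero_mul]
    · simp
  simp [hrow]

variable {K : Type*} (s : Finset K) {h : K → X → ℝ}

theorem integral_kernel_mul_kernel_eq_zero (hh : ∀ k, BddMeas (h k)) (h0 : ∀ k, ∫ x, h k x ∂ν = 0)
    {i i' l l' : Fin n} (h₁ : i ≠ i') (h₂ : i ≠ l) (h₃ : i ≠ l') :
    ∫ ω, (∑ k ∈ s, h k (ω i) * h k (ω i')) * (∑ k ∈ s, h k (ω l) * h k (ω l'))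
      ∂(Measure.pi fun _ : Fin n => ν) = 0 := by
  simp only [Finset.sum_mul_sum]
  have hb : ∀ k k', BddMeas fun ω : Fin n → X =>
      h k (ω i) * h k (ω i') * (h k' (ω l) * h k' (ω l')) := fun k k' =>
    (((hh k).eval i).mul ((hh k).eval i')).mul (((hh k').eval l).mul ((hh k').eval l'))
  rw [integral_finsetSum _ fun k _ => (BddMeas.sum fun k' _ => hb k k').integrable _]
  refine Finset.sum_eq_zero fun k _ => ?_
  rw [integral_finsetSum _ fun k' _ => (hb k k').integrable _]
  exact Finset.sum_eq_zero fun k' _ => integral_pi_four_eq_zero ν (h0 k) h₁ h₂ h₃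

theorem integral_sq_kernel (hh : ∀ k, BddMeas (h k)) {i i' : Fin n} (hne : i ≠ i') :
    ∫ ω, (∑ k ∈ s, h k (ω i) * h k (ω i')) * (∑ k ∈ s, h k (ω i) * h k (ω i'))
      ∂(Measure.pi fun _ : Fin n => ν)
      = ∑ k ∈ s, ∑ k' ∈ s, (∫ x, h k x * h k' x ∂ν) ^ 2 := by
  have hre : ∀ ω : Fin n → X,
      (∑ k ∈ s, h k (ω i) * h k (ω i')) * (∑ k ∈ s, h k (ω i) * h k (ω i'))
        = ∑ k ∈ s, ∑ k' ∈ s, (h k (ω i) * h k' (ω i)) * (h k (ω i') * h k' (ω i')) := fun ω => by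
    rw [Finset.sum_mul_sum]
    exact Finset.sum_congr rfl fun k _ => Finset.sum_congr rfl fun k' _ => by ring
  simp only [hre]
  have hp : ∀ k k', BddMeas fun x => h k x * h k' x := fun k k' => (hh k).mul (hh k')
  have hb : ∀ k k', BddMeas fun ω : Fin n → X =>
      (h k (ω i) * h k' (ω i)) * (h k (ω i') * h k' (ω i')) := fun k k' =>
    ((hp k k').eval i).mul ((hp k k').eval i')
  rw [integral_finsetSum _ fun k _ => (BddMeas.sum fun k' _ => hb k k').integrable _]
  refine Finset.sum_congr rfl fun k _ => ?_
  rw [integral_finsetSum _ fun k' _ => (hb k k').integrable _]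
  refine Finset.sum_congr rfl fun k' _ => ?_
  rw [integral_pi_eval_mul_eval ν (hp k k').1 (hp k k').1 hne, pow_two]

/-- Second moment of a completely degenerate U-statistic of order two with a finite-rank kernel. -/
theorem integral_sq_sum_kernel (hh : ∀ k, BddMeas (h k)) (h0 : ∀ k, ∫ x, h k x ∂ν = 0) :
    ∫ ω, (∑ p ∈ (Finset.univ : Finset (Fin n)).offDiag, ∑ k ∈ s, h k (ω p.1) * h k (ω p.2)) ^ 2
      ∂(Measure.pi fun _ : Fin n => ν)
      = n * (n - 1) * (2 * ∑ k ∈ s, ∑ k' ∈ s, (∫ x, h k x * h k' x ∂ν) ^ 2) := by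
  simp only [pow_two (∑ p ∈ (Finset.univ : Finset (Fin n)).offDiag, _),
    Finset.sum_mul_sum _ _ (fun p : Fin n × Fin n => _) (fun p : Fin n × Fin n => _)]
  have hH : ∀ p : Fin n × Fin n, BddMeas fun ω : Fin n → X =>
      ∑ k ∈ s, h k (ω p.1) * h k (ω p.2) := fun p =>
    BddMeas.sum fun k _ => ((hh k).eval p.1).mul ((hh k).eval p.2)
  rw [integral_finsetSum _ fun p _ => (BddMeas.sum fun q _ => (hH p).mul (hH q)).integrable _]
  rw [Finset.sum_congr rfl (g := fun _ =>
    2 * ∑ k ∈ s, ∑ k' ∈ s, (∫ x, h k x * h k' x ∂ν) ^ 2)]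
  · rw [Finset.sum_const, Finset.offDiag_card, nsmul_eq_mul, Nat.cast_sub (Nat.le_mul_self _)]
    simp only [Finset.card_univ, Fintype.card_fin]
    push_cast
    ring
  intro p hp
  obtain ⟨i, i'⟩ := p
  have hne : i ≠ i' := by simpa using hp
  rw [integral_finsetSum _ fun q _ => ((hH _).mul (hH q)).integrable _]
  have hsub : ({(i, i'), (i', i)} : Finset (Fin n × Fin n)) ⊆ Finset.univ.offDiag := by
    intro q hq
    simp only [Finset.mem_insert, Finset.mem_singleton] at hq
    rcases hq with rfl | rfl <;> simp [hne, hne.symm]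
  rw [← Finset.sum_subset hsub, Finset.sum_pair (by simp [hne])]
  · rw [integral_sq_kernel ν s hh hne]
    have hsw : ∀ ω : Fin n → X, ∑ k ∈ s, h k (ω i') * h k (ω i) = ∑ k ∈ s, h k (ω i) * h k (ω i') :=
      fun ω => Finset.sum_congr rfl fun k _ => mul_comm _ _
    simp only [hsw]
    rw [integral_sq_kernel ν s hh hne, two_mul]
  · rintro ⟨l, l'⟩ hq hnot
    have hll : l ≠ l' := by simpa using hq
    by_cases hi : i ≠ l ∧ i ≠ l'
    · exact integral_kernel_mul_kernel_eq_zero ν s hh h0 hne hi.1 hi.2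
    · have hi' : i' ≠ l ∧ i' ≠ l' := by
        simp only [Finset.mem_insert, Finset.mem_singleton, Prod.mk.injEq] at hnot
        grind
      have hsw : ∀ ω : Fin n → X,
          ∑ k ∈ s, h k (ω i) * h k (ω i') = ∑ k ∈ s, h k (ω i') * h k (ω i) :=
        fun ω => Finset.sum_congr rfl fun k _ => mul_comm _ _
      simp only [hsw]
      exact integral_kernel_mul_kernel_eq_zero ν s hh h0 hne.symm hi'.1 hi'.2

/-- The squared Frobenius norm of a covariance matrix is at most its operator norm times its
trace. -/
theorem sum_sq_integral_mul_le (hh : ∀ k, BddMeas (h k)) {C : ℝ} (hC : 0 < C)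
    (hbessel : ∀ t : K → ℝ, ∫ x, (∑ k ∈ s, t k * h k x) ^ 2 ∂ν ≤ C * ∑ k ∈ s, t k ^ 2) :
    ∑ k ∈ s, ∑ k' ∈ s, (∫ x, h k x * h k' x ∂ν) ^ 2 ≤ C * ∑ k ∈ s, ∫ x, h k x ^ 2 ∂ν := by
  rw [Finset.mul_sum]
  refine Finset.sum_le_sum fun k _ => ?_
  set t : K → ℝ := fun k' => ∫ x, h k x * h k' x ∂ν with ht
  set S : ℝ := ∑ k' ∈ s, t k' ^ 2 with hS
  have hG : BddMeas fun x => ∑ k' ∈ s, t k' * h k' x :=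
    BddMeas.sum fun k' _ => (hh k').const_mul _
  have hSG : S = ∫ x, h k x * ∑ k' ∈ s, t k' * h k' x ∂ν := by
    simp only [Finset.mul_sum]
    rw [integral_finsetSum _ fun k' _ =>
      ((hh k).mul ((hh k').const_mul (t k'))).integrable _]
    refine Finset.sum_congr rfl fun k' _ => ?_
    rw [pow_two]
    nth_rewrite 2 [ht]
    simp only
    rw [← integral_const_mul]
    exact integral_congr_ae (ae_of_all _ fun x => by ring)
  have hyoung : 2 * C * S ≤ C ^ 2 * ∫ x, h k x ^ 2 ∂ν + ∫ x, (∑ k' ∈ s, t k' * h k' x) ^ 2 ∂ν := by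
    rw [hSG, ← integral_const_mul, ← integral_const_mul, ← integral_add
      (((hh k).sq.const_mul _).integrable _) (hG.sq.integrable _)]
    refine integral_mono ((((hh k).mul hG).const_mul _).integrable _)
      ((((hh k).sq.const_mul _).add hG.sq).integrable _) fun x => ?_
    simp only
    nlinarith [sq_nonneg (C * h k x - ∑ k' ∈ s, t k' * h k' x)]
  have hCS : C * S ≤ C * (C * ∫ x, h k x ^ 2 ∂ν) := by
    have := hbessel t
    nlinarith
  exact le_of_mul_le_mul_left hCS hC

theorem integral_sub_integral_sq_le {f : X → ℝ} (hf : BddMeas f) :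
    ∫ x, (f x - ∫ y, f y ∂ν) ^ 2 ∂ν ≤ ∫ x, f x ^ 2 ∂ν := by
  rw [← ProbabilityTheory.variance_eq_integral hf.1.aemeasurable]
  exact ProbabilityTheory.variance_le_expectation_sq hf.1.aestronglyMeasurable

theorem sum_offDiag_eq_sum_filter (F : Fin n → Fin n → ℝ) :
    ∑ p ∈ (Finset.univ : Finset (Fin n)).offDiag, F p.1 p.2
      = ∑ i, ∑ l ∈ Finset.univ.filter (· ≠ i), F i l := by
  rw [Finset.sum_sigma']
  refine Finset.sum_nbij' (fun p => ⟨p.1, p.2⟩) (fun p => (p.1, p.2)) ?_ ?_ ?_ ?_ ?_ <;>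
    simp +contextual [eq_comm]

theorem sum_filter_ne_add_mul_add (y : Fin n → ℝ) (θ : ℝ) :
    ∑ i, ∑ l ∈ Finset.univ.filter (· ≠ i), (y i + θ) * (y l + θ)
      = ∑ i, ∑ l ∈ Finset.univ.filter (· ≠ i), y i * y l + 2 * (n - 1) * θ * ∑ i, y i
        + n * (n - 1) * θ ^ 2 := by
  have hoff : ∀ z : Fin n → ℝ, ∑ i, ∑ l ∈ Finset.univ.filter (· ≠ i), z i * z l
      = (∑ i, z i) ^ 2 - ∑ i, z i ^ 2 := fun z => by
    rw [pow_two, Finset.sum_mul_sum, ← Finset.sum_sub_distrib]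
    refine Finset.sum_congr rfl fun i _ => ?_
    rw [Finset.filter_ne', ← Finset.add_sum_erase _ _ (Finset.mem_univ i)]
    ring
  rw [hoff, hoff]
  simp only [add_sq, Finset.sum_add_distrib, ← Finset.sum_mul, ← Finset.mul_sum, Finset.sum_const,
    Finset.card_univ, Fintype.card_fin, nsmul_eq_mul]
  ring

/-- Mean and variance of the U-statistic estimating `∑ k, (∫ e k - a k) ^ 2`. -/
theorem uStatistic_mean_variance {e : K → X → ℝ} (he : ∀ k, BddMeas (e k)) (a : K → ℝ)
    {B C : ℝ} (hC : 0 < C)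
    (hbessel : ∀ t : K → ℝ, ∫ x, (∑ k ∈ s, t k * e k x) ^ 2 ∂ν ≤ C * ∑ k ∈ s, t k ^ 2)
    (hB : ∀ x, ∑ k ∈ s, e k x ^ 2 ≤ B) (hn : 2 ≤ n) {T : ℝ}
    (hT : T = ∑ k ∈ s, (∫ x, e k x ∂ν - a k) ^ 2) {That : (Fin n → X) → ℝ}
    (hThat : ∀ ω, That ω = ∑ k ∈ s, ((n : ℝ) * ((n : ℝ) - 1))⁻¹ *
      ∑ i, ∑ l ∈ Finset.univ.filter (· ≠ i), (e k (ω i) - a k) * (e k (ω l) - a k)) :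
    ∫ ω, That ω ∂(Measure.pi fun _ : Fin n => ν) = T ∧
      ProbabilityTheory.variance That (Measure.pi fun _ : Fin n => ν)
        ≤ 4 * ((n : ℝ) * (n - 1))⁻¹ * (C * B) + 8 * (n : ℝ)⁻¹ * (C * T) := by
  have hn2 : (2 : ℝ) ≤ n := by exact_mod_cast hn
  have hn0 : (n : ℝ) ≠ 0 := by linarith
  have hn1 : (n : ℝ) - 1 ≠ 0 := by linarith
  set w : ℝ := ((n : ℝ) * ((n : ℝ) - 1))⁻¹ with hw
  have hw0 : 0 ≤ w := inv_nonneg.2 (by nlinarith)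
  let m : K → ℝ := fun k => ∫ x, e k x ∂ν
  let h : K → X → ℝ := fun k x => e k x - m k
  have hh : ∀ k, BddMeas (h k) := fun k => (he k).sub_const _
  have h0 : ∀ k, ∫ x, h k x ∂ν = 0 := fun k => by
    simp [h, m, integral_sub ((he k).integrable ν) (integrable_const _)]
  let D : X → ℝ := fun x => ∑ k ∈ s, (m k - a k) * h k x
  have hD : BddMeas D := BddMeas.sum fun k _ => (hh k).const_mul _
  have hD0 : ∫ x, D x ∂ν = 0 := by
    simp only [D]
    rw [integral_finsetSum _ fun k _ => ((hh k).const_mul _).integrable _]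
    simp [integral_const_mul, h0]
  let A : (Fin n → X) → ℝ := fun ω =>
    ∑ p ∈ (Finset.univ : Finset (Fin n)).offDiag, ∑ k ∈ s, h k (ω p.1) * h k (ω p.2)
  let S : (Fin n → X) → ℝ := fun ω => ∑ i, D (ω i)
  have hA : BddMeas A := BddMeas.sum fun p _ => BddMeas.sum fun k _ =>
    ((hh k).eval p.1).mul ((hh k).eval p.2)
  have hS : BddMeas S := BddMeas.sum fun i _ => hD.eval i
  have hdec : ∀ ω, That ω = w * A ω + 2 * (n : ℝ)⁻¹ * S ω + T := fun ω => by
    have hA' : A ω = ∑ k ∈ s, ∑ i, ∑ l ∈ Finset.univ.filter (· ≠ i), h k (ω i) * h k (ω l) := by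
      simp only [A]
      rw [Finset.sum_comm]
      exact Finset.sum_congr rfl fun k _ =>
        sum_offDiag_eq_sum_filter fun i l => h k (ω i) * h k (ω l)
    have hS' : S ω = ∑ k ∈ s, (m k - a k) * ∑ i, h k (ω i) := by
      simp only [S, D]
      rw [Finset.sum_comm]
      simp only [Finset.mul_sum]
    rw [hThat, hA', hS', hT, Finset.mul_sum, Finset.mul_sum, ← Finset.sum_add_distrib,
      ← Finset.sum_add_distrib]
    refine Finset.sum_congr rfl fun k _ => ?_
    have hexp := sum_filter_ne_add_mul_add (fun i => h k (ω i)) (m k - a k)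
    simp only [h, sub_add_sub_cancel] at hexp
    rw [hexp]
    simp only [h, m, hw]
    field_simp
  have hEA : ∫ ω, A ω ∂(Measure.pi fun _ : Fin n => ν) = 0 := by
    simp only [A]
    rw [integral_finsetSum _ fun p _ => (BddMeas.sum fun k _ =>
      ((hh k).eval p.1).mul ((hh k).eval p.2)).integrable _]
    refine Finset.sum_eq_zero fun p hp => ?_
    rw [integral_finsetSum _ fun k _ => (((hh k).eval p.1).mul ((hh k).eval p.2)).integrable _]
    refine Finset.sum_eq_zero fun k _ => ?_
    rw [integral_pi_eval_mul_eval ν (hh k).1 (hh k).1 (by simpa using hp), h0, zero_mul]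
  have hES : ∫ ω, S ω ∂(Measure.pi fun _ : Fin n => ν) = 0 := by
    simp only [S]
    rw [integral_finsetSum _ fun i _ => (hD.eval i).integrable _]
    simp [integral_pi_eval ν hD.1, hD0]
  have hmean : ∫ ω, That ω ∂(Measure.pi fun _ : Fin n => ν) = T := by
    simp only [hdec]
    rw [integral_add (((hA.const_mul _).add (hS.const_mul _)).integrable _) (integrable_const _),
      integral_add ((hA.const_mul _).integrable _) ((hS.const_mul _).integrable _),
      integral_const_mul, integral_const_mul, hEA, hES]
    simp
  refine ⟨hmean, ?_⟩
  have hbesselh : ∀ t : K → ℝ, ∫ x, (∑ k ∈ s, t k * h k x) ^ 2 ∂ν ≤ C * ∑ k ∈ s, t k ^ 2 :=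
    fun t => by
    have hf : BddMeas fun x => ∑ k ∈ s, t k * e k x := BddMeas.sum fun k _ => (he k).const_mul _
    have hcen : ∀ x, ∑ k ∈ s, t k * h k x
        = ∑ k ∈ s, t k * e k x - ∫ y, ∑ k ∈ s, t k * e k y ∂ν := fun x => by
      rw [integral_finsetSum _ fun k _ => ((he k).const_mul _).integrable _,
        ← Finset.sum_sub_distrib]
      simp only [integral_const_mul, h, m, mul_sub]
    simp only [hcen]
    exact (integral_sub_integral_sq_le ν hf).trans (hbessel t)
  have htrace : ∑ k ∈ s, ∫ x, h k x ^ 2 ∂ν ≤ B := by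
    calc ∑ k ∈ s, ∫ x, h k x ^ 2 ∂ν ≤ ∑ k ∈ s, ∫ x, e k x ^ 2 ∂ν :=
          Finset.sum_le_sum fun k _ => integral_sub_integral_sq_le ν (he k)
      _ = ∫ x, ∑ k ∈ s, e k x ^ 2 ∂ν :=
          (integral_finsetSum _ fun k _ => (he k).sq.integrable _).symm
      _ ≤ ∫ _, B ∂ν := integral_mono ((BddMeas.sum fun k _ => (he k).sq).integrable _)
          (integrable_const _) hB
      _ = B := by simp
  have hA2 : ∫ ω, A ω ^ 2 ∂(Measure.pi fun _ : Fin n => ν) ≤ n * (n - 1) * (2 * (C * B)) := by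
    simp only [A]
    rw [integral_sq_sum_kernel ν s hh h0]
    have hfrob := (sum_sq_integral_mul_le ν s hh hC hbesselh).trans
      (mul_le_mul_of_nonneg_left htrace hC.le)
    have : (0 : ℝ) ≤ n * (n - 1) := by nlinarith
    gcongr
  have hS2 : ∫ ω, S ω ^ 2 ∂(Measure.pi fun _ : Fin n => ν) ≤ n * (C * T) := by
    simp only [S]
    rw [integral_sq_sum_eval ν hD hD0, hT]
    exact mul_le_mul_of_nonneg_left (hbesselh _) (by linarith)
  have hThat' : That = fun ω => w * A ω + 2 * (n : ℝ)⁻¹ * S ω + T := funext hdec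
  have hmeas : Measurable That := by
    rw [hThat']
    exact ((hA.1.const_mul _).add (hS.1.const_mul _)).add_const _
  rw [ProbabilityTheory.variance_eq_integral hmeas.aemeasurable, hmean]
  calc ∫ ω, (That ω - T) ^ 2 ∂(Measure.pi fun _ : Fin n => ν)
      ≤ ∫ ω, (2 * w ^ 2 * A ω ^ 2 + 8 * (n : ℝ)⁻¹ ^ 2 * S ω ^ 2)
          ∂(Measure.pi fun _ : Fin n => ν) := by
        simp only [hdec, add_sub_cancel_right]
        refine integral_mono (((hA.const_mul _).add (hS.const_mul _)).sq.integrable _)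
          (((hA.sq.const_mul _).add (hS.sq.const_mul _)).integrable _) fun ω => ?_
        simp only
        nlinarith [sq_nonneg (w * A ω - 2 * (n : ℝ)⁻¹ * S ω)]
    _ = 2 * w ^ 2 * ∫ ω, A ω ^ 2 ∂(Measure.pi fun _ : Fin n => ν)
          + 8 * (n : ℝ)⁻¹ ^ 2 * ∫ ω, S ω ^ 2 ∂(Measure.pi fun _ : Fin n => ν) := by
        rw [integral_add ((hA.sq.const_mul _).integrable _) ((hS.sq.const_mul _).integrable _),
          integral_const_mul, integral_const_mul]
    _ ≤ 2 * w ^ 2 * (n * (n - 1) * (2 * (C * B))) + 8 * (n : ℝ)⁻¹ ^ 2 * (n * (C * T)) := by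
        gcongr
    _ = 4 * w * (C * B) + 8 * (n : ℝ)⁻¹ * (C * T) := by
        simp only [hw]
        field_simp
        ring

end Product

/-- A real number has at most `L + 1` integer translates in `[0, L]`. -/
theorem exists_card_le_of_sub_mem_Icc {L : ℝ} (hL : 0 < L) (t : ℝ) :
    ∃ S : Finset ℤ, (S.card : ℝ) ≤ L + 1 ∧ ∀ k : ℤ, t - k ∈ Set.Icc 0 L → k ∈ S := by
  refine ⟨Finset.Icc ⌈t - L⌉ ⌊t⌋, ?_, fun k hk => ?_⟩
  · rw [Int.card_Icc]
    have hmono : ⌈t - L⌉ ≤ ⌊t⌋ + 1 :=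
      Int.ceil_le.2 (by push_cast; linarith [Int.lt_floor_add_one t])
    have hcast : (((⌊t⌋ + 1 - ⌈t - L⌉).toNat : ℤ) : ℝ) = ((⌊t⌋ + 1 - ⌈t - L⌉ : ℤ) : ℝ) := by
      rw [Int.toNat_of_nonneg (by linarith)]
    rw [Int.cast_natCast] at hcast
    rw [hcast]
    push_cast
    linarith [Int.floor_le t, Int.le_ceil (t - L)]
  · exact Finset.mem_Icc.2 ⟨Int.ceil_le.2 (by linarith [hk.2]), Int.le_floor.2 (by linarith [hk.1])⟩

theorem phiJK_bddMeas {φ : ℝ → ℝ} (hφ : BddMeas φ) (j : ℕ) (k : ℤ × ℤ) : BddMeas (phiJK φ j k) :=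
  ((hφ.comp (u := fun z : ℝ × ℝ => 2 ^ j * z.1 - k.1) (by fun_prop)).const_mul _).mul
    (hφ.comp (u := fun z : ℝ × ℝ => 2 ^ j * z.2 - k.2) (by fun_prop))

theorem sum_sq_phiJK_le {φ : ℝ → ℝ} {L C : ℝ} (hL : 0 < L) (hφ : ∀ t, |φ t| ≤ C)
    (hsupp : ∀ t ∉ Set.Icc (0 : ℝ) L, φ t = 0) (j : ℕ) (s : Finset (ℤ × ℤ)) (z : ℝ × ℝ) :
    ∑ k ∈ s, phiJK φ j k z ^ 2 ≤ ((2 : ℝ) ^ j) ^ 2 * (C ^ 4 * (L + 1) ^ 2) := by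
  obtain ⟨S₁, hS₁, hmem₁⟩ := exists_card_le_of_sub_mem_Icc hL (2 ^ j * z.1)
  obtain ⟨S₂, hS₂, hmem₂⟩ := exists_card_le_of_sub_mem_Icc hL (2 ^ j * z.2)
  have hsq : ∀ t, φ t ^ 2 ≤ C ^ 2 := fun t => sq_le_sq' (abs_le.1 (hφ t)).1 (abs_le.1 (hφ t)).2
  have hterm : ∀ k, phiJK φ j k z ^ 2 ≤ ((2 : ℝ) ^ j) ^ 2 * C ^ 4 := fun k => by
    have hprod := mul_le_mul (hsq (2 ^ j * z.1 - k.1)) (hsq (2 ^ j * z.2 - k.2)) (sq_nonneg _)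
      (sq_nonneg C)
    calc phiJK φ j k z ^ 2
        = ((2 : ℝ) ^ j) ^ 2 * (φ (2 ^ j * z.1 - k.1) ^ 2 * φ (2 ^ j * z.2 - k.2) ^ 2) := by
          simp only [phiJK]
          ring
      _ ≤ ((2 : ℝ) ^ j) ^ 2 * (C ^ 2 * C ^ 2) := by gcongr
      _ = _ := by ring
  have hzero : ∀ k ∉ S₁ ×ˢ S₂, phiJK φ j k z = 0 := fun k hk => by
    by_contra hne
    refine hk (Finset.mem_product.2 ⟨hmem₁ _ ?_, hmem₂ _ ?_⟩) <;> by_contra hnot <;>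
      exact hne (by simp [phiJK, hsupp _ hnot])
  calc ∑ k ∈ s, phiJK φ j k z ^ 2 ≤ ∑ k ∈ S₁ ×ˢ S₂, phiJK φ j k z ^ 2 := by
        rw [← Finset.sum_subset (Finset.inter_subset_left (s₂ := S₁ ×ˢ S₂)) fun k hk hnot => by
          rw [hzero k fun hmem => hnot (Finset.mem_inter.2 ⟨hk, hmem⟩), zero_pow two_ne_zero]]
        exact Finset.sum_le_sum_of_subset_of_nonneg Finset.inter_subset_right
          fun k _ _ => sq_nonneg _
    _ ≤ (S₁ ×ˢ S₂).card • (((2 : ℝ) ^ j) ^ 2 * C ^ 4) :=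
        Finset.sum_le_card_nsmul _ _ _ fun k _ => hterm k
    _ = (S₁.card * S₂.card) * (((2 : ℝ) ^ j) ^ 2 * C ^ 4) := by
        rw [nsmul_eq_mul, Finset.card_product, Nat.cast_mul]
    _ ≤ ((L + 1) * (L + 1)) * (((2 : ℝ) ^ j) ^ 2 * C ^ 4) := by gcongr
    _ = _ := by ring

theorem integral_withDensity_unitSq {c : ℝ × ℝ → ℝ} (hc : Measurable c) (hc0 : ∀ z, 0 ≤ c z)
    (hcs : ∀ z ∉ unitSq, c z = 0) (f : ℝ × ℝ → ℝ) :
    ∫ z, f z ∂(volume.withDensity fun z => ENNReal.ofReal (c z)) = ∫ z in unitSq, f z * c z := by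
  rw [integral_withDensity_eq_integral_toReal_smul hc.ennreal_ofReal
    (ae_of_all _ fun _ => ENNReal.ofReal_lt_top),
    setIntegral_eq_integral_of_forall_compl_eq_zero fun z hz => by rw [hcs z hz, mul_zero]]
  simp [ENNReal.toReal_ofReal (hc0 _), mul_comm]

theorem integral_sq_sum_of_orthonormal {X K : Type*} [DecidableEq K] [MeasurableSpace X]
    (μ : Measure X) [IsFiniteMeasure μ] (s : Finset K) {e : K → X → ℝ} (he : ∀ k, BddMeas (e k))
    (horth : ∀ k ∈ s, ∀ k' ∈ s, ∫ x, e k x * e k' x ∂μ = if k = k' then 1 else 0) (t : K → ℝ) :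
    ∫ x, (∑ k ∈ s, t k * e k x) ^ 2 ∂μ = ∑ k ∈ s, t k ^ 2 := by
  simp only [pow_two, Finset.sum_mul_sum]
  have hb : ∀ k k', BddMeas fun x => t k * e k x * (t k' * e k' x) := fun k k' =>
    ((he k).const_mul _).mul ((he k').const_mul _)
  rw [integral_finsetSum _ fun k _ => (BddMeas.sum fun k' _ => hb k k').integrable _]
  refine Finset.sum_congr rfl fun k hk => ?_
  rw [integral_finsetSum _ fun k' _ => (hb k k').integrable _]
  have hterm : ∀ k' ∈ s, ∫ x, t k * e k x * (t k' * e k' x) ∂μ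
      = if k = k' then t k * t k' else 0 := fun k' hk' => by
    rw [integral_congr_ae (ae_of_all _ fun x => mul_mul_mul_comm (t k) (e k x) (t k') (e k' x)),
      integral_const_mul, horth k hk k' hk', mul_ite, mul_one, mul_zero]
  rw [Finset.sum_congr rfl hterm]
  simp [hk]

/-- **Lemma 1, direct-observation part.**
For i.i.d. `(U_i,V_i)` with bounded density `c` on `[0,1]²` and a bounded `c_λ ∈ L²`,
the U-statistic `T̂_j(λ)` is an unbiased estimator of `T_j(λ) = Σ_k(c_{j,k}−c_{j,k}(λ))²`
and its variance is at most `κ((2^j/n)² + (2^j/n)T_j(λ))`, with `κ` depending only on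
`‖φ‖_∞`, `L`, `‖c‖_∞` and `‖c_λ‖_∞`. -/
theorem lemma1_direct_part
    (L Cφ Cc Ccl : ℝ) (hL : 0 < L) (hCφ : 0 < Cφ) (hCc : 0 < Cc) (hCcl : 0 < Ccl) :
    ∃ κ : ℝ, 0 < κ ∧
      ∀ (φ : ℝ → ℝ) (j : ℕ) (Kf : Finset (ℤ × ℤ)) (c cl : ℝ × ℝ → ℝ)
        (n : ℕ) (ν : Measure (ℝ × ℝ)) (cjk cjkl : ℤ × ℤ → ℝ) (Tj : ℝ)
        (That : (Fin n → ℝ × ℝ) → ℝ),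
        2 ≤ n →
        Measurable φ → (∀ t, |φ t| ≤ Cφ) → (∀ t ∉ Set.Icc (0 : ℝ) L, φ t = 0) →
        (∀ k ∉ Kf, ∀ z ∈ unitSq, phiJK φ j k z = 0) →
        (∀ k ∈ Kf, ∀ k' ∈ Kf,
          (∫ z in unitSq, phiJK φ j k z * phiJK φ j k' z) = if k = k' then 1 else 0) →
        Measurable c → (∀ z, 0 ≤ c z) → (∀ z, c z ≤ Cc) → (∀ z ∉ unitSq, c z = 0) →
        Measurable cl → (∀ z, |cl z| ≤ Ccl) →
        ν = volume.withDensity (fun z => ENNReal.ofReal (c z)) →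
        IsProbabilityMeasure ν →
        (∀ k, cjk k = ∫ z in unitSq, phiJK φ j k z * c z) →
        (∀ k, cjkl k = ∫ z in unitSq, phiJK φ j k z * cl z) →
        Tj = ∑ k ∈ Kf, (cjk k - cjkl k) ^ 2 →
        (∀ ω, That ω = ∑ k ∈ Kf, ((n : ℝ) * ((n : ℝ) - 1))⁻¹ *
          ∑ i₁ : Fin n, ∑ i₂ ∈ Finset.univ.filter (· ≠ i₁),
            (phiJK φ j k (ω i₁) - cjkl k) * (phiJK φ j k (ω i₂) - cjkl k)) →
        (∫ ω, That ω ∂(Measure.pi fun _ : Fin n => ν)) = Tj ∧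
        ProbabilityTheory.variance That (Measure.pi fun _ : Fin n => ν) ≤
          κ * (((2 : ℝ) ^ j / (n : ℝ)) ^ 2 + ((2 : ℝ) ^ j / (n : ℝ)) * Tj) := by
  refine ⟨8 * Cc * (Cφ ^ 4 * (L + 1) ^ 2) + 8 * Cc, by positivity, ?_⟩
  intro φ j Kf c cl n ν cjk cjkl Tj That hn hφm hφb hφs _ horth hcm hc0 hcC hcs _ _ hν hprob
    hcjk _ hTj hThat
  have he : ∀ k, BddMeas (phiJK φ j k) := phiJK_bddMeas ⟨hφm, Cφ, hφb⟩ j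
  have hint : ∀ f : ℝ × ℝ → ℝ, ∫ z, f z ∂ν = ∫ z in unitSq, f z * c z := fun f => by
    rw [hν, integral_withDensity_unitSq hcm hc0 hcs f]
  have hcb : BddMeas c := ⟨hcm, Cc, fun z => by rw [abs_of_nonneg (hc0 z)]; exact hcC z⟩
  have : IsFiniteMeasure ((volume : Measure (ℝ × ℝ)).restrict unitSq) :=
    isFiniteMeasure_restrict.2 (isCompact_Icc.prod isCompact_Icc).measure_lt_top.ne
  have hbessel : ∀ t : ℤ × ℤ → ℝ,
      ∫ z, (∑ k ∈ Kf, t k * phiJK φ j k z) ^ 2 ∂ν ≤ Cc * ∑ k ∈ Kf, t k ^ 2 := fun t => by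
    have hf : BddMeas fun z => ∑ k ∈ Kf, t k * phiJK φ j k z :=
      BddMeas.sum fun k _ => (he k).const_mul _
    rw [hint, ← integral_sq_sum_of_orthonormal (volume.restrict unitSq) Kf he horth t,
      ← integral_const_mul]
    refine integral_mono ((hf.sq.mul hcb).integrable _) ((hf.sq.const_mul _).integrable _)
      fun z => ?_
    simp only
    rw [mul_comm Cc]
    exact mul_le_mul_of_nonneg_left (hcC z) (sq_nonneg _)
  have hT : Tj = ∑ k ∈ Kf, (∫ z, phiJK φ j k z ∂ν - cjkl k) ^ 2 := by
    simp only [hTj, hcjk, hint]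
  obtain ⟨hmean, hvar⟩ := uStatistic_mean_variance ν Kf he cjkl hCc hbessel
    (sum_sq_phiJK_le hL hφb hφs j Kf) hn hT hThat
  refine ⟨hmean, hvar.trans ?_⟩
  have hn2 : (2 : ℝ) ≤ n := by exact_mod_cast hn
  have hT0 : 0 ≤ Tj := hTj ▸ Finset.sum_nonneg fun k _ => sq_nonneg _
  have hinv : ((n : ℝ) * (n - 1))⁻¹ ≤ 2 * (n : ℝ)⁻¹ ^ 2 := by
    rw [inv_pow, ← div_eq_mul_inv, inv_eq_one_div, div_le_div_iff₀ (by nlinarith) (by positivity)]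
    nlinarith
  have h2j : (1 : ℝ) ≤ 2 ^ j := one_le_pow₀ (by norm_num)
  calc 4 * ((n : ℝ) * (n - 1))⁻¹ * (Cc * ((2 ^ j) ^ 2 * (Cφ ^ 4 * (L + 1) ^ 2)))
        + 8 * (n : ℝ)⁻¹ * (Cc * Tj)
      ≤ 4 * (2 * (n : ℝ)⁻¹ ^ 2) * (Cc * ((2 ^ j) ^ 2 * (Cφ ^ 4 * (L + 1) ^ 2)))
        + 8 * (n : ℝ)⁻¹ * (Cc * (2 ^ j * Tj)) := by
        gcongr
        exact le_mul_of_one_le_left hT0 h2j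
    _ = 8 * Cc * (Cφ ^ 4 * (L + 1) ^ 2) * (2 ^ j / n) ^ 2 + 8 * Cc * (2 ^ j / n * Tj) := by
        ring
    _ ≤ (8 * Cc * (Cφ ^ 4 * (L + 1) ^ 2) + 8 * Cc) * (2 ^ j / n) ^ 2
        + (8 * Cc * (Cφ ^ 4 * (L + 1) ^ 2) + 8 * Cc) * (2 ^ j / n * Tj) := by
        gcongr
        · linarith
        · have : 0 ≤ 8 * Cc * (Cφ ^ 4 * (L + 1) ^ 2) := by positivity
          linarith
    _ = _ := by ring
end
end

section
/- (Lemma 5, moment bounds for the pseudo-observation remainders.) Assume φ is q times continuously differentiable and let j be a level with 2^{j} ≤ min((n₂/log n₂)^{1/2}, (n₁/log n₁)^{1/2−1/(2q)}). For i ∈ I₂ define ξ_k(X_i,Y_i) = φ_{j,k}(F̂(X_i),Ĝ(Y_i)) − φ_{j,k}(F(X_i),G(Y_i)), and for distinct i₁, i₂ ∈ I₂ set A_{i₁} = ξ_k(X_{i₁},Y_{i₁}) (k fixed), B_{i₁,i₂} = Σ_k ξ_k(X_{i₁},Y_{i₁}) ξ_k(X_{i₂},Y_{i₂}), C_{i₁,i₂}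 = ξ_k(X_{i₁},Y_{i₁}) ξ_p(X_{i₂},Y_{i₂}) (k, p fixed), and D_{i₁} = Σ_{k,p} ( E[ ξ_k(X_{i₁},Y_{i₁}) ξ_p(X_{i₁},Y_{i₁}) ] )². Then there exists a constant κ > 0, depending only on φ, its derivatives, L and ‖c‖_∞, such that E|A_{i₁}| ≤ κ (log(n₁)/n₁)^{1/2}, E|B_{i₁,i₂}| ≤ κ 2^{2j} (log(n₁)/n₁), E|C_{i₁,i₂}| ≤ κ (log(n₁)/n₁), and D_{i₁} ≤ κ 2^{6j} (log(n₁)/n₁)². -/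
open MeasureTheory

noncomputable section

/-- Marginal cdf of the first coordinate of a measure on `ℝ²`. -/
def margF (μ : Measure (ℝ × ℝ)) (x : ℝ) : ℝ := (μ (Set.Iic x ×ˢ (Set.univ : Set ℝ))).toReal

/-- Marginal cdf of the second coordinate of a measure on `ℝ²`. -/
def margG (μ : Measure (ℝ × ℝ)) (y : ℝ) : ℝ := (μ ((Set.univ : Set ℝ) ×ˢ Set.Iic y)).toReal

/-- Empirical cdf of the first coordinates of a sample of size `n₁`. -/
def empF (n₁ : ℕ) (ω : Fin n₁ → ℝ × ℝ) (x : ℝ) : ℝ :=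
  (n₁ : ℝ)⁻¹ * ∑ i : Fin n₁, if (ω i).1 ≤ x then (1 : ℝ) else 0

/-- Empirical cdf of the second coordinates of a sample of size `n₁`. -/
def empG (n₁ : ℕ) (ω : Fin n₁ → ℝ × ℝ) (y : ℝ) : ℝ :=
  (n₁ : ℝ)⁻¹ * ∑ i : Fin n₁, if (ω i).2 ≤ y then (1 : ℝ) else 0

/-- The measure `μ` on `ℝ²` has copula density `c`: the image of `μ` under
`(x,y) ↦ (F(x),G(y))` (with `F`, `G` the marginal cdfs of `μ`) has density `c` with
respect to Lebesgue measure. -/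
def HasCopulaDensity (μ : Measure (ℝ × ℝ)) (c : ℝ × ℝ → ℝ) : Prop :=
  Measure.map (fun z : ℝ × ℝ => (margF μ z.1, margG μ z.2)) μ =
    volume.withDensity fun z => ENNReal.ofReal (c z)

/-- The pseudo-observation remainder
`ξ_k(X_i,Y_i) = φ_{j,k}(F̂(X_i),Ĝ(Y_i)) − φ_{j,k}(F(X_i),G(Y_i))`, as a function of the
two-sample outcome `ω`; the empirical cdfs are computed from the first subsample. -/
def xiK (φ : ℝ → ℝ) (j : ℕ) (k : ℤ × ℤ) (F G : ℝ → ℝ) {n₁ n₂ : ℕ}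
    (ω : (Fin n₁ → ℝ × ℝ) × (Fin n₂ → ℝ × ℝ)) (i : Fin n₂) : ℝ :=
  phiJK φ j k (empF n₁ ω.1 (ω.2 i).1, empG n₁ ω.1 (ω.2 i).2) -
    phiJK φ j k (F (ω.2 i).1, G (ω.2 i).2)

section MomentBounds

variable {Ω ι K : Type*} [MeasurableSpace Ω] {P : Measure Ω}

/-- A product of two remainders, each bounded by `s a` off the exceptional event and by `r w`
everywhere, is bounded by `s² a a` up to a contribution of the exceptional events. -/
lemma abs_mul_le_of_exceptional {x y a₁ a₂ w₁ w₂ b₁ b₂ s r : ℝ}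
    (hb₁ : b₁ = 0 ∨ b₁ = 1) (hb₂ : b₂ = 0 ∨ b₂ = 1) (hs : 0 ≤ s) (hr : 0 ≤ r)
    (ha₁ : 0 ≤ a₁) (ha₂ : 0 ≤ a₂) (hw₁ : 0 ≤ w₁) (hw₂ : 0 ≤ w₂)
    (hx : b₁ = 0 → |x| ≤ s * a₁) (hy : b₂ = 0 → |y| ≤ s * a₂)
    (hx' : |x| ≤ r * w₁) (hy' : |y| ≤ r * w₂) :
    |x * y| ≤ s ^ 2 * (a₁ * a₂) + r ^ 2 * ((b₁ + b₂) * (w₁ * w₂)) := by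
  rw [abs_mul]
  have h1 : 0 ≤ s ^ 2 * (a₁ * a₂) := by positivity
  have h2 : 0 ≤ r ^ 2 * (w₁ * w₂) := by positivity
  have h3 : |x| * |y| ≤ (r * w₁) * (r * w₂) :=
    mul_le_mul hx' hy' (abs_nonneg _) (by positivity)
  rcases hb₁ with hb₁ | hb₁ <;> rcases hb₂ with hb₂ | hb₂
  · have h4 : |x| * |y| ≤ (s * a₁) * (s * a₂) :=
      mul_le_mul (hx hb₁) (hy hb₂) (abs_nonneg _) (by positivity)
    rw [hb₁, hb₂]; linarith
  all_goals rw [hb₁, hb₂]; linarith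

lemma integrable_of_nonneg_of_le [IsFiniteMeasure P] {g : Ω → ℝ} (hg : Measurable g)
    (h0 : ∀ ω, 0 ≤ g ω) {C : ℝ}
    (h1 : ∀ ω, g ω ≤ C) : Integrable g P :=
  Integrable.of_bound hg.aestronglyMeasurable C
    (ae_of_all _ fun ω => by rw [Real.norm_eq_abs, abs_of_nonneg (h0 ω)]; exact h1 ω)

/-- A family of remainders `ξ i k`, of size at most `s a i k` outside an exceptional event with
indicator `b i`, and of size at most `r w i k` everywhere. -/
structure RemainderBounds (P : Measure Ω) (ξ a w : ι → K → Ω → ℝ) (b : ι → Ω → ℝ)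
    (s r h N β : ℝ) : Prop where
  s_nonneg : 0 ≤ s
  r_nonneg : 0 ≤ r
  h_nonneg : 0 ≤ h
  N_nonneg : 0 ≤ N
  b_meas : ∀ i, Measurable (b i)
  a_meas : ∀ i k, Measurable (a i k)
  w_meas : ∀ i k, Measurable (w i k)
  b_zero_or_one : ∀ i ω, b i ω = 0 ∨ b i ω = 1
  a_nonneg : ∀ i k ω, 0 ≤ a i k ω
  a_le : ∀ i k ω, a i k ω ≤ 1
  w_nonneg : ∀ i k ω, 0 ≤ w i k ω
  w_le : ∀ i k ω, w i k ω ≤ 2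
  abs_le_a : ∀ i k ω, b i ω = 0 → |ξ i k ω| ≤ s * a i k ω
  abs_le_w : ∀ i k ω, |ξ i k ω| ≤ r * w i k ω
  sum_a_le : ∀ (S : Finset K) i ω, ∑ k ∈ S, a i k ω ≤ N
  sum_w_le : ∀ (S : Finset K) i ω, ∑ k ∈ S, w i k ω ≤ 2 * N
  integral_a_le : ∀ i k, ∫ ω, a i k ω ∂P ≤ h
  integral_b_le : ∀ i, ∫ ω, b i ω ∂P ≤ β
  integral_mul_a : ∀ i i', i ≠ i' → ∀ k p,
    ∫ ω, a i k ω * a i' p ω ∂P = (∫ ω, a i k ω ∂P) * ∫ ω, a i' p ω ∂P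

namespace RemainderBounds

variable {ξ a w : ι → K → Ω → ℝ} {b : ι → Ω → ℝ} {s r h N β : ℝ}

lemma b_nonneg (H : RemainderBounds P ξ a w b s r h N β) (i : ι) (ω : Ω) : 0 ≤ b i ω := by
  rcases H.b_zero_or_one i ω with h | h <;> simp [h]

lemma b_le (H : RemainderBounds P ξ a w b s r h N β) (i : ι) (ω : Ω) : b i ω ≤ 1 := by
  rcases H.b_zero_or_one i ω with h | h <;> simp [h]

lemma integrable_a [IsProbabilityMeasure P]
    (H : RemainderBounds P ξ a w b s r h N β) (i : ι) (k : K) :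
    Integrable (a i k) P :=
  integrable_of_nonneg_of_le (H.a_meas i k) (H.a_nonneg i k) (H.a_le i k)

lemma integrable_b [IsProbabilityMeasure P]
    (H : RemainderBounds P ξ a w b s r h N β) (i : ι) : Integrable (b i) P :=
  integrable_of_nonneg_of_le (H.b_meas i) (H.b_nonneg i) (H.b_le i)

lemma integrable_mul_a [IsProbabilityMeasure P]
    (H : RemainderBounds P ξ a w b s r h N β) (i i' : ι) (k p : K) :
    Integrable (fun ω => a i k ω * a i' p ω) P :=
  integrable_of_nonneg_of_le ((H.a_meas i k).mul (H.a_meas i' p))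
    (fun ω => mul_nonneg (H.a_nonneg i k ω) (H.a_nonneg i' p ω)) (C := 1)
    (fun ω => mul_le_one₀ (H.a_le i k ω) (H.a_nonneg i' p ω) (H.a_le i' p ω))

lemma integrable_exceptional [IsProbabilityMeasure P]
    (H : RemainderBounds P ξ a w b s r h N β) (i i' : ι) (k p : K) :
    Integrable (fun ω => (b i ω + b i' ω) * (w i k ω * w i' p ω)) P := by
  refine integrable_of_nonneg_of_le (((H.b_meas i).add (H.b_meas i')).mul
    ((H.w_meas i k).mul (H.w_meas i' p))) (C := (1 + 1) * (2 * 2)) (fun ω => ?_) (fun ω => ?_)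
  · have := H.b_nonneg i ω
    have := H.b_nonneg i' ω
    have := H.w_nonneg i k ω
    have := H.w_nonneg i' p ω
    positivity
  · have := H.b_nonneg i ω
    have := H.b_nonneg i' ω
    have := H.w_nonneg i k ω
    have := H.w_nonneg i' p ω
    have := H.w_le i k ω
    have := H.w_le i' p ω
    have := H.b_le i ω
    have := H.b_le i' ω
    gcongr

lemma abs_mul_le (H : RemainderBounds P ξ a w b s r h N β) (i i' : ι) (k p : K) (ω : Ω) :
    |ξ i k ω * ξ i' p ω| ≤
      s ^ 2 * (a i k ω * a i' p ω) + r ^ 2 * ((b i ω + b i' ω) * (w i k ω * w i' p ω)) :=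
  abs_mul_le_of_exceptional (H.b_zero_or_one i ω) (H.b_zero_or_one i' ω) H.s_nonneg H.r_nonneg
    (H.a_nonneg i k ω) (H.a_nonneg i' p ω) (H.w_nonneg i k ω) (H.w_nonneg i' p ω)
    (H.abs_le_a i k ω) (H.abs_le_a i' p ω) (H.abs_le_w i k ω) (H.abs_le_w i' p ω)

lemma integral_abs_le [IsProbabilityMeasure P]
    (H : RemainderBounds P ξ a w b s r h N β) (i : ι) (k : K) :
    ∫ ω, |ξ i k ω| ∂P ≤ s * h + 2 * r * β := by
  have hs := H.s_nonneg
  have hr := H.r_nonneg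
  calc ∫ ω, |ξ i k ω| ∂P ≤ ∫ ω, (s * a i k ω + 2 * r * b i ω) ∂P := by
        refine integral_mono_of_nonneg (ae_of_all _ fun _ => abs_nonneg _)
          (((H.integrable_a i k).const_mul s).add ((H.integrable_b i).const_mul (2 * r)))
          (ae_of_all _ fun ω => ?_)
        have h1 := mul_nonneg hs (H.a_nonneg i k ω)
        have h2 := mul_le_mul_of_nonneg_left (H.w_le i k ω) hr
        have h3 := H.abs_le_w i k ω
        have h4 := H.abs_le_a i k ω
        dsimp only
        rcases H.b_zero_or_one i ω with hb | hb
        · rw [hb]; linarith [h4 hb]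
        · rw [hb]; linarith
    _ = s * ∫ ω, a i k ω ∂P + 2 * r * ∫ ω, b i ω ∂P := by
        rw [integral_add ((H.integrable_a i k).const_mul s)
          ((H.integrable_b i).const_mul (2 * r)), integral_const_mul, integral_const_mul]
    _ ≤ s * h + 2 * r * β := by
        have := H.integral_a_le i k
        have := H.integral_b_le i
        gcongr

lemma integral_abs_mul_le_add [IsProbabilityMeasure P]
    (H : RemainderBounds P ξ a w b s r h N β) (i i' : ι) (k p : K) :
    ∫ ω, |ξ i k ω * ξ i' p ω| ∂P ≤ s ^ 2 * ∫ ω, a i k ω * a i' p ω ∂P +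
      r ^ 2 * ∫ ω, (b i ω + b i' ω) * (w i k ω * w i' p ω) ∂P := by
  rw [← integral_const_mul, ← integral_const_mul,
    ← integral_add ((H.integrable_mul_a i i' k p).const_mul _)
      ((H.integrable_exceptional i i' k p).const_mul _)]
  exact integral_mono_of_nonneg (ae_of_all _ fun _ => abs_nonneg _)
    (((H.integrable_mul_a i i' k p).const_mul _).add
      ((H.integrable_exceptional i i' k p).const_mul _))
    (ae_of_all _ (H.abs_mul_le i i' k p))

lemma integral_a_nonneg (H : RemainderBounds P ξ a w b s r h N β) (i : ι) (k : K) :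
    0 ≤ ∫ ω, a i k ω ∂P := integral_nonneg (H.a_nonneg i k)

lemma integral_add_b_le [IsProbabilityMeasure P]
    (H : RemainderBounds P ξ a w b s r h N β) (i i' : ι) :
    ∫ ω, (b i ω + b i' ω) ∂P ≤ 2 * β := by
  rw [integral_add (H.integrable_b i) (H.integrable_b i')]
  linarith [H.integral_b_le i, H.integral_b_le i']

lemma integral_abs_mul_le [IsProbabilityMeasure P]
    (H : RemainderBounds P ξ a w b s r h N β) {i i' : ι} (hi : i ≠ i')
    (k p : K) : ∫ ω, |ξ i k ω * ξ i' p ω| ∂P ≤ s ^ 2 * h ^ 2 + 8 * r ^ 2 * β := by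
  refine (H.integral_abs_mul_le_add i i' k p).trans ?_
  have h1 : ∫ ω, a i k ω * a i' p ω ∂P ≤ h ^ 2 := by
    rw [H.integral_mul_a i i' hi, sq]
    exact mul_le_mul (H.integral_a_le i k) (H.integral_a_le i' p) (H.integral_a_nonneg i' p)
      H.h_nonneg
  have h2 : ∫ ω, (b i ω + b i' ω) * (w i k ω * w i' p ω) ∂P ≤ 4 * (2 * β) := by
    refine le_trans ?_ (mul_le_mul_of_nonneg_left (H.integral_add_b_le i i') (by norm_num))
    rw [← integral_const_mul]
    refine integral_mono (H.integrable_exceptional i i' k p)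
      (((H.integrable_b i).add (H.integrable_b i')).const_mul _) fun ω => ?_
    have := H.b_nonneg i ω
    have := H.b_nonneg i' ω
    have h3 : w i k ω * w i' p ω ≤ 2 * 2 :=
      mul_le_mul (H.w_le i k ω) (H.w_le i' p ω) (H.w_nonneg i' p ω) (by norm_num)
    dsimp only
    nlinarith
  nlinarith [sq_nonneg s, sq_nonneg r]

lemma sum_integral_a_le [IsProbabilityMeasure P]
    (H : RemainderBounds P ξ a w b s r h N β) (S : Finset K) (i : ι) :
    ∑ k ∈ S, ∫ ω, a i k ω ∂P ≤ N := by
  rw [← integral_finsetSum _ fun k _ => H.integrable_a i k]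
  calc ∫ ω, ∑ k ∈ S, a i k ω ∂P ≤ ∫ _, N ∂P :=
        integral_mono (integrable_finsetSum _ fun k _ => H.integrable_a i k)
          (integrable_const _) (H.sum_a_le S i)
    _ = N := by simp

lemma integral_abs_sum_mul_le [IsProbabilityMeasure P]
    (H : RemainderBounds P ξ a w b s r h N β) {i i' : ι} (hi : i ≠ i')
    (S : Finset K) :
    ∫ ω, |∑ k ∈ S, ξ i k ω * ξ i' k ω| ∂P ≤ s ^ 2 * (h * N) + 8 * N * r ^ 2 * β := by
  have hN := H.N_nonneg
  have hprodInt : ∀ k, Integrable (fun ω => s ^ 2 * (a i k ω * a i' k ω)) P :=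
    fun k => (H.integrable_mul_a i i' k k).const_mul _
  have hexcInt : Integrable (fun ω => 4 * N * r ^ 2 * (b i ω + b i' ω)) P :=
    ((H.integrable_b i).add (H.integrable_b i')).const_mul _
  have hpt : ∀ ω, |∑ k ∈ S, ξ i k ω * ξ i' k ω| ≤
      ∑ k ∈ S, s ^ 2 * (a i k ω * a i' k ω) + 4 * N * r ^ 2 * (b i ω + b i' ω) := by
    intro ω
    refine (Finset.abs_sum_le_sum_abs _ _).trans ?_
    refine (Finset.sum_le_sum fun k _ => H.abs_mul_le i i' k k ω).trans ?_
    rw [Finset.sum_add_distrib]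
    gcongr
    rw [← Finset.mul_sum, ← Finset.mul_sum]
    have h1 : ∑ k ∈ S, w i k ω * w i' k ω ≤ 2 * (2 * N) := by
      refine le_trans ?_ (mul_le_mul_of_nonneg_left (H.sum_w_le S i' ω) (by norm_num))
      rw [Finset.mul_sum]
      exact Finset.sum_le_sum fun k _ =>
        mul_le_mul_of_nonneg_right (H.w_le i k ω) (H.w_nonneg i' k ω)
    have h2 := mul_le_mul_of_nonneg_left h1
      (mul_nonneg (sq_nonneg r) (add_nonneg (H.b_nonneg i ω) (H.b_nonneg i' ω)))
    linarith
  calc ∫ ω, |∑ k ∈ S, ξ i k ω * ξ i' k ω| ∂P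
      ≤ ∫ ω, (∑ k ∈ S, s ^ 2 * (a i k ω * a i' k ω) + 4 * N * r ^ 2 * (b i ω + b i' ω)) ∂P :=
        integral_mono_of_nonneg (ae_of_all _ fun _ => abs_nonneg _)
          ((integrable_finsetSum _ fun k _ => hprodInt k).add hexcInt) (ae_of_all _ hpt)
    _ = s ^ 2 * (∑ k ∈ S, (∫ ω, a i k ω ∂P) * ∫ ω, a i' k ω ∂P) +
          4 * N * r ^ 2 * ∫ ω, (b i ω + b i' ω) ∂P := by
        rw [integral_add (integrable_finsetSum _ fun k _ => hprodInt k) hexcInt,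
          integral_finsetSum _ fun k _ => hprodInt k, integral_const_mul, Finset.mul_sum]
        simp_rw [integral_const_mul, H.integral_mul_a i i' hi]
    _ ≤ s ^ 2 * (h * N) + 4 * N * r ^ 2 * (2 * β) := by
        have h1 : ∑ k ∈ S, (∫ ω, a i k ω ∂P) * ∫ ω, a i' k ω ∂P ≤ h * N := by
          refine le_trans ?_ (mul_le_mul_of_nonneg_left (H.sum_integral_a_le S i') H.h_nonneg)
          rw [Finset.mul_sum]
          exact Finset.sum_le_sum fun k _ =>
            mul_le_mul_of_nonneg_right (H.integral_a_le i k) (H.integral_a_nonneg i' k)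
        have h2 := H.integral_add_b_le i i'
        gcongr
    _ = _ := by ring

lemma sum_sq_integral_mul_le [IsProbabilityMeasure P]
    (H : RemainderBounds P ξ a w b s r h N β) (i : ι) (S : Finset K) :
    ∑ k ∈ S, ∑ p ∈ S, (∫ ω, ξ i k ω * ξ i p ω ∂P) ^ 2 ≤
      2 * s ^ 4 * (h * N ^ 2) + 128 * r ^ 4 * N ^ 4 * β ^ 2 := by
  have hN := H.N_nonneg
  set x : K → K → ℝ := fun k p => ∫ ω, a i k ω * a i p ω ∂P with hx
  set y : K → K → ℝ := fun k p => ∫ ω, (b i ω + b i ω) * (w i k ω * w i p ω) ∂P with hy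
  have hx0 : ∀ k p, 0 ≤ x k p := fun k p =>
    integral_nonneg fun ω => mul_nonneg (H.a_nonneg i k ω) (H.a_nonneg i p ω)
  have hy0 : ∀ k p, 0 ≤ y k p := fun k p =>
    integral_nonneg fun ω => mul_nonneg (add_nonneg (H.b_nonneg i ω) (H.b_nonneg i ω))
      (mul_nonneg (H.w_nonneg i k ω) (H.w_nonneg i p ω))
  have hxh : ∀ k p, x k p ≤ h := fun k p =>
    (integral_mono (H.integrable_mul_a i i k p) (H.integrable_a i k) fun ω =>
      mul_le_of_le_one_right (H.a_nonneg i k ω) (H.a_le i p ω)).trans (H.integral_a_le i k)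
  have hterm : ∀ k p, (∫ ω, ξ i k ω * ξ i p ω ∂P) ^ 2 ≤
      2 * s ^ 4 * (h * x k p) + 2 * r ^ 4 * (y k p) ^ 2 := by
    intro k p
    have h1 : |∫ ω, ξ i k ω * ξ i p ω ∂P| ≤ s ^ 2 * x k p + r ^ 2 * y k p :=
      abs_integral_le_integral_abs.trans (H.integral_abs_mul_le_add i i k p)
    have h2 : (∫ ω, ξ i k ω * ξ i p ω ∂P) ^ 2 ≤ (s ^ 2 * x k p + r ^ 2 * y k p) ^ 2 := by
      rw [← sq_abs (∫ ω, ξ i k ω * ξ i p ω ∂P)]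
      exact pow_le_pow_left₀ (abs_nonneg _) h1 2
    have h3 : s ^ 4 * (x k p * x k p) ≤ s ^ 4 * (h * x k p) := by
      have := hx0 k p
      have := hxh k p
      gcongr
    nlinarith [sq_nonneg (s ^ 2 * x k p - r ^ 2 * y k p)]
  have hsumx : ∑ k ∈ S, ∑ p ∈ S, x k p ≤ N ^ 2 := by
    have h1 : ∑ k ∈ S, ∑ p ∈ S, x k p = ∫ ω, (∑ k ∈ S, a i k ω) * ∑ p ∈ S, a i p ω ∂P := by
      simp_rw [Finset.sum_mul_sum]
      rw [integral_finsetSum _ fun k _ => integrable_finsetSum _ fun p _ =>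
        H.integrable_mul_a i i k p]
      exact Finset.sum_congr rfl fun k _ =>
        (integral_finsetSum _ fun p _ => H.integrable_mul_a i i k p).symm
    rw [h1]
    calc ∫ ω, (∑ k ∈ S, a i k ω) * ∑ p ∈ S, a i p ω ∂P ≤ ∫ _, N ^ 2 ∂P := by
          refine integral_mono_of_nonneg (ae_of_all _ fun ω => ?_) (integrable_const _)
            (ae_of_all _ fun ω => ?_)
          · exact mul_self_nonneg _
          · dsimp only
            rw [sq]
            exact mul_le_mul (H.sum_a_le S i ω) (H.sum_a_le S i ω)
              (Finset.sum_nonneg fun k _ => H.a_nonneg i k ω) hN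
      _ = N ^ 2 := by simp
  have hsumy : ∑ k ∈ S, ∑ p ∈ S, y k p ≤ 8 * N ^ 2 * β := by
    have h1 : ∑ k ∈ S, ∑ p ∈ S, y k p =
        ∫ ω, (b i ω + b i ω) * ((∑ k ∈ S, w i k ω) * ∑ p ∈ S, w i p ω) ∂P := by
      simp_rw [Finset.sum_mul_sum, Finset.mul_sum]
      rw [integral_finsetSum _ fun k _ => integrable_finsetSum _ fun p _ =>
        H.integrable_exceptional i i k p]
      exact Finset.sum_congr rfl fun k _ =>
        (integral_finsetSum _ fun p _ => H.integrable_exceptional i i k p).symm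
    rw [h1]
    calc ∫ ω, (b i ω + b i ω) * ((∑ k ∈ S, w i k ω) * ∑ p ∈ S, w i p ω) ∂P
        ≤ ∫ ω, (4 * N ^ 2) * (b i ω + b i ω) ∂P := by
          refine integral_mono_of_nonneg (ae_of_all _ fun ω => ?_)
            (((H.integrable_b i).add (H.integrable_b i)).const_mul _) (ae_of_all _ fun ω => ?_)
          · exact mul_nonneg (add_nonneg (H.b_nonneg i ω) (H.b_nonneg i ω)) (mul_self_nonneg _)
          · have h2 : (∑ k ∈ S, w i k ω) * ∑ p ∈ S, w i p ω ≤ (2 * N) * (2 * N) :=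
              mul_le_mul (H.sum_w_le S i ω) (H.sum_w_le S i ω)
                (Finset.sum_nonneg fun k _ => H.w_nonneg i k ω) (by positivity)
            have h3 := mul_le_mul_of_nonneg_left h2
              (add_nonneg (H.b_nonneg i ω) (H.b_nonneg i ω))
            dsimp only
            linarith
      _ ≤ (4 * N ^ 2) * (2 * β) := by
          rw [integral_const_mul]
          have := H.integral_add_b_le i i
          gcongr
      _ = _ := by ring
  have hsumy2 : ∑ k ∈ S, ∑ p ∈ S, (y k p) ^ 2 ≤ (8 * N ^ 2 * β) ^ 2 := by
    rw [← Finset.sum_product'] at hsumy ⊢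
    refine le_trans (Finset.sum_sq_le_sq_sum_of_nonneg fun q _ => hy0 q.1 q.2) ?_
    exact pow_le_pow_left₀ (Finset.sum_nonneg fun q _ => hy0 q.1 q.2) hsumy 2
  calc ∑ k ∈ S, ∑ p ∈ S, (∫ ω, ξ i k ω * ξ i p ω ∂P) ^ 2
      ≤ ∑ k ∈ S, ∑ p ∈ S, (2 * s ^ 4 * (h * x k p) + 2 * r ^ 4 * (y k p) ^ 2) :=
        Finset.sum_le_sum fun k _ => Finset.sum_le_sum fun p _ => hterm k p
    _ = 2 * s ^ 4 * (h * ∑ k ∈ S, ∑ p ∈ S, x k p) +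
          2 * r ^ 4 * ∑ k ∈ S, ∑ p ∈ S, (y k p) ^ 2 := by
        simp only [Finset.sum_add_distrib, Finset.mul_sum]
    _ ≤ 2 * s ^ 4 * (h * N ^ 2) + 2 * r ^ 4 * (8 * N ^ 2 * β) ^ 2 := by
        have := H.h_nonneg
        gcongr
    _ = _ := by ring

end RemainderBounds

end MomentBounds

/-- The set on which `φ_{j,k}` can be non-zero when `φ` is supported in `[0, L]`, enlarged
by `2` on each side at scale `2^j`. -/
def cell (L : ℝ) (j : ℕ) (k : ℤ × ℤ) : Set (ℝ × ℝ) :=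
  {z | 2 ^ j * z.1 - k.1 ∈ Set.Icc (-2) (L + 2) ∧ 2 ^ j * z.2 - k.2 ∈ Set.Icc (-2) (L + 2)}

/-- The indicator function of `cell L j k`. -/
def cellInd (L : ℝ) (j : ℕ) (k : ℤ × ℤ) (z : ℝ × ℝ) : ℝ := (cell L j k).indicator 1 z

lemma measurableSet_cell (L : ℝ) (j : ℕ) (k : ℤ × ℤ) : MeasurableSet (cell L j k) :=
  MeasurableSet.inter
    (measurableSet_Icc.preimage (((measurable_fst.const_mul _).sub_const _)))
    (measurableSet_Icc.preimage (((measurable_snd.const_mul _).sub_const _)))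

lemma measurable_cellInd (L : ℝ) (j : ℕ) (k : ℤ × ℤ) : Measurable (cellInd L j k) :=
  measurable_one.indicator (measurableSet_cell L j k)

lemma cellInd_nonneg (L : ℝ) (j : ℕ) (k : ℤ × ℤ) (z : ℝ × ℝ) : 0 ≤ cellInd L j k z :=
  Set.indicator_nonneg (fun _ _ => zero_le_one) z

lemma cellInd_le_one (L : ℝ) (j : ℕ) (k : ℤ × ℤ) (z : ℝ × ℝ) : cellInd L j k z ≤ 1 :=
  Set.indicator_le_self' (fun _ _ => zero_le_one) z

lemma card_Icc_ceil_floor_le {L : ℝ} (hL : 0 < L) (x : ℝ) :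
    ((Finset.Icc ⌈x - (L + 2)⌉ ⌊x + 2⌋).card : ℝ) ≤ L + 5 := by
  rw [Int.card_Icc]
  have h1 := Int.floor_le (x + 2)
  have h2 := Int.le_ceil (x - (L + 2))
  rcases le_total 0 (⌊x + 2⌋ + 1 - ⌈x - (L + 2)⌉) with h | h
  · have h3 : (((⌊x + 2⌋ + 1 - ⌈x - (L + 2)⌉).toNat : ℤ) : ℝ)
        = ((⌊x + 2⌋ + 1 - ⌈x - (L + 2)⌉ : ℤ) : ℝ) := by rw [Int.toNat_of_nonneg h]
    rw [Int.cast_natCast] at h3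
    rw [h3]
    push_cast
    linarith
  · rw [Int.toNat_of_nonpos h]
    push_cast
    linarith

lemma sum_cellInd_le {L : ℝ} (hL : 0 < L) (j : ℕ) (S : Finset (ℤ × ℤ)) (z : ℝ × ℝ) :
    ∑ k ∈ S, cellInd L j k z ≤ (L + 5) ^ 2 := by
  classical
  have h1 : ∑ k ∈ S, cellInd L j k z = ((S.filter fun k => z ∈ cell L j k).card : ℝ) := by
    simp [cellInd, Set.indicator_apply]
  set I : ℝ → Finset ℤ := fun x => Finset.Icc ⌈x - (L + 2)⌉ ⌊x + 2⌋ with hI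
  have h2 : (S.filter fun k => z ∈ cell L j k) ⊆ I (2 ^ j * z.1) ×ˢ I (2 ^ j * z.2) := by
    intro k hk
    obtain ⟨⟨h11, h12⟩, h21, h22⟩ := (Finset.mem_filter.1 hk).2
    simp only [hI, Finset.mem_product, Finset.mem_Icc, Int.ceil_le, Int.le_floor]
    refine ⟨⟨?_, ?_⟩, ?_, ?_⟩ <;> linarith
  rw [h1]
  calc ((S.filter fun k => z ∈ cell L j k).card : ℝ)
      ≤ ((I (2 ^ j * z.1) ×ˢ I (2 ^ j * z.2)).card : ℝ) := by
        exact_mod_cast Finset.card_le_card h2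
    _ = ((I (2 ^ j * z.1)).card : ℝ) * ((I (2 ^ j * z.2)).card : ℝ) := by
        rw [Finset.card_product]; push_cast; rfl
    _ ≤ (L + 5) * (L + 5) := by
        have := card_Icc_ceil_floor_le hL (2 ^ j * z.1)
        have := card_Icc_ceil_floor_le hL (2 ^ j * z.2)
        gcongr
    _ = (L + 5) ^ 2 := by ring

lemma volume_cell {L : ℝ} (hL : 0 < L) (j : ℕ) (k : ℤ × ℤ) :
    volume (cell L j k) = ENNReal.ofReal ((L + 4) ^ 2 / (2 ^ j) ^ 2) := by
  have hT : (0 : ℝ) < 2 ^ j := by positivity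
  have h1 : cell L j k = Set.Icc ((-2 + k.1) / 2 ^ j : ℝ) ((L + 2 + k.1) / 2 ^ j) ×ˢ
      Set.Icc ((-2 + k.2) / 2 ^ j : ℝ) ((L + 2 + k.2) / 2 ^ j) := by
    ext z
    simp only [cell, Set.mem_ofPred_eq, Set.mem_prod, Set.mem_Icc, div_le_iff₀ hT, le_div_iff₀ hT]
    constructor
    · rintro ⟨⟨h1, h2⟩, h3, h4⟩
      refine ⟨⟨?_, ?_⟩, ?_, ?_⟩ <;> linarith
    · rintro ⟨⟨h1, h2⟩, h3, h4⟩
      refine ⟨⟨?_, ?_⟩, ?_, ?_⟩ <;> linarith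
  rw [h1, Measure.volume_eq_prod, Measure.prod_prod, Real.volume_Icc, Real.volume_Icc,
    ← ENNReal.ofReal_mul]
  · congr 1
    field_simp
    ring
  · rw [← sub_div]
    apply div_nonneg _ hT.le
    linarith

/-- `φ` is supported in `[0, L]`, bounded by `M` and `M`-Lipschitz. -/
structure IsBump (φ : ℝ → ℝ) (L M : ℝ) : Prop where
  M_nonneg : 0 ≤ M
  bound : ∀ t, |φ t| ≤ M
  lipschitz : ∀ s t, |φ s - φ t| ≤ M * |s - t|
  support : ∀ t ∉ Set.Icc (0 : ℝ) L, φ t = 0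

lemma exists_isBump {φ : ℝ → ℝ} {L : ℝ} {q : ℕ} (hq : 1 ≤ q)
    (hφbdd : ∃ Cφ : ℝ, ∀ t, |φ t| ≤ Cφ) (hφsupp : ∀ t ∉ Set.Icc (0 : ℝ) L, φ t = 0)
    (hφsmooth : ContDiff ℝ q φ) : ∃ M, IsBump φ L M := by
  obtain ⟨C, hC⟩ := hφbdd
  have hcs : HasCompactSupport φ := HasCompactSupport.intro isCompact_Icc fun t ht => hφsupp t ht
  obtain ⟨K, hK⟩ := hφsmooth.lipschitzWith_of_hasCompactSupport hcs
    (by exact_mod_cast (by lia : q ≠ 0))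
  refine ⟨max C K, le_max_of_le_right K.coe_nonneg, fun t => (hC t).trans (le_max_left _ _),
    fun s t => ?_, hφsupp⟩
  have h1 := hK.dist_le_mul s t
  rw [Real.dist_eq, Real.dist_eq] at h1
  exact h1.trans (mul_le_mul_of_nonneg_right (le_max_right _ _) (abs_nonneg _))

lemma abs_phiJK_le {φ : ℝ → ℝ} {L M : ℝ} (hφ : IsBump φ L M) (j : ℕ) (k : ℤ × ℤ) (z : ℝ × ℝ) :
    |phiJK φ j k z| ≤ M ^ 2 * 2 ^ j * cellInd L j k z := by
  have hM := hφ.M_nonneg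
  by_cases hz : z ∈ cell L j k
  · have h1 := hφ.bound (2 ^ j * z.1 - k.1)
    have h2 := hφ.bound (2 ^ j * z.2 - k.2)
    rw [cellInd, Set.indicator_of_mem hz, phiJK, abs_mul, abs_mul,
      abs_of_nonneg (by positivity : (0 : ℝ) ≤ 2 ^ j), Pi.one_apply]
    calc 2 ^ j * |φ (2 ^ j * z.1 - k.1)| * |φ (2 ^ j * z.2 - k.2)| ≤ 2 ^ j * M * M := by gcongr
      _ = _ := by ring
  · rw [cellInd, Set.indicator_of_notMem hz]
    have h0 : phiJK φ j k z = 0 := by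
      by_contra hne
      apply hz
      have h1 : 2 ^ j * z.1 - k.1 ∈ Set.Icc (0 : ℝ) L := by
        by_contra h
        exact hne (by simp [phiJK, hφ.support _ h])
      have h2 : 2 ^ j * z.2 - k.2 ∈ Set.Icc (0 : ℝ) L := by
        by_contra h
        exact hne (by simp [phiJK, hφ.support _ h])
      exact ⟨⟨by linarith [h1.1], by linarith [h1.2]⟩, ⟨by linarith [h2.1], by linarith [h2.2]⟩⟩
    simp [h0]

lemma abs_phiJK_sub_le {φ : ℝ → ℝ} {L M t : ℝ} (hφ : IsBump φ L M) (j : ℕ) (k : ℤ × ℤ)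
    {z z' : ℝ × ℝ} (h₁ : |z'.1 - z.1| ≤ t) (h₂ : |z'.2 - z.2| ≤ t) (ht : 2 ^ j * t ≤ 2) :
    |phiJK φ j k z' - phiJK φ j k z| ≤ 2 * M ^ 2 * (2 ^ j) ^ 2 * t * cellInd L j k z := by
  have hM := hφ.M_nonneg
  have hT : (0 : ℝ) < 2 ^ j := by positivity
  have hd : ∀ u u' : ℝ, ∀ m : ℤ, |u' - u| ≤ t →
      |(2 ^ j * u' - m) - (2 ^ j * u - m)| ≤ 2 ^ j * t := by
    intro u u' m hu
    rw [show (2 ^ j * u' - m) - (2 ^ j * u - m) = 2 ^ j * (u' - u) by ring, abs_mul,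
      abs_of_pos hT]
    gcongr
  have hd₁ := hd z.1 z'.1 k.1 h₁
  have hd₂ := hd z.2 z'.2 k.2 h₂
  set a := 2 ^ j * z.1 - k.1 with ha
  set b := 2 ^ j * z.2 - k.2 with hb
  set a' := 2 ^ j * z'.1 - k.1 with ha'
  set b' := 2 ^ j * z'.2 - k.2 with hb'
  by_cases hz : z ∈ cell L j k
  · rw [cellInd, Set.indicator_of_mem hz, Pi.one_apply]
    have e : phiJK φ j k z' - phiJK φ j k z =
        2 ^ j * ((φ a' - φ a) * φ b' + φ a * (φ b' - φ b)) := by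
      simp only [phiJK, ← ha, ← hb, ← ha', ← hb']; ring
    rw [e, abs_mul, abs_of_pos hT]
    have h3 : |φ a' - φ a| ≤ M * (2 ^ j * t) := (hφ.lipschitz a' a).trans (by gcongr)
    have h4 : |φ b' - φ b| ≤ M * (2 ^ j * t) := (hφ.lipschitz b' b).trans (by gcongr)
    have h5 := hφ.bound a
    have h6 := hφ.bound b'
    have ht0 : 0 ≤ t := (abs_nonneg _).trans h₁
    calc 2 ^ j * |(φ a' - φ a) * φ b' + φ a * (φ b' - φ b)|
        ≤ 2 ^ j * (|φ a' - φ a| * |φ b'| + |φ a| * |φ b' - φ b|) := by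
          rw [← abs_mul, ← abs_mul]
          gcongr
          exact abs_add_le _ _
      _ ≤ 2 ^ j * (M * (2 ^ j * t) * M + M * (M * (2 ^ j * t))) := by gcongr
      _ = _ := by ring
  · rw [cellInd, Set.indicator_of_notMem hz]
    have hout : ∀ x x' : ℝ, |x' - x| ≤ 2 ^ j * t → x ∉ Set.Icc (-2) (L + 2) →
        φ x = 0 ∧ φ x' = 0 := by
      intro x x' hx hn
      have h3 := abs_le.1 (hx.trans ht)
      refine ⟨hφ.support _ fun h => hn ⟨by linarith [h.1], by linarith [h.2]⟩,
        hφ.support _ fun h => hn ⟨by linarith [h.1], by linarith [h.2]⟩⟩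
    have h3 : a ∉ Set.Icc (-2) (L + 2) ∨ b ∉ Set.Icc (-2) (L + 2) := by
      by_contra hcon
      push Not at hcon
      exact hz hcon
    rcases h3 with h | h
    · obtain ⟨e1, e2⟩ := hout a a' hd₁ h
      simp [phiJK, ← ha, ← ha', e1, e2]
    · obtain ⟨e1, e2⟩ := hout b b' hd₂ h
      simp [phiJK, ← hb, ← hb', e1, e2]

lemma hoeffding_pi_le {Z : Type*} [MeasurableSpace Z] (μ : Measure Z) [IsProbabilityMeasure μ]
    {n : ℕ} (hn : 0 < n) {f : Z → ℝ} (hf : Measurable f) (hf01 : ∀ z, f z ∈ Set.Icc (0 : ℝ) 1)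
    {t : ℝ} (ht : 0 ≤ t) :
    (Measure.pi fun _ : Fin n => μ).real {ω | t ≤ (n : ℝ)⁻¹ * ∑ i, f (ω i) - ∫ z, f z ∂μ} ≤
      Real.exp (-2 * n * t ^ 2) := by
  have hn' : (0 : ℝ) < n := by exact_mod_cast hn
  have hind : ProbabilityTheory.iIndepFun (fun (i : Fin n) (ω : Fin n → Z) =>
      f (ω i) - ∫ z, f z ∂μ) (Measure.pi fun _ : Fin n => μ) :=
    ProbabilityTheory.iIndepFun_pi (X := fun _ z => f z - ∫ z, f z ∂μ)
      fun _ => (hf.sub_const _).aemeasurable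
  have hsub : ∀ i ∈ (Finset.univ : Finset (Fin n)), ProbabilityTheory.HasSubgaussianMGF
      (fun ω : Fin n → Z => f (ω i) - ∫ z, f z ∂μ) ((‖(1 : ℝ) - 0‖₊ / 2) ^ 2)
      (Measure.pi fun _ : Fin n => μ) := by
    intro i _
    have h1 := ProbabilityTheory.hasSubgaussianMGF_of_mem_Icc
      (μ := Measure.pi fun _ : Fin n => μ) (X := fun ω => f (ω i)) (a := 0) (b := 1)
      (hf.comp (measurable_pi_apply i)).aemeasurable (ae_of_all _ fun ω => hf01 (ω i))
    rwa [integral_comp_eval (μ := fun _ : Fin n => μ) (i := i) hf.aestronglyMeasurable] at h1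
  have h2 := ProbabilityTheory.HasSubgaussianMGF.measure_sum_ge_le_of_iIndepFun hind hsub
    (mul_nonneg hn'.le ht)
  have hset : {ω : Fin n → Z | t ≤ (n : ℝ)⁻¹ * ∑ i, f (ω i) - ∫ z, f z ∂μ} =
      {ω | n * t ≤ ∑ i, (f (ω i) - ∫ z, f z ∂μ)} := by
    ext ω
    simp only [Set.mem_ofPred_eq, Finset.sum_sub_distrib, Finset.sum_const, Finset.card_univ,
      Fintype.card_fin, nsmul_eq_mul]
    rw [← mul_le_mul_iff_right₀ hn', mul_sub, mul_inv_cancel_left₀ hn'.ne']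
  rw [hset]
  refine h2.trans (le_of_eq ?_)
  congr 1
  simp
  field_simp

lemma hoeffding_pi_abs {Z : Type*} [MeasurableSpace Z] (μ : Measure Z) [IsProbabilityMeasure μ]
    {n : ℕ} (hn : 0 < n) {f : Z → ℝ} (hf : Measurable f) (hf01 : ∀ z, f z ∈ Set.Icc (0 : ℝ) 1)
    {t : ℝ} (ht : 0 ≤ t) :
    (Measure.pi fun _ : Fin n => μ).real {ω | t < |(n : ℝ)⁻¹ * ∑ i, f (ω i) - ∫ z, f z ∂μ|} ≤
      2 * Real.exp (-2 * n * t ^ 2) := by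
  have hn' : (n : ℝ) ≠ 0 := by exact_mod_cast hn.ne'
  have hfint : Integrable f μ := Integrable.of_mem_Icc 0 1 hf.aemeasurable (ae_of_all _ hf01)
  have h1 := hoeffding_pi_le μ hn hf hf01 ht
  have h2 := hoeffding_pi_le μ hn (f := fun z => 1 - f z) (hf.const_sub 1)
    (fun z => ⟨by linarith [(hf01 z).2], by linarith [(hf01 z).1]⟩) ht
  have hsub : {ω : Fin n → Z | t < |(n : ℝ)⁻¹ * ∑ i, f (ω i) - ∫ z, f z ∂μ|} ⊆
      {ω | t ≤ (n : ℝ)⁻¹ * ∑ i, f (ω i) - ∫ z, f z ∂μ} ∪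
      {ω | t ≤ (n : ℝ)⁻¹ * ∑ i, (1 - f (ω i)) - ∫ z, (1 - f z) ∂μ} := by
    intro ω hω
    rcases lt_abs.1 hω.out with h | h
    · exact Or.inl h.le
    · refine Or.inr ?_
      rw [Set.mem_ofPred_eq, integral_sub (integrable_const _) hfint, Finset.sum_sub_distrib,
        mul_sub]
      simp only [Finset.sum_const, Finset.card_univ, Fintype.card_fin, nsmul_eq_mul, mul_one,
        inv_mul_cancel₀ hn', integral_const, probReal_univ, smul_eq_mul]
      linarith
  calc _ ≤ _ := measureReal_mono hsub
    _ ≤ _ := measureReal_union_le _ _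
    _ ≤ _ := by linarith

lemma integral_le_indicator (μ : Measure (ℝ × ℝ)) [IsProbabilityMeasure μ] {g : ℝ × ℝ → ℝ}
    (hg : Measurable g) (x : ℝ) :
    ∫ z, (if g z ≤ x then (1 : ℝ) else 0) ∂μ = (μ {z | g z ≤ x}).toReal := by
  have h1 := integral_indicator_one (μ := μ)
    (measurableSet_le hg measurable_const : MeasurableSet {z | g z ≤ x})
  rw [Measure.real] at h1
  rw [← h1]
  congr 1

lemma empirical_deviation_le (μ : Measure (ℝ × ℝ)) [IsProbabilityMeasure μ]
    {n : ℕ} (hn : 2 ≤ n) {g : ℝ × ℝ → ℝ} (hg : Measurable g) (x : ℝ) :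
    (Measure.pi fun _ : Fin n => μ).real
      {ω | 2 * Real.sqrt (Real.log n / n) <
        |(n : ℝ)⁻¹ * ∑ i, (if g (ω i) ≤ x then (1 : ℝ) else 0) - (μ {z | g z ≤ x}).toReal|} ≤
      2 * ((n : ℝ) ^ 8)⁻¹ := by
  have hn' : (0 : ℝ) < n := by exact_mod_cast (by lia : 0 < n)
  have hlog : 0 ≤ Real.log n := Real.log_natCast_nonneg n
  have h1 := hoeffding_pi_abs μ (by lia : 0 < n)
    (f := fun z => if g z ≤ x then (1 : ℝ) else 0)
    (Measurable.ite (measurableSet_le hg measurable_const) measurable_const measurable_const)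
    (fun z => by split_ifs <;> simp)
    (by positivity : 0 ≤ 2 * Real.sqrt (Real.log n / n))
  rw [integral_le_indicator μ hg] at h1
  refine h1.trans (le_of_eq ?_)
  rw [mul_pow, Real.sq_sqrt (by positivity),
    show -2 * (n : ℝ) * (2 ^ 2 * (Real.log n / n)) = -(8 * Real.log n) by field_simp; ring,
    Real.exp_neg, show (8 : ℝ) = (8 : ℕ) by norm_num, Real.exp_nat_mul, Real.exp_log hn']

lemma exceptional_measure_le (μ : Measure (ℝ × ℝ)) [IsProbabilityMeasure μ] {n₁ n₂ : ℕ}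
    (hn : 2 ≤ n₁) (i : Fin n₂) {g : ℝ × ℝ → ℝ} (hg : Measurable g) {Fg : ℝ → ℝ}
    (hFg : Measurable Fg) (hFg' : ∀ x, Fg x = (μ {z | g z ≤ x}).toReal) :
    ((Measure.pi fun _ : Fin n₁ => μ).prod (Measure.pi fun _ : Fin n₂ => μ)).real
      {ω | 2 * Real.sqrt (Real.log n₁ / n₁) <
        |(n₁ : ℝ)⁻¹ * ∑ l, (if g (ω.1 l) ≤ g (ω.2 i) then (1 : ℝ) else 0) - Fg (g (ω.2 i))|} ≤
      2 * ((n₁ : ℝ) ^ 8)⁻¹ := by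
  set D : Set ((Fin n₁ → ℝ × ℝ) × (Fin n₂ → ℝ × ℝ)) :=
    {ω | 2 * Real.sqrt (Real.log n₁ / n₁) <
      |(n₁ : ℝ)⁻¹ * ∑ l, (if g (ω.1 l) ≤ g (ω.2 i) then (1 : ℝ) else 0) - Fg (g (ω.2 i))|} with hD
  have hDm : MeasurableSet D := by
    refine measurableSet_lt measurable_const (Measurable.abs ?_)
    refine ((Finset.measurable_fun_sum _ fun l _ => ?_).const_mul _).sub (by fun_prop)
    exact Measurable.ite (measurableSet_le (by fun_prop) (by fun_prop))
      measurable_const measurable_const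
  refine ENNReal.toReal_le_of_le_ofReal (by positivity) ?_
  rw [Measure.prod_apply_symm hDm]
  calc _ ≤ ∫⁻ _, ENNReal.ofReal (2 * ((n₁ : ℝ) ^ 8)⁻¹) ∂(Measure.pi fun _ : Fin n₂ => μ) := by
        refine lintegral_mono fun y => ?_
        rw [← ofReal_measureReal]
        refine ENNReal.ofReal_le_ofReal ?_
        have h1 := empirical_deviation_le μ hn hg (g (y i))
        rw [← hFg'] at h1
        exact h1
    _ = _ := by simp

lemma setOf_fst_le (x : ℝ) : {z : ℝ × ℝ | z.1 ≤ x} = Set.Iic x ×ˢ Set.univ := by ext; simp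

lemma setOf_snd_le (x : ℝ) : {z : ℝ × ℝ | z.2 ≤ x} = Set.univ ×ˢ Set.Iic x := by ext; simp

/-- The probability integral transform `(x, y) ↦ (F(x), G(y))`. -/
def copulaMap (μ : Measure (ℝ × ℝ)) (z : ℝ × ℝ) : ℝ × ℝ := (margF μ z.1, margG μ z.2)

/-- The pseudo-observation `(F̂(X_i), Ĝ(Y_i))`. -/
def pseudoObs {n₁ n₂ : ℕ} (ω : (Fin n₁ → ℝ × ℝ) × (Fin n₂ → ℝ × ℝ)) (i : Fin n₂) : ℝ × ℝ :=
  (empF n₁ ω.1 (ω.2 i).1, empG n₁ ω.1 (ω.2 i).2)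

/-- The event that one of the two empirical cdfs is far from its target at observation `i`. -/
def farEvent (μ : Measure (ℝ × ℝ)) (t : ℝ) {n₁ n₂ : ℕ} (i : Fin n₂) :
    Set ((Fin n₁ → ℝ × ℝ) × (Fin n₂ → ℝ × ℝ)) :=
  {ω | t < |(pseudoObs ω i).1 - margF μ (ω.2 i).1|} ∪
    {ω | t < |(pseudoObs ω i).2 - margG μ (ω.2 i).2|}

lemma measurable_pseudoObs {n₁ n₂ : ℕ} (i : Fin n₂) :
    Measurable fun ω : (Fin n₁ → ℝ × ℝ) × (Fin n₂ → ℝ × ℝ) => pseudoObs ω i := by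
  refine Measurable.prodMk ?_ ?_
  all_goals
    refine (Finset.measurable_fun_sum _ fun l _ => ?_).const_mul _
    exact Measurable.ite (measurableSet_le (by fun_prop) (by fun_prop))
      measurable_const measurable_const

lemma measurableSet_farEvent {μ : Measure (ℝ × ℝ)} (hF : Measurable (margF μ))
    (hG : Measurable (margG μ)) (t : ℝ) {n₁ n₂ : ℕ} (i : Fin n₂) :
    MeasurableSet (farEvent μ t (n₁ := n₁) i) := by
  have h := measurable_pseudoObs (n₁ := n₁) i
  refine MeasurableSet.union ?_ ?_
  · exact measurableSet_lt measurable_const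
      ((measurable_fst.comp h).sub (by fun_prop)).abs
  · exact measurableSet_lt measurable_const
      ((measurable_snd.comp h).sub (by fun_prop)).abs

lemma farEvent_measure_le {μ : Measure (ℝ × ℝ)} [IsProbabilityMeasure μ]
    (hF : Measurable (margF μ)) (hG : Measurable (margG μ)) {n₁ n₂ : ℕ} (hn : 2 ≤ n₁)
    (i : Fin n₂) :
    ((Measure.pi fun _ : Fin n₁ => μ).prod (Measure.pi fun _ : Fin n₂ => μ)).real
      (farEvent μ (2 * Real.sqrt (Real.log n₁ / n₁)) i) ≤ 4 * ((n₁ : ℝ) ^ 8)⁻¹ := by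
  refine (measureReal_union_le _ _).trans ?_
  have h1 := exceptional_measure_le μ hn i measurable_fst hF
    fun x => by rw [setOf_fst_le, margF]
  have h2 := exceptional_measure_le μ hn i measurable_snd hG
    fun x => by rw [setOf_snd_le, margG]
  have h3 := add_le_add h1 h2
  refine h3.trans (le_of_eq ?_)
  ring

lemma integral_cellInd_le {μ : Measure (ℝ × ℝ)} [IsProbabilityMeasure μ]
    (hF : Measurable (margF μ)) (hG : Measurable (margG μ)) {c : ℝ × ℝ → ℝ} {C : ℝ}
    (hc : ∀ z, c z ≤ C) (hC : 0 ≤ C) (hμ : HasCopulaDensity μ c) {L : ℝ} (hL : 0 < L) (j : ℕ)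
    (k : ℤ × ℤ) :
    ∫ z, cellInd L j k (copulaMap μ z) ∂μ ≤ C * ((L + 4) ^ 2 / (2 ^ j) ^ 2) := by
  have hm : Measurable (copulaMap μ) := by unfold copulaMap; fun_prop
  have h1 : ∫ z, cellInd L j k (copulaMap μ z) ∂μ = (μ.map (copulaMap μ)).real (cell L j k) := by
    rw [← integral_map hm.aemeasurable (measurable_cellInd L j k).aestronglyMeasurable]
    exact integral_indicator_one (measurableSet_cell L j k)
  have h2 : μ.map (copulaMap μ) = volume.withDensity fun z => ENNReal.ofReal (c z) := hμ
  rw [h1, h2]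
  refine ENNReal.toReal_le_of_le_ofReal (by positivity) ?_
  rw [withDensity_apply _ (measurableSet_cell L j k), ENNReal.ofReal_mul hC, ← volume_cell hL,
    ← setLIntegral_const]
  exact lintegral_mono fun z => ENNReal.ofReal_le_ofReal (hc z)

lemma integral_prod_pi_eval {μ : Measure (ℝ × ℝ)} [IsProbabilityMeasure μ] {n₁ n₂ : ℕ}
    {f : ℝ × ℝ → ℝ} (hf : Measurable f) (i : Fin n₂) :
    ∫ ω, f (ω.2 i) ∂((Measure.pi fun _ : Fin n₁ => μ).prod (Measure.pi fun _ : Fin n₂ => μ)) =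
      ∫ z, f z ∂μ := by
  rw [integral_fun_snd fun y : Fin n₂ → ℝ × ℝ => f (y i),
    integral_comp_eval (μ := fun _ : Fin n₂ => μ) (i := i) hf.aestronglyMeasurable]
  simp

lemma integral_prod_pi_eval_mul {μ : Measure (ℝ × ℝ)} [IsProbabilityMeasure μ] {n₁ n₂ : ℕ}
    {f g : ℝ × ℝ → ℝ} (hf : Measurable f) (hg : Measurable g) {i i' : Fin n₂} (hi : i ≠ i') :
    ∫ ω, f (ω.2 i) * g (ω.2 i')
        ∂((Measure.pi fun _ : Fin n₁ => μ).prod (Measure.pi fun _ : Fin n₂ => μ)) =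
      (∫ z, f z ∂μ) * ∫ z, g z ∂μ := by
  have hind : ProbabilityTheory.iIndepFun (fun (i : Fin n₂) (y : Fin n₂ → ℝ × ℝ) => y i)
      (Measure.pi fun _ : Fin n₂ => μ) :=
    ProbabilityTheory.iIndepFun_pi (X := fun _ z => z) fun _ => aemeasurable_id
  have h1 := ((hind.indepFun hi).comp hf hg).integral_fun_mul_eq_mul_integral
    (hf.comp (measurable_pi_apply i)).aestronglyMeasurable
    (hg.comp (measurable_pi_apply i')).aestronglyMeasurable
  simp only [Function.comp_apply] at h1
  rw [integral_fun_snd fun y : Fin n₂ → ℝ × ℝ => f (y i) * g (y i'), h1,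
    ← integral_comp_eval (μ := fun _ : Fin n₂ => μ) (i := i) hf.aestronglyMeasurable,
    ← integral_comp_eval (μ := fun _ : Fin n₂ => μ) (i := i') hg.aestronglyMeasurable]
  simp

lemma xiK_remainderBounds {φ : ℝ → ℝ} {L M : ℝ} (hL : 0 < L) (hφ : IsBump φ L M)
    {μ : Measure (ℝ × ℝ)} [IsProbabilityMeasure μ]
    (hF : Measurable (margF μ)) (hG : Measurable (margG μ)) {c : ℝ × ℝ → ℝ} {C : ℝ}
    (hc : ∀ z, c z ≤ C) (hC : 0 ≤ C) (hμ : HasCopulaDensity μ c) {n₁ n₂ j : ℕ} (hn : 2 ≤ n₁)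
    (hj : (2 : ℝ) ^ j * Real.sqrt (Real.log n₁ / n₁) ≤ 1) :
    RemainderBounds ((Measure.pi fun _ : Fin n₁ => μ).prod (Measure.pi fun _ : Fin n₂ => μ))
      (fun i k ω => xiK φ j k (margF μ) (margG μ) ω i)
      (fun i k ω => cellInd L j k (copulaMap μ (ω.2 i)))
      (fun i k ω => cellInd L j k (copulaMap μ (ω.2 i)) + cellInd L j k (pseudoObs ω i))
      (fun i ω => (farEvent μ (2 * Real.sqrt (Real.log n₁ / n₁)) i).indicator 1 ω)
      (4 * M ^ 2 * (2 ^ j) ^ 2 * Real.sqrt (Real.log n₁ / n₁)) (M ^ 2 * 2 ^ j)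
      (C * ((L + 4) ^ 2 / (2 ^ j) ^ 2)) ((L + 5) ^ 2) (4 * ((n₁ : ℝ) ^ 8)⁻¹) := by
  have hm : Measurable (copulaMap μ) := by unfold copulaMap; fun_prop
  have hcell : ∀ k, Measurable fun z => cellInd L j k (copulaMap μ z) :=
    fun k => (measurable_cellInd L j k).comp hm
  have ha : ∀ (i : Fin n₂) k, Measurable fun ω : (Fin n₁ → ℝ × ℝ) × (Fin n₂ → ℝ × ℝ) =>
      cellInd L j k (copulaMap μ (ω.2 i)) :=
    fun i k => (hcell k).comp ((measurable_pi_apply i).comp measurable_snd)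
  have hM := hφ.M_nonneg
  exact
    { s_nonneg := by positivity
      r_nonneg := by positivity
      h_nonneg := by positivity
      N_nonneg := by positivity
      b_meas := fun i => measurable_one.indicator (measurableSet_farEvent hF hG _ i)
      a_meas := ha
      w_meas := fun i k => (ha i k).add ((measurable_cellInd L j k).comp (measurable_pseudoObs i))
      b_zero_or_one := fun i ω => by
        classical
        rw [Set.indicator_apply]
        split_ifs <;> simp
      a_nonneg := fun i k ω => cellInd_nonneg _ _ _ _
      a_le := fun i k ω => cellInd_le_one _ _ _ _
      w_nonneg := fun i k ω => add_nonneg (cellInd_nonneg _ _ _ _) (cellInd_nonneg _ _ _ _)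
      w_le := fun i k ω => by
        linarith [cellInd_le_one L j k (copulaMap μ (ω.2 i)),
          cellInd_le_one L j k (pseudoObs ω i)]
      abs_le_a := fun i k ω hb => by
        have hω : ω ∉ farEvent μ (2 * Real.sqrt (Real.log n₁ / n₁)) i := by
          intro hω
          rw [Set.indicator_of_mem hω] at hb
          exact one_ne_zero hb
        have h1 : |(pseudoObs ω i).1 - (copulaMap μ (ω.2 i)).1| ≤
            2 * Real.sqrt (Real.log n₁ / n₁) := not_lt.1 fun h => hω (Or.inl h)
        have h2 : |(pseudoObs ω i).2 - (copulaMap μ (ω.2 i)).2| ≤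
            2 * Real.sqrt (Real.log n₁ / n₁) := not_lt.1 fun h => hω (Or.inr h)
        refine (abs_phiJK_sub_le hφ j k h1 h2 (by linarith)).trans (le_of_eq ?_)
        ring
      abs_le_w := fun i k ω => by
        refine (abs_sub _ _).trans ?_
        have h1 := abs_phiJK_le hφ j k (pseudoObs ω i)
        have h2 := abs_phiJK_le hφ j k (copulaMap μ (ω.2 i))
        have h3 := add_le_add h1 h2
        refine h3.trans (le_of_eq ?_)
        ring
      sum_a_le := fun S i ω => sum_cellInd_le hL j S _
      sum_w_le := fun S i ω => by
        rw [Finset.sum_add_distrib, two_mul]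
        exact add_le_add (sum_cellInd_le hL j S _) (sum_cellInd_le hL j S _)
      integral_a_le := fun i k => by
        rw [integral_prod_pi_eval (hcell k) i]
        exact integral_cellInd_le hF hG hc hC hμ hL j k
      integral_b_le := fun i => by
        rw [integral_indicator_one (measurableSet_farEvent hF hG _ i)]
        exact farEvent_measure_le hF hG hn i
      integral_mul_a := fun i l hil k p => by
        rw [integral_prod_pi_eval_mul (hcell k) (hcell p) hil, integral_prod_pi_eval (hcell k) i,
          integral_prod_pi_eval (hcell p) l] }

/-- Numerical facts on the rate `log n / n`. -/
lemma rate_bounds {n : ℕ} (hn : 2 ≤ n) :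
    0 < Real.log n / n ∧ Real.log n / n ≤ 1 ∧
      4 * ((n : ℝ) ^ 8)⁻¹ ≤ 16 * (Real.log n / n) ^ 2 := by
  have hn' : (2 : ℝ) ≤ n := by exact_mod_cast hn
  have hlog : 1 / 2 ≤ Real.log n := by
    have := Real.log_two_gt_d9
    have := Real.log_le_log (by norm_num) hn'
    linarith
  refine ⟨by positivity, ?_, ?_⟩
  · rw [div_le_one (by positivity)]
    exact (Real.log_le_sub_one_of_pos (by positivity)).trans (by linarith)
  · have h1 : ((n : ℝ) ^ 8)⁻¹ ≤ ((n : ℝ) ^ 2)⁻¹ := by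
      gcongr
      · linarith
      · norm_num
    have h2 : (1 / 2 : ℝ) ^ 2 ≤ Real.log n ^ 2 := by gcongr
    rw [div_pow, div_eq_mul_inv]
    have h3 : 0 ≤ ((n : ℝ) ^ 2)⁻¹ := by positivity
    nlinarith

lemma two_pow_mul_sqrt_rate_le {n j q : ℕ} (hn : 2 ≤ n) (hq : 1 ≤ q)
    (hj : (2 : ℝ) ^ j ≤ ((n : ℝ) / Real.log n) ^ ((1 : ℝ) / 2 - 1 / (2 * (q : ℝ)))) :
    (2 : ℝ) ^ j * Real.sqrt (Real.log n / n) ≤ 1 := by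
  obtain ⟨h0, h1, -⟩ := rate_bounds hn
  have h2 : (n : ℝ) / Real.log n = (Real.log n / n)⁻¹ := (inv_div _ _).symm
  have h3 : ((n : ℝ) / Real.log n) ^ ((1 : ℝ) / 2 - 1 / (2 * (q : ℝ))) ≤
      (Real.sqrt (Real.log n / n))⁻¹ := by
    rw [h2, ← Real.sqrt_inv, Real.sqrt_eq_rpow]
    refine Real.rpow_le_rpow_of_exponent_le ((one_le_inv₀ h0).2 h1) ?_
    have : (0 : ℝ) ≤ 1 / (2 * (q : ℝ)) := by positivity
    linarith
  have h4 := Real.sqrt_pos.2 h0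
  calc _ ≤ (Real.sqrt (Real.log n / n))⁻¹ * Real.sqrt (Real.log n / n) := by
        gcongr; exact hj.trans h3
    _ = 1 := inv_mul_cancel₀ h4.ne'

lemma remainder_constants_le {M Q N T S β : ℝ} (hN0 : 0 ≤ N)
    (hT1 : 1 ≤ T) (hS0 : 0 < S) (hS1 : S ≤ 1) (hTS : T * S ≤ 1) (hβ0 : 0 ≤ β)
    (hβ : β ≤ 16 * S ^ 4) :
    4 * M ^ 2 * T ^ 2 * S * (Q / T ^ 2) + 2 * (M ^ 2 * T) * β ≤
      (4 * M ^ 2 * Q + 32 * M ^ 2) * S ∧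
    (4 * M ^ 2 * T ^ 2 * S) ^ 2 * (Q / T ^ 2 * N) + 8 * N * (M ^ 2 * T) ^ 2 * β ≤
      (16 * M ^ 4 * (Q * N) + 128 * N * M ^ 4) * (T ^ 2 * S ^ 2) ∧
    (4 * M ^ 2 * T ^ 2 * S) ^ 2 * (Q / T ^ 2) ^ 2 + 8 * (M ^ 2 * T) ^ 2 * β ≤
      (16 * M ^ 4 * Q ^ 2 + 128 * M ^ 4) * S ^ 2 ∧
    2 * (4 * M ^ 2 * T ^ 2 * S) ^ 4 * (Q / T ^ 2 * N ^ 2) +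
      128 * (M ^ 2 * T) ^ 4 * N ^ 4 * β ^ 2 ≤
      (512 * M ^ 8 * (Q * N ^ 2) + 128 * 256 * M ^ 8 * N ^ 4) * (T ^ 6 * (S ^ 2) ^ 2) := by
  have hT0 : 0 < T := by linarith
  have hS2 : S ^ 4 ≤ S ^ 2 := pow_le_pow_of_le_one hS0.le hS1 (by norm_num)
  have hTS2 : T ^ 2 * S ^ 2 ≤ 1 := by
    rw [← mul_pow]; exact pow_le_one₀ (by positivity) hTS
  have hTβ : T * β ≤ 16 * S := by
    calc T * β ≤ T * (16 * S ^ 4) := by gcongr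
      _ = 16 * S * (T * S) * S ^ 2 := by ring
      _ ≤ 16 * S * 1 * 1 := by
          gcongr
          exact pow_le_one₀ hS0.le hS1
      _ = 16 * S := by ring
  have hT2β : T ^ 2 * β ≤ 16 * S ^ 2 := by
    calc T ^ 2 * β ≤ T ^ 2 * (16 * S ^ 4) := by gcongr
      _ = 16 * S ^ 2 * (T ^ 2 * S ^ 2) := by ring
      _ ≤ 16 * S ^ 2 * 1 := by gcongr
      _ = 16 * S ^ 2 := by ring
  have hA_le : 4 * M ^ 2 * T ^ 2 * S * (Q / T ^ 2) + 2 * (M ^ 2 * T) * β ≤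
      (4 * M ^ 2 * Q + 32 * M ^ 2) * S := by
    have e : 4 * M ^ 2 * T ^ 2 * S * (Q / T ^ 2) = 4 * M ^ 2 * Q * S := by field_simp
    rw [e]
    linarith [mul_le_mul_of_nonneg_left hTβ (by positivity : 0 ≤ 2 * M ^ 2)]
  have hC_le : (4 * M ^ 2 * T ^ 2 * S) ^ 2 * (Q / T ^ 2) ^ 2 + 8 * (M ^ 2 * T) ^ 2 * β ≤
      (16 * M ^ 4 * Q ^ 2 + 128 * M ^ 4) * S ^ 2 := by
    have e : (4 * M ^ 2 * T ^ 2 * S) ^ 2 * (Q / T ^ 2) ^ 2 = 16 * M ^ 4 * Q ^ 2 * S ^ 2 := by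
      field_simp; ring
    rw [e]
    linarith [mul_le_mul_of_nonneg_left hT2β (by positivity : 0 ≤ 8 * M ^ 4)]
  have hB_le : (4 * M ^ 2 * T ^ 2 * S) ^ 2 * (Q / T ^ 2 * N) + 8 * N * (M ^ 2 * T) ^ 2 * β ≤
      (16 * M ^ 4 * (Q * N) + 128 * N * M ^ 4) * (T ^ 2 * S ^ 2) := by
    have e : (4 * M ^ 2 * T ^ 2 * S) ^ 2 * (Q / T ^ 2 * N) =
        16 * M ^ 4 * (Q * N) * (T ^ 2 * S ^ 2) := by
      field_simp; ring
    have h1 : β ≤ 16 * S ^ 2 := by linarith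
    have h2 := mul_le_mul_of_nonneg_left h1 (by positivity : 0 ≤ 8 * N * (M ^ 2 * T) ^ 2)
    rw [e]
    linarith
  have hD_le : 2 * (4 * M ^ 2 * T ^ 2 * S) ^ 4 * (Q / T ^ 2 * N ^ 2) +
      128 * (M ^ 2 * T) ^ 4 * N ^ 4 * β ^ 2 ≤
      (512 * M ^ 8 * (Q * N ^ 2) + 128 * 256 * M ^ 8 * N ^ 4) * (T ^ 6 * (S ^ 2) ^ 2) := by
    have e : 2 * (4 * M ^ 2 * T ^ 2 * S) ^ 4 * (Q / T ^ 2 * N ^ 2) =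
        512 * M ^ 8 * (Q * N ^ 2) * (T ^ 6 * (S ^ 2) ^ 2) := by
      field_simp; ring
    have h1 : β ^ 2 ≤ 256 * S ^ 4 := by
      calc β ^ 2 ≤ (16 * S ^ 2) ^ 2 := pow_le_pow_left₀ hβ0 (by linarith) 2
        _ = 256 * S ^ 4 := by ring
    have h2 : T ^ 4 ≤ T ^ 6 := pow_le_pow_right₀ hT1 (by norm_num)
    have h3 : 128 * (M ^ 2 * T) ^ 4 * N ^ 4 * β ^ 2 ≤
        128 * 256 * M ^ 8 * N ^ 4 * (T ^ 6 * (S ^ 2) ^ 2) := by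
      calc 128 * (M ^ 2 * T) ^ 4 * N ^ 4 * β ^ 2
          = 128 * M ^ 8 * N ^ 4 * (T ^ 4 * β ^ 2) := by ring
        _ ≤ 128 * M ^ 8 * N ^ 4 * (T ^ 6 * (256 * S ^ 4)) := by gcongr
        _ = _ := by ring
    rw [e]
    linarith
  exact ⟨hA_le, hB_le, hC_le, hD_le⟩

/-- **Lemma 5, moment bounds for the pseudo-observation remainders.**
Under the stated conditions on `φ` and for `2^j ≤ min((n₂/log n₂)^{1/2},
(n₁/log n₁)^{1/2−1/(2q)})`:
`E|A_{i₁}| ≤ κ(log n₁/n₁)^{1/2}`, `E|B_{i₁,i₂}| ≤ κ 2^{2j} log n₁/n₁`,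
`E|C_{i₁,i₂}| ≤ κ log n₁/n₁`, and `D_{i₁} ≤ κ 2^{6j}(log n₁/n₁)²`,
with `κ` depending only on `φ`, its derivatives, `L` and `‖c‖_∞`. -/
theorem lemma5_pseudo_observation_moments
    (φ : ℝ → ℝ) (L : ℝ) (q : ℕ) (hL : 0 < L) (hq : 1 ≤ q)
    (hφmeas : Measurable φ) (hφbdd : ∃ Cφ : ℝ, ∀ t, |φ t| ≤ Cφ)
    (hφsupp : ∀ t ∉ Set.Icc (0 : ℝ) L, φ t = 0)
    (hφsmooth : ContDiff ℝ q φ)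
    (Cc : ℝ) (hCc : 0 < Cc) :
    ∃ κ : ℝ, 0 < κ ∧
      ∀ (c : ℝ × ℝ → ℝ) (μ : Measure (ℝ × ℝ)) (n₁ n₂ : ℕ) (j : ℕ)
        (Kf : Finset (ℤ × ℤ)) (k p : ℤ × ℤ) (i₁ i₂ : Fin n₂),
        2 ≤ n₁ → 2 ≤ n₂ → i₁ ≠ i₂ →
        Measurable c → (∀ z, 0 ≤ c z) → (∀ z, c z ≤ Cc) → (∀ z ∉ unitSq, c z = 0) →
        IsProbabilityMeasure μ → Continuous (margF μ) → Continuous (margG μ) →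
        HasCopulaDensity μ c →
        (∀ k' ∉ Kf, ∀ z ∈ unitSq, phiJK φ j k' z = 0) →
        (2 : ℝ) ^ j ≤ min (Real.sqrt ((n₂ : ℝ) / Real.log n₂))
          (((n₁ : ℝ) / Real.log n₁) ^ ((1 : ℝ) / 2 - 1 / (2 * (q : ℝ)))) →
        (∫ ω, |xiK φ j k (margF μ) (margG μ) ω i₁|
            ∂((Measure.pi fun _ : Fin n₁ => μ).prod (Measure.pi fun _ : Fin n₂ => μ))) ≤
          κ * Real.sqrt (Real.log n₁ / n₁) ∧
        (∫ ω, |∑ k' ∈ Kf, xiK φ j k' (margF μ) (margG μ) ω i₁ *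
              xiK φ j k' (margF μ) (margG μ) ω i₂|
            ∂((Measure.pi fun _ : Fin n₁ => μ).prod (Measure.pi fun _ : Fin n₂ => μ))) ≤
          κ * (2 : ℝ) ^ (2 * j) * (Real.log n₁ / n₁) ∧
        (∫ ω, |xiK φ j k (margF μ) (margG μ) ω i₁ * xiK φ j p (margF μ) (margG μ) ω i₂|
            ∂((Measure.pi fun _ : Fin n₁ => μ).prod (Measure.pi fun _ : Fin n₂ => μ))) ≤
          κ * (Real.log n₁ / n₁) ∧
        (∑ k' ∈ Kf, ∑ p' ∈ Kf,
            (∫ ω, xiK φ j k' (margF μ) (margG μ) ω i₁ * xiK φ j p' (margF μ) (margG μ) ω i₁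
              ∂((Measure.pi fun _ : Fin n₁ => μ).prod
                  (Measure.pi fun _ : Fin n₂ => μ))) ^ 2) ≤
          κ * (2 : ℝ) ^ (6 * j) * (Real.log n₁ / n₁) ^ 2 := by
  obtain ⟨M, hM⟩ := exists_isBump hq hφbdd hφsupp hφsmooth
  set Q : ℝ := Cc * (L + 4) ^ 2 with hQ
  set N : ℝ := (L + 5) ^ 2 with hN
  have hQ0 : 0 ≤ Q := by positivity
  have hN0 : 0 ≤ N := by positivity
  have hκ₁ : 0 ≤ 4 * M ^ 2 * Q + 32 * M ^ 2 := by positivity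
  have hκ₂ : 0 ≤ 16 * M ^ 4 * (Q * N) + 128 * N * M ^ 4 := by positivity
  have hκ₃ : 0 ≤ 16 * M ^ 4 * Q ^ 2 + 128 * M ^ 4 := by positivity
  have hκ₄ : 0 ≤ 512 * M ^ 8 * (Q * N ^ 2) + 128 * 256 * M ^ 8 * N ^ 4 := by positivity
  refine ⟨1 + (4 * M ^ 2 * Q + 32 * M ^ 2) + (16 * M ^ 4 * (Q * N) + 128 * N * M ^ 4) +
    (16 * M ^ 4 * Q ^ 2 + 128 * M ^ 4) +
    (512 * M ^ 8 * (Q * N ^ 2) + 128 * 256 * M ^ 8 * N ^ 4), by positivity, ?_⟩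
  intro c μ n₁ n₂ j Kf k p i₁ i₂ hn₁ _ hi _ _ hcC _ hprob hFc hGc hμ _ hj
  obtain ⟨hδ0, hδ1, hβ⟩ := rate_bounds hn₁
  have hTS := two_pow_mul_sqrt_rate_le hn₁ hq (hj.trans (min_le_right _ _))
  have H := xiK_remainderBounds (n₂ := n₂) hL hM hFc.measurable hGc.measurable hcC hCc.le hμ hn₁ hTS
  have hA := H.integral_abs_le i₁ k
  have hB := H.integral_abs_sum_mul_le hi Kf
  have hC := H.integral_abs_mul_le hi k p
  have hD := H.sum_sq_integral_mul_le i₁ Kf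
  have hT1 : (1 : ℝ) ≤ 2 ^ j := one_le_pow₀ (by norm_num)
  rw [pow_mul' (2 : ℝ) 2 j, pow_mul' (2 : ℝ) 6 j]
  rw [← mul_div_assoc, ← hQ] at hA hB hC hD
  rw [← hN] at hB hD
  have hS0 := Real.sqrt_pos.2 hδ0
  have hδ : Real.log n₁ / n₁ = Real.sqrt (Real.log n₁ / n₁) ^ 2 := (Real.sq_sqrt hδ0.le).symm
  have hS1 : Real.sqrt (Real.log n₁ / n₁) ≤ 1 := Real.sqrt_le_one.2 hδ1
  have hβ0 : 0 ≤ 4 * ((n₁ : ℝ) ^ 8)⁻¹ := by positivity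
  set S := Real.sqrt (Real.log n₁ / n₁) with hS
  rw [hδ] at hβ ⊢
  set T : ℝ := 2 ^ j with hT
  set β : ℝ := 4 * ((n₁ : ℝ) ^ 8)⁻¹
  clear_value S T β Q N
  rw [← pow_mul] at hβ
  norm_num at hβ
  obtain ⟨hA_le, hB_le, hC_le, hD_le⟩ := remainder_constants_le hN0 hT1 hS0 hS1 hTS hβ0 hβ
  refine ⟨(hA.trans hA_le).trans ?_, (hB.trans hB_le).trans ?_, (hC.trans hC_le).trans ?_,
    (hD.trans hD_le).trans ?_⟩
  · exact mul_le_mul_of_nonneg_right (by linarith) (by positivity)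
  · rw [mul_assoc _ (T ^ 2) (S ^ 2)]; exact mul_le_mul_of_nonneg_right (by linarith) (by positivity)
  · exact mul_le_mul_of_nonneg_right (by linarith) (by positivity)
  · rw [mul_assoc _ (T ^ 6)]; exact mul_le_mul_of_nonneg_right (by linarith) (by positivity)
end
end

section
/- (U-statistic mean and variance bound.) Let (Z_i)_{i=1,…,n}, n ≥ 2, be i.i.d. random variables with values in a measurable space E, let K be a finite index set, and let h_k : E → ℝ, k ∈ K, be bounded measurable functions with m_k = E[h_k(Z₁)]. Define U = Σ_{k∈K} (n(n−1))^{−1} Σ_{i₁≠i₂} h_k(Z_{i₁}) h_k(Z_{i₂}). Then E[U] = Σ_{k∈K} m_k², and Var(U) ≤ (4/n) · E[ ( Σ_{k∈K} m_k h_k(Z₁) )² ] + (2/(n(n−1))) · Σ_{k,p∈K} ( E[ h_k(Z₁) h_p(Z₁) ] )². -/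
open MeasureTheory ProbabilityTheory

noncomputable section

section Bounded

lemma integrable_of_measurable_of_bounded {α : Type*} [MeasurableSpace α] {μ : Measure α}
    [IsFiniteMeasure μ] {f : α → ℝ} (hf : Measurable f) (hb : ∃ C : ℝ, ∀ z, |f z| ≤ C) :
    Integrable f μ := by
  obtain ⟨C, hC⟩ := hb
  exact Integrable.of_bound hf.aestronglyMeasurable C (ae_of_all _ hC)

lemma exists_bound_mul {α : Type*} {f g : α → ℝ} (hf : ∃ C : ℝ, ∀ z, |f z| ≤ C)
    (hg : ∃ C : ℝ, ∀ z, |g z| ≤ C) : ∃ C : ℝ, ∀ z, |f z * g z| ≤ C := by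
  obtain ⟨C, hC⟩ := hf
  obtain ⟨D, hD⟩ := hg
  refine ⟨C * D, fun z => ?_⟩
  rw [abs_mul]
  exact mul_le_mul (hC z) (hD z) (abs_nonneg _) ((abs_nonneg _).trans (hC z))

lemma exists_bound_sum {α β : Type*} (s : Finset β) {f : β → α → ℝ}
    (hf : ∀ b, ∃ C : ℝ, ∀ z, |f b z| ≤ C) : ∃ C : ℝ, ∀ z, |∑ b ∈ s, f b z| ≤ C := by
  choose C hC using hf
  exact ⟨∑ b ∈ s, C b, fun z => (Finset.abs_sum_le_sum_abs _ _).trans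
    (Finset.sum_le_sum fun b _ => hC b z)⟩

end Bounded

section ProductMeasure

variable {E : Type*} [MeasurableSpace E] {ν : Measure E} [IsProbabilityMeasure ν]
  {κ : Type*} [Fintype κ]

lemma integral_pi_mul_of_ne {i j : κ} (hij : i ≠ j) (f g : E → ℝ) :
    ∫ ω, f (ω i) * g (ω j) ∂(Measure.pi fun _ : κ => ν) = (∫ z, f z ∂ν) * ∫ z, g z ∂ν := by
  classical
  have key := integral_fintype_prod_eq_prod (μ := fun _ : κ => ν)
    (fun t z => (if t = i then f z else 1) * (if t = j then g z else 1))
  have hfac : ∀ t, ∫ z, (if t = i then f z else 1) * (if t = j then g z else 1) ∂ν =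
      (if t = i then ∫ z, f z ∂ν else 1) * (if t = j then ∫ z, g z ∂ν else 1) := by
    intro t
    by_cases hi : t = i
    · have hj : t ≠ j := fun hj => hij (hi.symm.trans hj)
      simp [hi, hij]
    · by_cases hj : t = j <;> simp [hi, hj, hij.symm]
  simp only [hfac, Finset.prod_mul_distrib] at key
  simpa using key

lemma integral_pi_mul_eq_zero {i j k l : κ} (hj : i ≠ j) (hk : i ≠ k) (hl : i ≠ l)
    {f : E → ℝ} (hf : ∫ z, f z ∂ν = 0) (f₁ f₂ f₃ : E → ℝ) :
    ∫ ω, f (ω i) * (f₁ (ω j) * (f₂ (ω k) * f₃ (ω l))) ∂(Measure.pi fun _ : κ => ν) = 0 := by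
  classical
  have key := integral_fintype_prod_eq_prod (μ := fun _ : κ => ν)
    (fun t z => (if t = i then f z else 1) * ((if t = j then f₁ z else 1) *
      ((if t = k then f₂ z else 1) * (if t = l then f₃ z else 1))))
  rw [Finset.prod_eq_zero (Finset.mem_univ i) (by simpa [hj, hk, hl] using hf)] at key
  simp only [Finset.prod_mul_distrib] at key
  simpa using key

end ProductMeasure

section Degenerate

variable {E : Type*} [MeasurableSpace E] {ν : Measure E} [IsProbabilityMeasure ν]
  {κ : Type*} [Fintype κ]

lemma integral_pi_sum {f : E → ℝ} (hf : Measurable f) (hfb : ∃ C : ℝ, ∀ z, |f z| ≤ C)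
    (hf0 : ∫ z, f z ∂ν = 0) :
    ∫ ω, ∑ i, f (ω i) ∂(Measure.pi fun _ : κ => ν) = 0 := by
  rw [integral_finsetSum]
  · refine Finset.sum_eq_zero fun i _ => ?_
    rw [integral_comp_eval (μ := fun _ : κ => ν) (i := i) hf.aestronglyMeasurable, hf0]
  · exact fun i _ => integrable_of_measurable_of_bounded (by fun_prop)
      (hfb.imp fun _ hC ω => hC (ω i))

lemma integral_pi_sum_sq {f : E → ℝ} (hf : Measurable f) (hfb : ∃ C : ℝ, ∀ z, |f z| ≤ C)
    (hf0 : ∫ z, f z ∂ν = 0) :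
    ∫ ω, (∑ i, f (ω i)) ^ 2 ∂(Measure.pi fun _ : κ => ν) =
      Fintype.card κ * ∫ z, f z ^ 2 ∂ν := by
  classical
  have hb : ∀ i : κ, ∃ C : ℝ, ∀ ω : κ → E, |f (ω i)| ≤ C :=
    fun i => hfb.imp fun _ hC ω => hC (ω i)
  have hint : ∀ i j : κ, Integrable (fun ω => f (ω i) * f (ω j)) (Measure.pi fun _ : κ => ν) :=
    fun i j => integrable_of_measurable_of_bounded (by fun_prop) (exists_bound_mul (hb i) (hb j))
  have hterm : ∀ i j : κ, ∫ ω, f (ω i) * f (ω j) ∂(Measure.pi fun _ : κ => ν) =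
      if i = j then ∫ z, f z ^ 2 ∂ν else 0 := by
    intro i j
    split_ifs with hij
    · subst hij
      rw [← integral_comp_eval (μ := fun _ : κ => ν) (i := i) (f := fun z => f z ^ 2)
        (by fun_prop)]
      simp only [sq]
    · rw [integral_pi_mul_of_ne hij, hf0, zero_mul]
  simp_rw [sq (∑ i, f _), Finset.sum_mul_sum]
  rw [integral_finsetSum _ fun i _ => integrable_finsetSum _ fun j _ => hint i j]
  simp_rw [integral_finsetSum _ fun j _ => hint _ j, hterm]
  simp

lemma integral_pi_offDiag {f : E → ℝ} (hf : Measurable f) (hfb : ∃ C : ℝ, ∀ z, |f z| ≤ C)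
    (hf0 : ∫ z, f z ∂ν = 0) :
    ∫ ω, ∑ p ∈ (Finset.univ : Finset κ).offDiag, f (ω p.1) * f (ω p.2)
      ∂(Measure.pi fun _ : κ => ν) = 0 := by
  rw [integral_finsetSum]
  · refine Finset.sum_eq_zero fun p hp => ?_
    rw [integral_pi_mul_of_ne (by simpa using hp), hf0, zero_mul]
  · exact fun p _ => integrable_of_measurable_of_bounded (by fun_prop)
      (exists_bound_mul (hfb.imp fun _ hC ω => hC (ω p.1)) (hfb.imp fun _ hC ω => hC (ω p.2)))

variable [DecidableEq κ]

lemma integral_pi_four {f g : E → ℝ} (hf0 : ∫ z, f z ∂ν = 0)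
    {i j k l : κ} (hij : i ≠ j) (hkl : k ≠ l) :
    ∫ ω, f (ω i) * f (ω j) * (g (ω k) * g (ω l)) ∂(Measure.pi fun _ : κ => ν) =
      (if k = i ∧ l = j then (∫ z, f z * g z ∂ν) ^ 2 else 0) +
      (if k = j ∧ l = i then (∫ z, f z * g z ∂ν) ^ 2 else 0) := by
  have hpair : ∫ ω, f (ω i) * f (ω j) * (g (ω i) * g (ω j)) ∂(Measure.pi fun _ : κ => ν) =
      (∫ z, f z * g z ∂ν) ^ 2 := by
    rw [sq, ← integral_pi_mul_of_ne hij]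
    congr with ω
    ring
  by_cases h₁ : k = i ∧ l = j
  · obtain ⟨rfl, rfl⟩ := h₁
    simpa [hkl] using hpair
  by_cases h₂ : k = j ∧ l = i
  · obtain ⟨rfl, rfl⟩ := h₂
    rw [if_neg h₁, if_pos ⟨rfl, rfl⟩, zero_add, ← hpair]
    congr with ω
    ring
  rw [if_neg h₁, if_neg h₂, add_zero]
  by_cases hi : i = k ∨ i = l
  · have hj : j ≠ k ∧ j ≠ l := by grind
    rw [← integral_pi_mul_eq_zero hij.symm hj.1 hj.2 hf0 f g g]
    congr with ω
    ring
  · push Not at hi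
    rw [← integral_pi_mul_eq_zero hij hi.1 hi.2 hf0 f g g]
    congr with ω
    ring

lemma integral_pi_sum_mul_offDiag {f g : E → ℝ} (hf : Measurable f)
    (hfb : ∃ C : ℝ, ∀ z, |f z| ≤ C) (hg : Measurable g) (hgb : ∃ C : ℝ, ∀ z, |g z| ≤ C)
    (hg0 : ∫ z, g z ∂ν = 0) :
    ∫ ω, (∑ i, f (ω i)) * ∑ p ∈ (Finset.univ : Finset κ).offDiag, g (ω p.1) * g (ω p.2)
      ∂(Measure.pi fun _ : κ => ν) = 0 := by
  have hint : ∀ (i : κ) (p : κ × κ), Integrable (fun ω => f (ω i) * (g (ω p.1) * g (ω p.2)))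
      (Measure.pi fun _ : κ => ν) := fun i p =>
    integrable_of_measurable_of_bounded (by fun_prop)
      (exists_bound_mul (hfb.imp fun _ hC ω => hC (ω i))
        (exists_bound_mul (hgb.imp fun _ hC ω => hC (ω p.1)) (hgb.imp fun _ hC ω => hC (ω p.2))))
  simp_rw [Finset.sum_mul_sum]
  rw [integral_finsetSum _ fun i _ => integrable_finsetSum _ fun p _ => hint i p]
  refine Finset.sum_eq_zero fun i _ => ?_
  rw [integral_finsetSum _ fun p _ => hint i p]
  refine Finset.sum_eq_zero fun p hp => ?_
  have hp' : p.1 ≠ p.2 := by simpa using hp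
  by_cases hi : i = p.1
  · rw [← integral_pi_mul_eq_zero (ν := ν) (i := p.2) (hi ▸ hp'.symm) hp'.symm hp'.symm hg0
      f g (fun _ => 1)]
    congr with ω
    ring
  · rw [← integral_pi_mul_eq_zero (ν := ν) (Ne.symm hi) hp' hp' hg0 f g (fun _ => 1)]
    congr with ω
    ring

lemma integral_pi_offDiag_mul_offDiag {f g : E → ℝ} (hf : Measurable f)
    (hfb : ∃ C : ℝ, ∀ z, |f z| ≤ C) (hf0 : ∫ z, f z ∂ν = 0) (hg : Measurable g)
    (hgb : ∃ C : ℝ, ∀ z, |g z| ≤ C) :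
    ∫ ω, (∑ p ∈ (Finset.univ : Finset κ).offDiag, f (ω p.1) * f (ω p.2)) *
        ∑ q ∈ (Finset.univ : Finset κ).offDiag, g (ω q.1) * g (ω q.2)
        ∂(Measure.pi fun _ : κ => ν) =
      2 * (Fintype.card κ * (Fintype.card κ - 1)) * (∫ z, f z * g z ∂ν) ^ 2 := by
  have hint : ∀ p q : κ × κ, Integrable
      (fun ω => f (ω p.1) * f (ω p.2) * (g (ω q.1) * g (ω q.2)))
      (Measure.pi fun _ : κ => ν) := fun p q =>
    integrable_of_measurable_of_bounded (by fun_prop)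
      (exists_bound_mul
        (exists_bound_mul (hfb.imp fun _ hC ω => hC (ω p.1)) (hfb.imp fun _ hC ω => hC (ω p.2)))
        (exists_bound_mul (hgb.imp fun _ hC ω => hC (ω q.1)) (hgb.imp fun _ hC ω => hC (ω q.2))))
  simp_rw [Finset.sum_mul_sum]
  rw [integral_finsetSum _ fun p _ => integrable_finsetSum _ fun q _ => hint p q]
  have hrow : ∀ p ∈ (Finset.univ : Finset κ).offDiag,
      ∫ ω, ∑ q ∈ (Finset.univ : Finset κ).offDiag,
        f (ω p.1) * f (ω p.2) * (g (ω q.1) * g (ω q.2)) ∂(Measure.pi fun _ : κ => ν) =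
      2 * (∫ z, f z * g z ∂ν) ^ 2 := by
    intro p hp
    have hp' : p.1 ≠ p.2 := by simpa using hp
    rw [integral_finsetSum _ fun q _ => hint p q,
      Finset.sum_congr rfl fun q hq => integral_pi_four hf0 hp'
        (by simpa using hq : q.1 ≠ q.2), Finset.sum_add_distrib]
    have hsingle : ∀ i j : κ, i ≠ j → ∑ q ∈ (Finset.univ : Finset κ).offDiag,
        (if q.1 = i ∧ q.2 = j then (∫ z, f z * g z ∂ν) ^ 2 else 0) =
        (∫ z, f z * g z ∂ν) ^ 2 := by
      intro i j hij
      rw [Finset.sum_eq_single (i, j)]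
      · simp
      · intro q _ hq
        exact if_neg fun h => hq (Prod.ext h.1 h.2)
      · simp [hij]
    rw [hsingle _ _ hp', hsingle _ _ hp'.symm, two_mul]
  rw [Finset.sum_congr rfl hrow, Finset.sum_const, Finset.offDiag_card, nsmul_eq_mul,
    Nat.cast_sub (Nat.le_mul_self _), Finset.card_univ]
  push_cast
  ring

end Degenerate

section Algebra

variable {κ : Type*} [Fintype κ] [DecidableEq κ]

lemma sum_offDiag_mul_eq (x : κ → ℝ) :
    ∑ p ∈ (Finset.univ : Finset κ).offDiag, x p.1 * x p.2 = (∑ i, x i) ^ 2 - ∑ i, x i ^ 2 := by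
  have h := Finset.sum_union (Finset.disjoint_diag_offDiag (Finset.univ : Finset κ))
    (f := fun p => x p.1 * x p.2)
  rw [Finset.diag_union_offDiag, Finset.sum_diag, Finset.sum_product, ← Finset.sum_mul_sum] at h
  simp only [sq]
  linarith

lemma sum_offDiag_add_mul_add (x : κ → ℝ) (c : ℝ) :
    ∑ p ∈ (Finset.univ : Finset κ).offDiag, (x p.1 + c) * (x p.2 + c) =
      ∑ p ∈ (Finset.univ : Finset κ).offDiag, x p.1 * x p.2 +
        2 * (Fintype.card κ - 1) * c * ∑ i, x i +
        Fintype.card κ * (Fintype.card κ - 1) * c ^ 2 := by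
  rw [sum_offDiag_mul_eq x, sum_offDiag_mul_eq fun i => x i + c]
  simp only [add_sq, Finset.sum_add_distrib, Finset.sum_const, Finset.card_univ, nsmul_eq_mul,
    ← Finset.sum_mul, ← Finset.mul_sum]
  ring

lemma sum_sum_ne_eq_sum_offDiag (F : κ → κ → ℝ) :
    ∑ i, ∑ j ∈ Finset.univ.filter (· ≠ i), F i j =
      ∑ p ∈ (Finset.univ : Finset κ).offDiag, F p.1 p.2 :=
  (Finset.sum_finset_product' _ _ _ fun p => by simp [eq_comm]).symm

end Algebra

section Centering

variable {E : Type*} [MeasurableSpace E] {ν : Measure E}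

lemma integral_sub_integral_mul_sub_integral [IsProbabilityMeasure ν] {f g : E → ℝ} (hf : Measurable f)
    (hfb : ∃ C : ℝ, ∀ z, |f z| ≤ C) (hg : Measurable g) (hgb : ∃ C : ℝ, ∀ z, |g z| ≤ C) :
    ∫ z, (f z - ∫ w, f w ∂ν) * (g z - ∫ w, g w ∂ν) ∂ν =
      ∫ z, f z * g z ∂ν - (∫ z, f z ∂ν) * ∫ z, g z ∂ν := by
  have hL : ∀ {f : E → ℝ}, Measurable f → (∃ C : ℝ, ∀ z, |f z| ≤ C) → MemLp f 2 ν :=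
    fun hf ⟨C, hC⟩ => MemLp.of_bound hf.aestronglyMeasurable C (ae_of_all _ hC)
  exact covariance_eq_sub (hL hf hfb) (hL hg hgb)

lemma integral_sum_mul_sq {ι : Type*} [Fintype ι] {h : ι → E → ℝ}
    (hint : ∀ k p, Integrable (fun z => h k z * h p z) ν) (c : ι → ℝ) :
    ∫ z, (∑ k, c k * h k z) ^ 2 ∂ν =
      ∑ k, ∑ p, c k * c p * ∫ z, h k z * h p z ∂ν := by
  simp_rw [sq, Finset.sum_mul_sum,
    fun k p z => mul_mul_mul_comm (c k) (h k z) (c p) (h p z)]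
  rw [integral_finsetSum _ fun k _ => integrable_finsetSum _ fun p _ => (hint k p).const_mul _]
  refine Finset.sum_congr rfl fun k _ => ?_
  rw [integral_finsetSum _ fun p _ => (hint k p).const_mul _]
  exact Finset.sum_congr rfl fun p _ => integral_const_mul _ _

end Centering

/-- **U-statistic mean and variance bound.**
For i.i.d. `Z_i ~ ν` and a finite family of bounded measurable kernels `h_k` with means
`m_k`, the statistic `U = Σ_k (n(n-1))⁻¹ Σ_{i₁≠i₂} h_k(Z_{i₁})h_k(Z_{i₂})` has mean
`Σ_k m_k²` and variance at most
`(4/n)·E[(Σ_k m_k h_k(Z₁))²] + (2/(n(n-1)))·Σ_{k,p}(E[h_k(Z₁)h_p(Z₁)])²`. -/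
theorem ustat_mean_and_variance
    {E : Type*} [MeasurableSpace E] (ν : Measure E) [IsProbabilityMeasure ν]
    (n : ℕ) (hn : 2 ≤ n)
    {ι : Type*} [Fintype ι] (h : ι → E → ℝ)
    (hmeas : ∀ k, Measurable (h k))
    (hbdd : ∀ k, ∃ C : ℝ, ∀ z, |h k z| ≤ C)
    (m : ι → ℝ) (hm : ∀ k, m k = ∫ z, h k z ∂ν)
    (U : (Fin n → E) → ℝ)
    (hU : ∀ ω, U ω = ∑ k : ι, ((n : ℝ) * ((n : ℝ) - 1))⁻¹ *
      ∑ i₁ : Fin n, ∑ i₂ ∈ Finset.univ.filter (· ≠ i₁), h k (ω i₁) * h k (ω i₂)) :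
    (∫ ω, U ω ∂(Measure.pi fun _ : Fin n => ν)) = ∑ k : ι, (m k) ^ 2 ∧
    variance U (Measure.pi fun _ : Fin n => ν) ≤
      (4 / (n : ℝ)) * (∫ z, (∑ k : ι, m k * h k z) ^ 2 ∂ν) +
      (2 / ((n : ℝ) * ((n : ℝ) - 1))) * ∑ k : ι, ∑ p : ι, (∫ z, h k z * h p z ∂ν) ^ 2 := by
  set P : Measure (Fin n → E) := Measure.pi fun _ : Fin n => ν
  have hn0 : (n : ℝ) ≠ 0 := by positivity
  have hn1 : (0 : ℝ) < (n : ℝ) - 1 := by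
    have : (2 : ℝ) ≤ n := by exact_mod_cast hn
    linarith
  have hn1' : (n : ℝ) - 1 ≠ 0 := hn1.ne'
  set g : ι → E → ℝ := fun k z => h k z - m k with hg_def
  have hg : ∀ k, Measurable (g k) := fun k => (hmeas k).sub_const _
  have hgb : ∀ k, ∃ C : ℝ, ∀ z, |g k z| ≤ C := fun k => by
    obtain ⟨C, hC⟩ := hbdd k
    exact ⟨C + |m k|, fun z => (abs_sub _ _).trans (by gcongr; exact hC z)⟩
  have hgg : ∀ k p, Integrable (fun z => g k z * g p z) ν := fun k p =>
    integrable_of_measurable_of_bounded (by fun_prop) (exists_bound_mul (hgb k) (hgb p))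
  have hhh : ∀ k p, Integrable (fun z => h k z * h p z) ν := fun k p =>
    integrable_of_measurable_of_bounded (by fun_prop) (exists_bound_mul (hbdd k) (hbdd p))
  have hg0 : ∀ k, ∫ z, g k z ∂ν = 0 := fun k => by
    rw [integral_sub (integrable_of_measurable_of_bounded (hmeas k) (hbdd k))
      (integrable_const _), hm k]
    simp
  have hcov : ∀ k p, ∫ z, g k z * g p z ∂ν = ∫ z, h k z * h p z ∂ν - m k * m p := fun k p => by
    simp only [hg_def, hm]
    exact integral_sub_integral_mul_sub_integral (hmeas k) (hbdd k) (hmeas p) (hbdd p)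
  set L : E → ℝ := fun z => ∑ k, m k * g k z with hL_def
  have hL : Measurable L := by fun_prop
  have hLb : ∃ C : ℝ, ∀ z, |L z| ≤ C := exists_bound_sum _ fun k =>
    exists_bound_mul ⟨|m k|, fun _ => le_rfl⟩ (hgb k)
  have hL0 : ∫ z, L z ∂ν = 0 := by
    rw [integral_finsetSum _ fun k _ =>
      (integrable_of_measurable_of_bounded (hg k) (hgb k)).const_mul _]
    simp [integral_const_mul, hg0]
  set A : (Fin n → E) → ℝ := fun ω => ∑ i, L (ω i) with hA_def
  set S : ι → (Fin n → E) → ℝ := fun k ω =>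
    ∑ p ∈ (Finset.univ : Finset (Fin n)).offDiag, g k (ω p.1) * g k (ω p.2) with hS_def
  set B : (Fin n → E) → ℝ := fun ω => ∑ k, S k ω with hB_def
  have hA : Measurable A := by fun_prop
  have hAb : ∃ C : ℝ, ∀ ω, |A ω| ≤ C :=
    exists_bound_sum _ fun i => hLb.imp fun _ hC ω => hC (ω i)
  have hS : ∀ k, Measurable (S k) := fun k => by fun_prop
  have hSb : ∀ k, ∃ C : ℝ, ∀ ω, |S k ω| ≤ C := fun k => exists_bound_sum _ fun p =>
    exists_bound_mul ((hgb k).imp fun _ hC ω => hC (ω p.1))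
      ((hgb k).imp fun _ hC ω => hC (ω p.2))
  have hB : Measurable B := by fun_prop
  have hBb : ∃ C : ℝ, ∀ ω, |B ω| ≤ C := exists_bound_sum _ hSb
  have hdecomp : ∀ ω, U ω = ∑ k, m k ^ 2 +
      (2 / (n : ℝ) * A ω + ((n : ℝ) * ((n : ℝ) - 1))⁻¹ * B ω) := by
    intro ω
    have hAω : A ω = ∑ k, m k * ∑ i, g k (ω i) := by
      simp only [hA_def, hL_def, Finset.mul_sum]
      exact Finset.sum_comm
    rw [hU, hAω, hB_def, Finset.mul_sum, Finset.mul_sum, ← Finset.sum_add_distrib,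
      ← Finset.sum_add_distrib]
    refine Finset.sum_congr rfl fun k _ => ?_
    have hexp := sum_offDiag_add_mul_add (fun i => g k (ω i)) (m k)
    simp only [hg_def, sub_add_cancel, Fintype.card_fin] at hexp
    rw [sum_sum_ne_eq_sum_offDiag fun i j => h k (ω i) * h k (ω j), hexp]
    simp only [hS_def, hg_def]
    field_simp
    ring
  have hUmeas : Measurable U := by
    rw [funext hdecomp]
    fun_prop
  have hAi : Integrable A P := integrable_of_measurable_of_bounded hA hAb
  have hBi : Integrable B P := integrable_of_measurable_of_bounded hB hBb
  have hA0 : ∫ ω, A ω ∂P = 0 := integral_pi_sum hL hLb hL0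
  have hB0 : ∫ ω, B ω ∂P = 0 := by
    rw [integral_finsetSum _ fun k _ => integrable_of_measurable_of_bounded (hS k) (hSb k)]
    exact Finset.sum_eq_zero fun k _ => integral_pi_offDiag (hg k) (hgb k) (hg0 k)
  have hmean : ∫ ω, U ω ∂P = ∑ k, m k ^ 2 := by
    simp_rw [hdecomp]
    rw [integral_add (integrable_const _) ((hAi.const_mul _).fun_add (hBi.const_mul _)),
      integral_add (hAi.const_mul _) (hBi.const_mul _), integral_const_mul, integral_const_mul,
      hA0, hB0]
    simp
  have hAA : ∫ ω, A ω ^ 2 ∂P = n * ∫ z, L z ^ 2 ∂ν := by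
    rw [integral_pi_sum_sq hL hLb hL0, Fintype.card_fin]
  have hAB : ∫ ω, A ω * B ω ∂P = 0 := by
    simp_rw [hB_def, Finset.mul_sum]
    rw [integral_finsetSum _ fun k _ => integrable_of_measurable_of_bounded (hA.fun_mul (hS k))
      (exists_bound_mul hAb (hSb k))]
    exact Finset.sum_eq_zero fun k _ =>
      integral_pi_sum_mul_offDiag hL hLb (hg k) (hgb k) (hg0 k)
  have hBB : ∫ ω, B ω ^ 2 ∂P =
      2 * (n * ((n : ℝ) - 1)) * ∑ k, ∑ p, (∫ z, g k z * g p z ∂ν) ^ 2 := by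
    have hSS : ∀ k p, Integrable (fun ω => S k ω * S p ω) P := fun k p =>
      integrable_of_measurable_of_bounded ((hS k).mul (hS p)) (exists_bound_mul (hSb k) (hSb p))
    simp_rw [hB_def, sq (∑ k, S k _), Finset.sum_mul_sum]
    rw [integral_finsetSum _ fun k _ => integrable_finsetSum _ fun p _ => hSS k p]
    simp_rw [Finset.mul_sum]
    refine Finset.sum_congr rfl fun k _ => ?_
    rw [integral_finsetSum _ fun p _ => hSS k p]
    refine Finset.sum_congr rfl fun p _ => ?_
    rw [integral_pi_offDiag_mul_offDiag (hg k) (hgb k) (hg0 k) (hg p) (hgb p),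
      Fintype.card_fin]
  have hvar : variance U P = 4 / (n : ℝ) * ∫ z, L z ^ 2 ∂ν +
      2 / ((n : ℝ) * ((n : ℝ) - 1)) * ∑ k, ∑ p, (∫ z, g k z * g p z ∂ν) ^ 2 := by
    have hAAi : Integrable (fun ω => A ω ^ 2) P := by
      simp only [sq]
      exact integrable_of_measurable_of_bounded (hA.mul hA) (exists_bound_mul hAb hAb)
    have hABi : Integrable (fun ω => A ω * B ω) P :=
      integrable_of_measurable_of_bounded (hA.mul hB) (exists_bound_mul hAb hBb)
    have hBBi : Integrable (fun ω => B ω ^ 2) P := by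
      simp only [sq]
      exact integrable_of_measurable_of_bounded (hB.mul hB) (exists_bound_mul hBb hBb)
    have hsq : ∀ ω, (U ω - ∑ k, m k ^ 2) ^ 2 = (2 / (n : ℝ)) ^ 2 * A ω ^ 2 +
        (2 * (2 / (n : ℝ)) * ((n : ℝ) * ((n : ℝ) - 1))⁻¹ * (A ω * B ω) +
          (((n : ℝ) * ((n : ℝ) - 1))⁻¹) ^ 2 * B ω ^ 2) := fun ω => by
      rw [hdecomp]
      ring
    rw [variance_eq_integral hUmeas.aemeasurable, hmean]
    simp_rw [hsq]
    rw [integral_add (hAAi.const_mul _) ((hABi.const_mul _).fun_add (hBBi.const_mul _)),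
      integral_add (hABi.const_mul _) (hBBi.const_mul _), integral_const_mul, integral_const_mul,
      integral_const_mul, hAA, hAB, hBB]
    field_simp
    ring
  have hLsq : ∫ z, L z ^ 2 ∂ν = ∑ k, ∑ p, m k * m p * ∫ z, g k z * g p z ∂ν :=
    integral_sum_mul_sq hgg m
  have hLnonneg : 0 ≤ ∫ z, L z ^ 2 ∂ν := integral_nonneg fun z => sq_nonneg _
  have hLle : ∫ z, L z ^ 2 ∂ν ≤ ∫ z, (∑ k, m k * h k z) ^ 2 ∂ν := by
    have hdiff : ∫ z, (∑ k, m k * h k z) ^ 2 ∂ν =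
        ∫ z, L z ^ 2 ∂ν + ∑ k, ∑ p, (m k * m p) ^ 2 := by
      rw [hLsq, integral_sum_mul_sq hhh m]
      simp_rw [← Finset.sum_add_distrib, hcov]
      exact Finset.sum_congr rfl fun k _ => Finset.sum_congr rfl fun p _ => by ring
    rw [hdiff]
    exact le_add_of_nonneg_right
      (Finset.sum_nonneg fun k _ => Finset.sum_nonneg fun p _ => sq_nonneg _)
  have hCle : ∑ k, ∑ p, (∫ z, g k z * g p z ∂ν) ^ 2 ≤
      ∑ k, ∑ p, (∫ z, h k z * h p z ∂ν) ^ 2 := by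
    have hdiff : ∑ k, ∑ p, (∫ z, h k z * h p z ∂ν) ^ 2 =
        ∑ k, ∑ p, (∫ z, g k z * g p z ∂ν) ^ 2 + 2 * ∫ z, L z ^ 2 ∂ν +
          ∑ k, ∑ p, (m k * m p) ^ 2 := by
      rw [hLsq]
      simp_rw [Finset.mul_sum, ← Finset.sum_add_distrib, hcov]
      exact Finset.sum_congr rfl fun k _ => Finset.sum_congr rfl fun p _ => by ring
    have : 0 ≤ ∑ k, ∑ p, (m k * m p) ^ 2 :=
      Finset.sum_nonneg fun k _ => Finset.sum_nonneg fun p _ => sq_nonneg _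
    linarith
  refine ⟨hmean, ?_⟩
  rw [hvar]
  gcongr
end
end

section
/- (Second moment of the randomized likelihood ratio.) Let μ be a probability measure on a measurable space E, let K ∈ ℕ, and let D₁, …, D_K : E → ℝ be bounded measurable functions such that: ∫ D_k dμ = 0 for every k; D_k(z)·D_{k'}(z) = 0 for all z ∈ E whenever k ≠ k' (pairwise disjoint supports); and Σ_{k=1}^{K} ∫ D_k² dμ ≤ 1. Let Z₁, …, Z_n be i.i.d. with law μ and define L = 2^{−K} Σ_{δ ∈ {−1,1}^K} Π_{i=1}^{n} Π_{k=1}^{K} (1 + δ_k D_k(Z_i)) (note that by disjointness of supports Π_{k}(1+δ_kD_k(z)) = 1 + Σ_k δ_k D_k(z)). Then E[L²] ≤ Π_{k=1}^{K} cosh( n ∫ D_k² dμ ). -/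
open MeasureTheory

noncomputable section

/-- The product of `1 + u k` linearizes when the `u k` annihilate each other pairwise. -/
lemma prod_one_add_eq_one_add_sum {ι R : Type*} [CommRing R] (s : Finset ι) (u : ι → R)
    (hu : ∀ k k', k ≠ k' → u k * u k' = 0) :
    ∏ k ∈ s, (1 + u k) = 1 + ∑ k ∈ s, u k := by
  classical
  induction s using Finset.induction_on with
  | empty => simp
  | insert a s ha ih =>
    have h : u a * ∑ k ∈ s, u k = 0 := by
      rw [Finset.mul_sum]
      exact Finset.sum_eq_zero fun k hk => hu a k (by rintro rfl; exact ha hk)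
    rw [Finset.prod_insert ha, Finset.sum_insert ha, ih]
    linear_combination h

/-- The product of two sums over pairwise annihilating families is the diagonal sum. -/
lemma sum_mul_sum_eq_sum_diag {ι R : Type*} [CommRing R] [Fintype ι] (u v : ι → R)
    (h : ∀ k k', k ≠ k' → u k * v k' = 0) :
    (∑ k, u k) * ∑ k, v k = ∑ k, u k * v k := by
  rw [Finset.sum_mul_sum]
  exact Finset.sum_congr rfl fun k _ =>
    Finset.sum_eq_single k (fun k' _ hk => h k k' hk.symm) (by simp)

/-- The Rademacher sign encoded by a Boolean. -/
def rademacherSign (b : Bool) : ℝ := if b then 1 else -1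

lemma abs_rademacherSign (b : Bool) : |rademacherSign b| = 1 := by
  cases b <;> simp [rademacherSign]

/-- The inner product of two densities `∏ (1 + s k * D k)` and `∏ (1 + t k * D k)`, for centered
perturbations `D k` with disjoint supports. -/
lemma integrable_perturbation_mul_and_integral_eq
    {E ι : Type*} [MeasurableSpace E] [Fintype ι] (μ : Measure E) [IsProbabilityMeasure μ]
    (D : ι → E → ℝ) (hD : ∀ k, MemLp (D k) 2 μ) (hcent : ∀ k, ∫ z, D k z ∂μ = 0)
    (hdisj : ∀ k k', k ≠ k' → ∀ z, D k z * D k' z = 0) (s t : ι → ℝ) :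
    Integrable (fun z => (∏ k, (1 + s k * D k z)) * ∏ k, (1 + t k * D k z)) μ ∧
      ∫ z, (∏ k, (1 + s k * D k z)) * ∏ k, (1 + t k * D k z) ∂μ =
        1 + ∑ k, s k * t k * ∫ z, D k z ^ 2 ∂μ := by
  have hexp : ∀ z, (∏ k, (1 + s k * D k z)) * ∏ k, (1 + t k * D k z) =
      1 + ∑ k, ((s k + t k) * D k z + s k * t k * D k z ^ 2) := by
    intro z
    have hz : ∀ s t : ι → ℝ, ∀ k k', k ≠ k' → s k * D k z * (t k' * D k' z) = 0 :=
      fun s t k k' hk => by linear_combination s k * t k' * hdisj k k' hk z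
    rw [prod_one_add_eq_one_add_sum _ _ (hz s s), prod_one_add_eq_one_add_sum _ _ (hz t t)]
    have hdiag := sum_mul_sum_eq_sum_diag _ _ (hz s t)
    have hsplit : ∑ k, ((s k + t k) * D k z + s k * t k * D k z ^ 2) =
        ∑ k, s k * D k z + ∑ k, t k * D k z + ∑ k, s k * D k z * (t k * D k z) := by
      simp only [← Finset.sum_add_distrib]
      exact Finset.sum_congr rfl fun k _ => by ring
    rw [hsplit]
    linear_combination hdiag
  have hlin : ∀ k, Integrable (fun z => (s k + t k) * D k z) μ :=
    fun k => ((hD k).integrable one_le_two).const_mul _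
  have hsq : ∀ k, Integrable (fun z => s k * t k * D k z ^ 2) μ :=
    fun k => (hD k).integrable_sq.const_mul _
  have hterm : ∀ k, Integrable (fun z => (s k + t k) * D k z + s k * t k * D k z ^ 2) μ :=
    fun k => (hlin k).add (hsq k)
  have hint := integrable_finsetSum Finset.univ fun k _ => hterm k
  simp only [hexp]
  refine ⟨(integrable_const 1).add hint, ?_⟩
  rw [integral_add (integrable_const 1) hint, integral_finsetSum _ fun k _ => hterm k]
  simp only [integral_add (hlin _) (hsq _), integral_const_mul, hcent]
  simp

/-- Averaging `exp` over a pair of independent uniform sign vectors produces a product of `cosh`. -/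
lemma sum_sum_exp_rademacherSign {ι : Type*} [Fintype ι] [DecidableEq ι] (a : ι → ℝ) :
    ∑ δ : ι → Bool, ∑ δ' : ι → Bool,
        Real.exp (∑ k, rademacherSign (δ k) * rademacherSign (δ' k) * a k) =
      ((2 : ℝ) ^ Fintype.card ι) ^ 2 * ∏ k, Real.cosh (a k) := by
  have hinner : ∀ δ : ι → Bool, ∑ δ' : ι → Bool,
      Real.exp (∑ k, rademacherSign (δ k) * rademacherSign (δ' k) * a k) =
        (2 : ℝ) ^ Fintype.card ι * ∏ k, Real.cosh (a k) := by
    intro δ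
    simp only [Real.exp_sum]
    rw [← Fintype.prod_sum fun k b => Real.exp (rademacherSign (δ k) * rademacherSign b * a k)]
    have hfactor : ∀ k, ∑ b, Real.exp (rademacherSign (δ k) * rademacherSign b * a k) =
        2 * Real.cosh (a k) := by
      intro k
      rw [Real.cosh_eq]
      cases δ k <;> simp [rademacherSign] <;> ring
    simp only [hfactor, Finset.prod_mul_distrib]
    simp
  simp only [hinner]
  simp
  ring

/-- **Second moment of the randomized likelihood ratio.**
For centered, bounded perturbations `D_k` with pairwise disjoint supports and
`Σ_k ∫ D_k² dμ ≤ 1`, the likelihood ratio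
`L = 2^{-K} Σ_{δ∈{-1,1}^K} Π_i Π_k (1 + δ_k D_k(Z_i))` of the Rademacher mixture
satisfies `E[L²] ≤ Π_k cosh(n ∫ D_k² dμ)`. -/
theorem likelihood_ratio_second_moment
    {E : Type*} [MeasurableSpace E] (μ : Measure E) [IsProbabilityMeasure μ]
    (K n : ℕ) (D : Fin K → E → ℝ)
    (hmeas : ∀ k, Measurable (D k))
    (hbdd : ∀ k, ∃ C : ℝ, ∀ z, |D k z| ≤ C)
    (hcent : ∀ k, ∫ z, D k z ∂μ = 0)
    (hdisj : ∀ k k' : Fin K, k ≠ k' → ∀ z, D k z * D k' z = 0)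
    (hsum : ∑ k : Fin K, ∫ z, (D k z) ^ 2 ∂μ ≤ 1)
    (L : (Fin n → E) → ℝ)
    (hL : ∀ ω, L ω = ((2 : ℝ) ^ K)⁻¹ * ∑ δ : Fin K → Bool,
      ∏ i : Fin n, ∏ k : Fin K, (1 + (if δ k then (1 : ℝ) else -1) * D k (ω i))) :
    ∫ ω, (L ω) ^ 2 ∂(Measure.pi fun _ : Fin n => μ) ≤
      ∏ k : Fin K, Real.cosh ((n : ℝ) * ∫ z, (D k z) ^ 2 ∂μ) := by
  set a : Fin K → ℝ := fun k => ∫ z, (D k z) ^ 2 ∂μ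
  have ha0 : ∀ k, 0 ≤ a k := fun k => integral_nonneg fun z => sq_nonneg _
  have hD : ∀ k, MemLp (D k) 2 μ := fun k => by
    obtain ⟨C, hC⟩ := hbdd k
    exact MemLp.of_bound (hmeas k).aestronglyMeasurable C (ae_of_all _ hC)
  set f : (Fin K → Bool) → E → ℝ :=
    fun δ z => ∏ k, (1 + rademacherSign (δ k) * D k z)
  have hpair := fun δ δ' : Fin K → Bool =>
    integrable_perturbation_mul_and_integral_eq μ D hD hcent hdisj
      (fun k => rademacherSign (δ k)) (fun k => rademacherSign (δ' k))
  have hL2 : ∀ ω, L ω ^ 2 = (((2 : ℝ) ^ K) ^ 2)⁻¹ *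
      ∑ δ, ∑ δ', ∏ i, (f δ (ω i) * f δ' (ω i)) := by
    intro ω
    have hLf : L ω = ((2 : ℝ) ^ K)⁻¹ * ∑ δ, ∏ i, f δ (ω i) := hL ω
    simp only [hLf, Finset.prod_mul_distrib, ← Finset.sum_mul_sum]
    ring
  have hprod : ∀ δ δ', Integrable (fun ω : Fin n → E => ∏ i, (f δ (ω i) * f δ' (ω i)))
      (Measure.pi fun _ => μ) :=
    fun δ δ' => Integrable.fintype_prod (f := fun _ z => f δ z * f δ' z) fun _ => (hpair δ δ').1
  have hbound : ∀ δ δ', ∫ ω : Fin n → E, ∏ i, (f δ (ω i) * f δ' (ω i)) ∂(Measure.pi fun _ => μ) ≤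
      Real.exp (∑ k, rademacherSign (δ k) * rademacherSign (δ' k) * (n * a k)) := by
    intro δ δ'
    rw [integral_fintype_prod_eq_pow (fun z => f δ z * f δ' z), (hpair δ δ').2,
      Fintype.card_fin]
    set x := ∑ k, rademacherSign (δ k) * rademacherSign (δ' k) * a k with hx
    have habs : |x| ≤ 1 := by
      refine (Finset.abs_sum_le_sum_abs _ _).trans (le_trans (Finset.sum_le_sum (g := a) ?_) hsum)
      intro k _
      simp [abs_mul, abs_rademacherSign, abs_of_nonneg (ha0 k)]
    have hexponent : ∑ k, rademacherSign (δ k) * rademacherSign (δ' k) * (n * a k) = n * x := by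
      rw [hx, Finset.mul_sum]
      exact Finset.sum_congr rfl fun k _ => by ring
    rw [hexponent, Real.exp_nat_mul]
    exact pow_le_pow_left₀ (by linarith [neg_le_of_abs_le habs])
      (by linarith [Real.add_one_le_exp x]) n
  simp only [hL2]
  rw [integral_const_mul,
    integral_finsetSum _ fun δ _ => integrable_finsetSum _ fun δ' _ => hprod δ δ']
  simp only [integral_finsetSum _ fun δ' _ => hprod _ δ']
  rw [inv_mul_le_iff₀ (by positivity)]
  refine (Finset.sum_le_sum fun δ _ => Finset.sum_le_sum fun δ' _ => hbound δ δ').trans_eq ?_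
  rw [sum_sum_exp_rademacherSign, Fintype.card_fin]
end
end

section
/- (Pointwise and variance bounds for the linear statistic.) Let c be a bounded density on [0,1]² with coefficients c_{j,k} = ∫ φ_{j,k} c, and let (d_k) be arbitrary real numbers indexed by the finitely many relevant k; set T = Σ_k (c_{j,k} − d_k)². Define Z(u,v) = Σ_k (φ_{j,k}(u,v) − c_{j,k}) (c_{j,k} − d_k). Then there exists a constant K > 0 depending only on L, ‖φ‖_∞ and ‖c‖_{L²} such that sup_{(u,v)∈[0,1]²} |Z(u,v)| ≤ K 2^{j} T^{1/2}; moreover, if (U,V) is a random vector with density c, then Var(Z(U,V)) ≤ ‖c‖_∞ · T. -/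
open MeasureTheory

noncomputable section

lemma sum_sq_translates_le {φ : ℝ → ℝ} {L C : ℝ} (hL : 0 ≤ L) (hφ : ∀ t, |φ t| ≤ C)
    (hsupp : ∀ t ∉ Set.Icc (0 : ℝ) L, φ t = 0) (x : ℝ) (A : Finset ℤ) :
    ∑ n ∈ A, φ (x - n) ^ 2 ≤ (L + 1) * C ^ 2 := by
  have hzero : ∀ n ∈ A, n ∉ Finset.Icc ⌈x - L⌉ ⌊x⌋ → φ (x - n) ^ 2 = 0 := by
    intro n _ hn
    rw [hsupp, zero_pow two_ne_zero]
    intro h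
    refine hn (Finset.mem_Icc.2 ⟨Int.ceil_le.2 ?_, Int.le_floor.2 ?_⟩) <;>
      linarith [h.1, h.2]
  have hcard : ((Finset.Icc ⌈x - L⌉ ⌊x⌋).card : ℝ) ≤ L + 1 := by
    rw [Int.card_Icc]
    have h : (((⌊x⌋ + 1 - ⌈x - L⌉).toNat : ℤ) : ℝ) ≤ L + 1 := by
      rw [Int.toNat_eq_max]
      push_cast
      exact max_le (by linarith [Int.floor_le x, Int.le_ceil (x - L)]) (by linarith)
    exact_mod_cast h
  calc ∑ n ∈ A, φ (x - n) ^ 2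
      = ∑ n ∈ A with n ∈ Finset.Icc ⌈x - L⌉ ⌊x⌋, φ (x - n) ^ 2 := by
        rw [Finset.sum_filter_of_ne]
        intro n hn h
        by_contra hn'
        exact h (hzero n hn hn')
    _ ≤ ∑ n ∈ Finset.Icc ⌈x - L⌉ ⌊x⌋, φ (x - n) ^ 2 :=
        Finset.sum_le_sum_of_subset_of_nonneg (fun n hn => (Finset.mem_filter.1 hn).2)
          fun _ _ _ => sq_nonneg _
    _ ≤ (Finset.Icc ⌈x - L⌉ ⌊x⌋).card • C ^ 2 :=
        Finset.sum_le_card_nsmul _ _ _ fun n _ => sq_le_sq.2 ((hφ _).trans (le_abs_self C))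
    _ ≤ (L + 1) * C ^ 2 := by
        rw [nsmul_eq_mul]
        gcongr

lemma sum_phiJK_sq_le {φ : ℝ → ℝ} {L C : ℝ} (hL : 0 ≤ L) (hφ : ∀ t, |φ t| ≤ C)
    (hsupp : ∀ t ∉ Set.Icc (0 : ℝ) L, φ t = 0) (j : ℕ) (s : Finset (ℤ × ℤ)) (z : ℝ × ℝ) :
    ∑ k ∈ s, phiJK φ j k z ^ 2 ≤ ((L + 1) * C ^ 2 * 2 ^ j) ^ 2 := by
  calc ∑ k ∈ s, phiJK φ j k z ^ 2
      ≤ ∑ k ∈ s.image Prod.fst ×ˢ s.image Prod.snd, phiJK φ j k z ^ 2 :=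
        Finset.sum_le_sum_of_subset_of_nonneg Finset.subset_product fun _ _ _ => sq_nonneg _
    _ = (2 ^ j) ^ 2 * ((∑ n ∈ s.image Prod.fst, φ (2 ^ j * z.1 - n) ^ 2) *
          ∑ n ∈ s.image Prod.snd, φ (2 ^ j * z.2 - n) ^ 2) := by
        rw [Finset.sum_mul_sum, ← Finset.sum_product', Finset.mul_sum]
        refine Finset.sum_congr rfl fun k _ => ?_
        simp only [phiJK]
        ring
    _ ≤ (2 ^ j) ^ 2 * (((L + 1) * C ^ 2) * ((L + 1) * C ^ 2)) := by
        gcongr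
        · exact sum_sq_translates_le hL hφ hsupp _ _
        · exact sum_sq_translates_le hL hφ hsupp _ _
    _ = ((L + 1) * C ^ 2 * 2 ^ j) ^ 2 := by ring

lemma measurable_phiJK {φ : ℝ → ℝ} (hφ : Measurable φ) (j : ℕ) (k : ℤ × ℤ) :
    Measurable (phiJK φ j k) := by
  unfold phiJK
  fun_prop

/-- Finite Cauchy–Schwarz for the scaling family, uniformly in the point. -/
lemma abs_sum_mul_phiJK_le {φ : ℝ → ℝ} {L C : ℝ} (hL : 0 ≤ L) (hφ : ∀ t, |φ t| ≤ C)
    (hsupp : ∀ t ∉ Set.Icc (0 : ℝ) L, φ t = 0) (j : ℕ) (s : Finset (ℤ × ℤ))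
    (a : ℤ × ℤ → ℝ) (z : ℝ × ℝ) :
    |∑ k ∈ s, a k * phiJK φ j k z| ≤
      (L + 1) * C ^ 2 * 2 ^ j * √(∑ k ∈ s, a k ^ 2) := by
  refine (Real.abs_le_sqrt (Finset.sum_mul_sq_le_sq_mul_sq s a fun k => phiJK φ j k z)).trans ?_
  rw [Real.sqrt_mul (Finset.sum_nonneg fun k _ => sq_nonneg (a k)), mul_comm]
  gcongr
  exact Real.sqrt_le_iff.2 ⟨by positivity, sum_phiJK_sq_le hL hφ hsupp j s z⟩

lemma abs_integral_mul_le_sqrt_mul_sqrt {α : Type*} [MeasurableSpace α] {μ : Measure α}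
    {f g : α → ℝ} (hf : MemLp f 2 μ) (hg : MemLp g 2 μ) :
    |∫ x, f x * g x ∂μ| ≤ √(∫ x, f x ^ 2 ∂μ) * √(∫ x, g x ^ 2 ∂μ) := by
  have h := integral_mul_norm_le_Lp_mul_Lq (μ := μ) (f := f) (g := g)
    Real.HolderConjugate.two_two (by simpa using hf) (by simpa using hg)
  simp only [Real.rpow_two, Real.norm_eq_abs, sq_abs, ← Real.sqrt_eq_rpow] at h
  refine (abs_integral_le_integral_abs).trans ?_
  simpa only [abs_mul] using h

lemma integral_sum_mul_sq_of_orthonormal {α ι : Type*} [MeasurableSpace α] [DecidableEq ι]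
    {μ : Measure α} {s : Finset ι} {e : ι → α → ℝ} (he : ∀ k ∈ s, MemLp (e k) 2 μ)
    (horth : ∀ k ∈ s, ∀ k' ∈ s, (∫ x, e k x * e k' x ∂μ) = if k = k' then 1 else 0)
    (a : ι → ℝ) :
    ∫ x, (∑ k ∈ s, a k * e k x) ^ 2 ∂μ = ∑ k ∈ s, a k ^ 2 := by
  have hint : ∀ k ∈ s, ∀ k' ∈ s, Integrable (fun x => a k * a k' * (e k x * e k' x)) μ :=
    fun k hk k' hk' => ((he k hk).integrable_mul (he k' hk')).const_mul _
  calc ∫ x, (∑ k ∈ s, a k * e k x) ^ 2 ∂μ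
      = ∫ x, ∑ k ∈ s, ∑ k' ∈ s, a k * a k' * (e k x * e k' x) ∂μ := by
        simp only [sq, Finset.sum_mul_sum, mul_mul_mul_comm]
    _ = ∑ k ∈ s, ∑ k' ∈ s, a k * a k' * ∫ x, e k x * e k' x ∂μ := by
        rw [integral_finsetSum _ fun k hk => integrable_finsetSum _ (hint k hk)]
        refine Finset.sum_congr rfl fun k hk => ?_
        rw [integral_finsetSum _ (hint k hk)]
        simp only [integral_const_mul]
    _ = ∑ k ∈ s, a k ^ 2 := by
        refine Finset.sum_congr rfl fun k hk => ?_
        rw [Finset.sum_congr rfl fun k' hk' => by rw [horth k hk k' hk']]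
        simp [hk, sq]

/-- **Pointwise and variance bounds for the linear statistic**
`Z(u,v) = Σ_k (φ_{j,k}(u,v) − c_{j,k})(c_{j,k} − d_k)`:
`sup_{[0,1]²}|Z| ≤ K 2^j T^{1/2}` with `K` depending only on `L`, `‖φ‖_∞`, `‖c‖_{L²}`,
and `Var(Z(U,V)) ≤ ‖c‖_∞ T` when `(U,V)` has density `c`. -/
theorem linear_statistic_bounds
    (L Cφ C2 : ℝ) (hL : 0 < L) (hCφ : 0 < Cφ) (hC2 : 0 < C2) :
    ∃ K : ℝ, 0 < K ∧
      ∀ (φ : ℝ → ℝ) (j : ℕ) (Kf : Finset (ℤ × ℤ)) (c : ℝ × ℝ → ℝ) (Cc : ℝ)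
        (d cjk : ℤ × ℤ → ℝ) (T : ℝ) (Z : ℝ × ℝ → ℝ),
        Measurable φ → (∀ t, |φ t| ≤ Cφ) → (∀ t ∉ Set.Icc (0 : ℝ) L, φ t = 0) →
        (∀ k ∉ Kf, ∀ z ∈ unitSq, phiJK φ j k z = 0) →
        (∀ k ∈ Kf, ∀ k' ∈ Kf,
          (∫ z in unitSq, phiJK φ j k z * phiJK φ j k' z) = if k = k' then 1 else 0) →
        Measurable c → (∀ z, 0 ≤ c z) → (∀ z, c z ≤ Cc) → (∀ z ∉ unitSq, c z = 0) →
        Real.sqrt (∫ z in unitSq, (c z) ^ 2) ≤ C2 →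
        (∀ k, cjk k = ∫ z in unitSq, phiJK φ j k z * c z) →
        T = ∑ k ∈ Kf, (cjk k - d k) ^ 2 →
        (∀ z, Z z = ∑ k ∈ Kf, (phiJK φ j k z - cjk k) * (cjk k - d k)) →
        (∀ z ∈ unitSq, |Z z| ≤ K * 2 ^ j * Real.sqrt T) ∧
        (IsProbabilityMeasure (volume.withDensity fun z => ENNReal.ofReal (c z)) →
          ProbabilityTheory.variance Z (volume.withDensity fun z => ENNReal.ofReal (c z)) ≤
            Cc * T) := by
  classical
  refine ⟨(L + 1) * Cφ ^ 2 + C2, by positivity, ?_⟩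
  intro φ j Kf c Cc d cjk T Z hφm hφ hsupp _ horth hcm hc0 hcC hcsupp hcL2 hcjk hT hZ
  set a : ℤ × ℤ → ℝ := fun k => cjk k - d k
  set f : ℝ × ℝ → ℝ := fun z => ∑ k ∈ Kf, a k * phiJK φ j k z with hf
  set b : ℝ := ∑ k ∈ Kf, cjk k * a k with hb
  have hZf : Z = fun z => f z - b := by
    funext z
    simp only [hZ, hf, hb, ← Finset.sum_sub_distrib]
    exact Finset.sum_congr rfl fun k _ => by ring
  have hfm : Measurable f :=
    Finset.measurable_fun_sum _ fun k _ => (measurable_phiJK hφm j k).const_mul _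
  have hfb : ∀ z, |f z| ≤ (L + 1) * Cφ ^ 2 * 2 ^ j * √T := fun z => by
    rw [hT]
    exact abs_sum_mul_phiJK_le hL.le hφ hsupp j Kf a z
  have : IsFiniteMeasure (volume.restrict unitSq) :=
    isFiniteMeasure_restrict.2 (isCompact_Icc.prod isCompact_Icc).measure_ne_top
  have hfLp : MemLp f 2 (volume.restrict unitSq) :=
    MemLp.of_bound hfm.aestronglyMeasurable _ (.of_forall hfb)
  have hcLp : MemLp c 2 (volume.restrict unitSq) :=
    MemLp.of_bound hcm.aestronglyMeasurable Cc
      (.of_forall fun z => by rw [Real.norm_of_nonneg (hc0 z)]; exact hcC z)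
  have heLp : ∀ k, MemLp (phiJK φ j k) 2 (volume.restrict unitSq) := fun k =>
    MemLp.of_bound (measurable_phiJK hφm j k).aestronglyMeasurable ((L + 1) * Cφ ^ 2 * 2 ^ j)
      (.of_forall fun z => by
        simpa using abs_sum_mul_phiJK_le hL.le hφ hsupp j {k} 1 z)
  have hf2 : ∫ z in unitSq, f z ^ 2 = T := by
    rw [hT]
    exact integral_sum_mul_sq_of_orthonormal (fun k _ => heLp k) horth a
  have hbint : b = ∫ z in unitSq, f z * c z := by
    have hint : ∀ k ∈ Kf, Integrable (fun z => a k * (phiJK φ j k z * c z))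
        (volume.restrict unitSq) := fun k _ => ((heLp k).integrable_mul hcLp).const_mul _
    simp only [hb, hf, hcjk, Finset.sum_mul, mul_assoc]
    rw [integral_finsetSum _ hint]
    exact Finset.sum_congr rfl fun k _ => by rw [integral_const_mul, mul_comm]
  have hbb : |b| ≤ √T * C2 := by
    rw [hbint]
    refine (abs_integral_mul_le_sqrt_mul_sqrt hfLp hcLp).trans ?_
    rw [hf2]
    gcongr
  refine ⟨fun z _ => ?_, fun hP => ?_⟩
  · have h2 : (1 : ℝ) ≤ 2 ^ j := one_le_pow₀ one_le_two
    calc |Z z| ≤ |f z| + |b| := by rw [hZf]; exact abs_sub _ _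
      _ ≤ (L + 1) * Cφ ^ 2 * 2 ^ j * √T + √T * C2 * 2 ^ j :=
          add_le_add (hfb z) (hbb.trans (le_mul_of_one_le_right (by positivity) h2))
      _ = ((L + 1) * Cφ ^ 2 + C2) * 2 ^ j * √T := by ring
  · rw [hZf, ProbabilityTheory.variance_sub_const hfm.aestronglyMeasurable]
    refine (ProbabilityTheory.variance_le_expectation_sq hfm.aestronglyMeasurable).trans ?_
    rw [integral_withDensity_eq_integral_toReal_smul hcm.ennreal_ofReal
      (.of_forall fun _ => ENNReal.ofReal_lt_top)]
    simp only [ENNReal.toReal_ofReal (hc0 _), smul_eq_mul, Pi.pow_apply]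
    rw [← setIntegral_eq_integral_of_forall_compl_eq_zero (s := unitSq)
      fun z hz => by rw [hcsupp z hz, zero_mul], ← hf2, ← integral_const_mul]
    exact integral_mono_of_nonneg (.of_forall fun z => mul_nonneg (hc0 z) (sq_nonneg _))
      (hfLp.integrable_sq.const_mul Cc)
      (.of_forall fun z => mul_le_mul_of_nonneg_right (hcC z) (sq_nonneg _))
end
end

section
/- (Deviation of the empirical cdf from one sample evaluated at order statistics of an independent sample.) Let F be a continuous cdf on ℝ, let X₁, …, X_{n₁} and X'₁, …, X'_{n₂} be two independent i.i.d. samples from F, let F̂ be the empirical cdf of the first sample, and let X'_{(i:n₂)} denote the i-th order statistic of the second sample. Let δ > 0 and set ε = max( √(δ log(n₁)/(2n₁)), √(δ log(n₂)/(2n₂)) ). Then for every i ∈ {1, …, n₂}: P( | F̂(X'_{(i:n₂)}) − i/n₂ | ≥ 2ε ) ≤ 2( n₁^{−δ} + n₂^{−δ} ). -/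
open MeasureTheory

noncomputable section

open ProbabilityTheory

/-- **Hoeffding's inequality** for the empirical frequency of a set, upper tail. -/
lemma measure_le_sum_indicator_sub {α : Type*} [MeasurableSpace α] (μ : Measure α)
    [IsProbabilityMeasure μ] {n : ℕ} (hn : 1 ≤ n) {A : Set α} (hA : MeasurableSet A)
    {t : ℝ} (ht : 0 ≤ t) :
    (Measure.pi fun _ : Fin n => μ)
      {ω | t ≤ (n : ℝ)⁻¹ * ∑ j, A.indicator (fun _ => (1 : ℝ)) (ω j) - μ.real A} ≤
      ENNReal.ofReal (Real.exp (-2 * n * t ^ 2)) := by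
  set P := Measure.pi fun _ : Fin n => μ
  have hn0 : (0 : ℝ) < n := by exact_mod_cast hn
  have hind : Measurable (A.indicator (fun _ => (1 : ℝ))) := measurable_const.indicator hA
  let X : Fin n → (Fin n → α) → ℝ :=
    fun j ω => A.indicator (fun _ => (1 : ℝ)) (ω j) - μ.real A
  have hXindep : iIndepFun X P :=
    iIndepFun_pi (X := fun _ x => A.indicator (fun _ => (1 : ℝ)) x - μ.real A)
      fun _ => (hind.sub_const _).aemeasurable
  have hXsub (j : Fin n) : HasSubgaussianMGF (X j) ((‖(1 : ℝ) - 0‖₊ / 2) ^ 2) P := by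
    have hmean : ∫ ω, A.indicator (fun _ => (1 : ℝ)) (ω j) ∂P = μ.real A := by
      have h := integral_map (μ := P) (measurable_pi_apply j).aemeasurable
        (f := A.indicator (fun _ => (1 : ℝ))) hind.aestronglyMeasurable
      rw [← h, (measurePreserving_eval (fun _ : Fin n => μ) j).map_eq,
        integral_indicator_const _ hA, smul_eq_mul, mul_one]
    have h := hasSubgaussianMGF_of_mem_Icc (μ := P) (a := 0) (b := 1)
      (X := fun ω => A.indicator (fun _ => (1 : ℝ)) (ω j))
      (hind.comp (measurable_pi_apply j)).aemeasurable
      (Filter.Eventually.of_forall fun ω => by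
        by_cases h : ω j ∈ A <;> simp [h])
    rwa [hmean] at h
  have key := HasSubgaussianMGF.measure_sum_ge_le_of_iIndepFun hXindep (s := Finset.univ)
    (fun j _ => hXsub j) (ε := n * t) (by positivity)
  rw [← ofReal_measureReal]
  refine ENNReal.ofReal_le_ofReal ((measureReal_mono fun ω hω => ?_).trans (key.trans_eq ?_))
  · simp only [Set.mem_ofPred_eq] at hω ⊢
    have : ∑ j, X j ω = n * ((n : ℝ)⁻¹ * ∑ j, A.indicator (fun _ => (1 : ℝ)) (ω j) - μ.real A) := by
      simp only [X, Finset.sum_sub_distrib, Finset.sum_const, Finset.card_univ, Fintype.card_fin,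
        nsmul_eq_mul]
      field_simp
    rw [this]
    gcongr
  · congr 1
    simp
    field_simp

/-- **Hoeffding's inequality** for the empirical frequency of a set, lower tail. -/
lemma measure_le_sub_sum_indicator {α : Type*} [MeasurableSpace α] (μ : Measure α)
    [IsProbabilityMeasure μ] {n : ℕ} (hn : 1 ≤ n) {A : Set α} (hA : MeasurableSet A)
    {t : ℝ} (ht : 0 ≤ t) :
    (Measure.pi fun _ : Fin n => μ)
      {ω | t ≤ μ.real A - (n : ℝ)⁻¹ * ∑ j, A.indicator (fun _ => (1 : ℝ)) (ω j)} ≤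
      ENNReal.ofReal (Real.exp (-2 * n * t ^ 2)) := by
  have hn0 : (n : ℝ) ≠ 0 := by positivity
  refine (measure_mono fun ω hω => ?_).trans (measure_le_sum_indicator_sub μ hn hA.compl ht)
  simp only [Set.mem_ofPred_eq] at hω ⊢
  have hcompl (x : α) : Aᶜ.indicator (fun _ => (1 : ℝ)) x = 1 - A.indicator (fun _ => 1) x := by
    by_cases h : x ∈ A <;> simp [h]
  simp only [hcompl, Finset.sum_sub_distrib, probReal_compl_eq_one_sub hA, Finset.sum_const,
    Finset.card_univ, Fintype.card_fin, nsmul_eq_mul, mul_one, mul_sub, inv_mul_cancel₀ hn0]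
  linarith

/-- The `i`-th order statistic satisfies a downward closed property iff more than `i` of the
sample points do. -/
lemma Tuple.apply_sort_iff_lt_card {n : ℕ} (ω : Fin n → ℝ) (i : Fin n) (p : ℝ → Prop)
    [DecidablePred p] (hp : ∀ ⦃x y⦄, x ≤ y → p y → p x) :
    p (ω (Tuple.sort ω i)) ↔ (i : ℕ) < (Finset.univ.filter fun j => p (ω j)).card := by
  have hmono := Tuple.monotone_sort ω
  have hcard : (Finset.univ.filter fun j => p (ω j)).card =
      (Finset.univ.filter fun j => p (ω (Tuple.sort ω j))).card := by
    symm
    exact Finset.card_equiv (Tuple.sort ω) (by simp)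
  rw [hcard]
  constructor
  · intro h
    have : Finset.Iic i ⊆ Finset.univ.filter fun j => p (ω (Tuple.sort ω j)) := fun j hj =>
      Finset.mem_filter.2 ⟨Finset.mem_univ _, hp (hmono (Finset.mem_Iic.1 hj)) h⟩
    exact (Fin.card_Iic i).symm.trans_le (Finset.card_le_card this)
  · contrapose!
    intro h
    have : (Finset.univ.filter fun j => p (ω (Tuple.sort ω j))) ⊆ Finset.Iio i := fun j hj => by
      rw [Finset.mem_Iio]
      by_contra! hij
      exact h (hp (hmono hij) (by simpa using hj))
    simpa using Finset.card_le_card this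

lemma Tuple.measurable_apply_sort {n : ℕ} (i : Fin n) :
    Measurable fun ω : Fin n → ℝ => ω (Tuple.sort ω i) := by
  refine measurable_of_Iic fun c => ?_
  have h (ω : Fin n → ℝ) := Tuple.apply_sort_iff_lt_card ω i (· ≤ c) fun _ _ => le_trans
  have hset : (fun ω : Fin n → ℝ => ω (Tuple.sort ω i)) ⁻¹' Set.Iic c =
      {ω | (i : ℕ) < ∑ j, if ω j ≤ c then 1 else 0} := by
    ext ω
    simpa using h ω
  rw [hset]
  refine measurableSet_lt measurable_const (Finset.measurable_sum _ fun j _ => ?_)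
  exact Measurable.ite (measurableSet_le (measurable_pi_apply j) measurable_const)
    measurable_const measurable_const

section ContinuousCDF

variable {μ : Measure ℝ}

lemma exists_cdf_eq (hc : Continuous (cdf μ)) {r : ℝ} (h0 : 0 < r) (h1 : r < 1) :
    ∃ x, cdf μ x = r :=
  mem_range_of_exists_le_of_exists_ge hc
    ((tendsto_cdf_atBot μ).eventually_le_const h0).exists
    ((tendsto_cdf_atTop μ).eventually_const_le h1).exists

lemma le_measureReal_cdf_lt [IsProbabilityMeasure μ] (hc : Continuous (cdf μ)) {q : ℝ} (h1 : q ≤ 1) :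
    q ≤ μ.real {x | cdf μ x < q} := by
  refine le_of_forall_lt fun r hr => ?_
  by_contra! hlt
  obtain ⟨s, hrs, hsq⟩ := exists_between hr
  obtain ⟨x, hx⟩ := exists_cdf_eq hc ((measureReal_nonneg.trans hlt).trans_lt hrs)
    (hsq.trans_le h1)
  have : cdf μ x ≤ μ.real {x | cdf μ x < q} := by
    rw [cdf_eq_real]
    exact measureReal_mono fun y hy => ((monotone_cdf μ hy).trans_eq hx).trans_lt hsq
  linarith

lemma measureReal_cdf_le_le [IsProbabilityMeasure μ] (hc : Continuous (cdf μ)) {q : ℝ} (h0 : 0 ≤ q) :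
    μ.real {x | cdf μ x ≤ q} ≤ q := by
  refine le_of_forall_gt fun r hr => ?_
  by_contra! hlt
  obtain ⟨s, hqs, hsr⟩ := exists_between hr
  obtain ⟨x, hx⟩ := exists_cdf_eq hc (h0.trans_lt hqs)
    (hsr.trans_le (hlt.trans measureReal_le_one))
  have : μ.real {x | cdf μ x ≤ q} ≤ cdf μ x := by
    rw [cdf_eq_real]
    refine measureReal_mono fun y hy => ?_
    by_contra! hxy
    have := monotone_cdf μ (not_le.1 hxy).le
    simp only [Set.mem_ofPred_eq] at hy
    linarith
  linarith

/-- Sub-Gaussian concentration of the cdf evaluated at an order statistic. -/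
lemma measure_le_abs_cdf_sort_sub [IsProbabilityMeasure μ] (hc : Continuous (cdf μ))
    {n : ℕ} (hn : 1 ≤ n) (i : Fin n) {t : ℝ} (ht : 0 ≤ t) :
    (Measure.pi fun _ : Fin n => μ)
      {ω | t ≤ |cdf μ (ω (Tuple.sort ω i)) - ((i : ℕ) + 1) / (n : ℝ)|} ≤
      ENNReal.ofReal (2 * Real.exp (-2 * n * t ^ 2)) := by
  classical
  have hn0 : (0 : ℝ) < n := by exact_mod_cast hn
  set k : ℝ := ((i : ℕ) + 1) / (n : ℝ)
  have hk : 0 < k := by positivity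
  have hsum (p : ℝ → Prop) (ω : Fin n → ℝ) :
      ∑ j, {x | p x}.indicator (fun _ => (1 : ℝ)) (ω j) =
        ((Finset.univ.filter fun j => p (ω j)).card : ℝ) := by
    simp [Set.indicator_apply]
  have hmeas_lt : MeasurableSet {x | cdf μ x < k + t} :=
    measurableSet_lt hc.measurable measurable_const
  have hmeas_le : MeasurableSet {x | cdf μ x ≤ k - t} :=
    measurableSet_le hc.measurable measurable_const
  rw [two_mul, ENNReal.ofReal_add (Real.exp_nonneg _) (Real.exp_nonneg _)]
  refine (measure_mono fun ω hω => ?_).trans ((measure_union_le _ _).trans (add_le_add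
    (measure_le_sum_indicator_sub μ hn hmeas_le ht)
    (measure_le_sub_sum_indicator μ hn hmeas_lt ht)))
  rw [Set.mem_ofPred_eq] at hω
  rcases le_abs'.1 hω with h | h
  · left
    have hq : cdf μ (ω (Tuple.sort ω i)) ≤ k - t := by linarith
    have hμ := measureReal_cdf_le_le hc ((cdf_nonneg μ _).trans hq)
    have hcard := (Tuple.apply_sort_iff_lt_card ω i (fun x => cdf μ x ≤ k - t)
      fun x y hxy hy => (monotone_cdf μ hxy).trans hy).1 hq
    have hfreq : k ≤ (n : ℝ)⁻¹ * ((Finset.univ.filter fun j => cdf μ (ω j) ≤ k - t).card : ℝ) := by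
      rw [inv_mul_eq_div]
      exact div_le_div_of_nonneg_right (by exact_mod_cast hcard) hn0.le
    simp only [Set.mem_ofPred_eq, hsum]
    linarith
  · right
    have hq : ¬ cdf μ (ω (Tuple.sort ω i)) < k + t := by linarith
    have hμ := le_measureReal_cdf_lt hc (q := k + t) ((not_lt.1 hq).trans (cdf_le_one μ _))
    have hcard := (Tuple.apply_sort_iff_lt_card ω i (fun x => cdf μ x < k + t)
      fun x y hxy hy => (monotone_cdf μ hxy).trans_lt hy).not.1 hq
    have hfreq : (n : ℝ)⁻¹ * ((Finset.univ.filter fun j => cdf μ (ω j) < k + t).card : ℝ) ≤ k := by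
      rw [inv_mul_eq_div]
      exact div_le_div_of_nonneg_right
        (by exact_mod_cast (not_lt.1 hcard).trans (Nat.le_succ _)) hn0.le
    simp only [Set.mem_ofPred_eq, hsum]
    linarith

end ContinuousCDF

lemma exp_neg_two_mul_sq_le_rpow_neg {n : ℕ} (hn : 1 ≤ n) {δ t : ℝ}
    (ht : Real.sqrt (δ * Real.log n / (2 * n)) ≤ t) :
    Real.exp (-2 * n * t ^ 2) ≤ (n : ℝ) ^ (-δ) := by
  have hn0 : (0 : ℝ) < n := by exact_mod_cast hn
  rw [Real.rpow_def_of_pos hn0, Real.exp_le_exp]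
  have h := (Real.sqrt_le_left ((Real.sqrt_nonneg _).trans ht)).1 ht
  rw [div_le_iff₀ (by positivity)] at h
  linarith

/-- **DKW-type deviation of the empirical cdf of one sample evaluated at order
statistics of an independent sample.**
With `F̂` the empirical cdf of an i.i.d. sample of size `n₁` from a continuous cdf `F`,
and `X'_{(i:n₂)}` the `i`-th order statistic of an independent i.i.d. sample of size `n₂`
from `F`, for `ε = max(√(δ log n₁/(2n₁)), √(δ log n₂/(2n₂)))` one has
`P(|F̂(X'_{(i:n₂)}) − i/n₂| ≥ 2ε) ≤ 2(n₁^{−δ} + n₂^{−δ})`. -/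
theorem dkw_order_statistic
    (μ : Measure ℝ) [IsProbabilityMeasure μ]
    (F : ℝ → ℝ) (hF : ∀ x, F x = (μ (Set.Iic x)).toReal) (hFcont : Continuous F)
    (n₁ n₂ : ℕ) (hn₁ : 1 ≤ n₁) (hn₂ : 1 ≤ n₂)
    (δ : ℝ) (hδ : 0 < δ)
    (ε : ℝ)
    (hε : ε = max (Real.sqrt (δ * Real.log n₁ / (2 * n₁)))
                  (Real.sqrt (δ * Real.log n₂ / (2 * n₂))))
    (Fhat : (Fin n₁ → ℝ) → ℝ → ℝ)
    (hFhat : ∀ ω x, Fhat ω x = (n₁ : ℝ)⁻¹ * ∑ i : Fin n₁, if ω i ≤ x then (1 : ℝ) else 0)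
    (i : Fin n₂) :
    ((Measure.pi fun _ : Fin n₁ => μ).prod (Measure.pi fun _ : Fin n₂ => μ))
      {ω : (Fin n₁ → ℝ) × (Fin n₂ → ℝ) |
        2 * ε ≤ |Fhat ω.1 (ω.2 (Tuple.sort ω.2 i)) - ((i : ℕ) + 1) / (n₂ : ℝ)|} ≤
      ENNReal.ofReal (2 * ((n₁ : ℝ) ^ (-δ) + (n₂ : ℝ) ^ (-δ))) := by
  have hFcdf : F = cdf μ := by
    ext x
    rw [hF, cdf_eq_real]
    rfl
  subst hFcdf
  have hε₁ : Real.sqrt (δ * Real.log n₁ / (2 * n₁)) ≤ ε := hε ▸ le_max_left _ _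
  have hε₂ : Real.sqrt (δ * Real.log n₂ / (2 * n₂)) ≤ ε := hε ▸ le_max_right _ _
  have hε0 : 0 ≤ ε := (Real.sqrt_nonneg _).trans hε₁
  let T : (Fin n₂ → ℝ) → ℝ := fun ω => ω (Tuple.sort ω i)
  have hT : Measurable T := Tuple.measurable_apply_sort i
  let S₁ : Set ((Fin n₁ → ℝ) × (Fin n₂ → ℝ)) := {ω | ε ≤ |Fhat ω.1 (T ω.2) - cdf μ (T ω.2)|}
  let S₂ : Set (Fin n₂ → ℝ) := {ω | ε ≤ |cdf μ (T ω) - ((i : ℕ) + 1) / (n₂ : ℝ)|}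
  have hS₁ : MeasurableSet S₁ := by
    have hFhat_meas :
        Measurable fun ω : (Fin n₁ → ℝ) × (Fin n₂ → ℝ) => Fhat ω.1 (T ω.2) := by
      simp only [hFhat]
      refine (Finset.measurable_sum _ fun j _ => ?_).const_mul _
      exact Measurable.ite (measurableSet_le (by fun_prop) (by fun_prop))
        measurable_const measurable_const
    exact measurableSet_le measurable_const
      (hFhat_meas.sub (hFcont.measurable.comp (hT.comp measurable_snd))).abs
  have hfirst : ((Measure.pi fun _ : Fin n₁ => μ).prod (Measure.pi fun _ : Fin n₂ => μ)) S₁ ≤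
      ENNReal.ofReal (2 * (n₁ : ℝ) ^ (-δ)) := by
    rw [Measure.prod_apply_symm hS₁]
    refine (lintegral_mono (g := fun _ => ENNReal.ofReal (2 * (n₁ : ℝ) ^ (-δ)))
      fun ω' => ?_).trans (by simp)
    have hexp := ENNReal.ofReal_le_ofReal (exp_neg_two_mul_sq_le_rpow_neg hn₁ hε₁)
    rw [two_mul, ENNReal.ofReal_add (by positivity) (by positivity)]
    refine (measure_mono fun ω hω => ?_).trans ((measure_union_le _ _).trans (add_le_add
      ((measure_le_sum_indicator_sub μ hn₁ (measurableSet_Iic (a := T ω')) hε0).trans hexp)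
      ((measure_le_sub_sum_indicator μ hn₁ (measurableSet_Iic (a := T ω')) hε0).trans hexp)))
    simp only [S₁, Set.mem_preimage, Set.mem_ofPred_eq, hFhat, cdf_eq_real] at hω
    simp only [Set.mem_union, Set.mem_ofPred_eq, Set.indicator_apply, Set.mem_Iic]
    rcases le_abs.1 hω with h | h
    · exact Or.inl h
    · exact Or.inr (by linarith)
  have hsecond : ((Measure.pi fun _ : Fin n₁ => μ).prod (Measure.pi fun _ : Fin n₂ => μ))
      (Set.univ ×ˢ S₂) ≤ ENNReal.ofReal (2 * (n₂ : ℝ) ^ (-δ)) := by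
    rw [Measure.prod_prod, measure_univ, one_mul]
    refine (measure_le_abs_cdf_sort_sub hFcont hn₂ i hε0).trans (ENNReal.ofReal_le_ofReal ?_)
    linarith [exp_neg_two_mul_sq_le_rpow_neg hn₂ hε₂]
  rw [mul_add, ENNReal.ofReal_add (by positivity) (by positivity)]
  refine (measure_mono fun ω hω => ?_).trans
    ((measure_union_le S₁ (Set.univ ×ˢ S₂)).trans (add_le_add hfirst hsecond))
  by_contra hnot
  simp only [Set.mem_union, Set.mem_prod, Set.mem_univ, true_and, not_or, S₁, S₂,
    Set.mem_ofPred_eq, not_le] at hnot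
  have htri := abs_sub_le (Fhat ω.1 (T ω.2)) (cdf μ (T ω.2)) (((i : ℕ) + 1) / (n₂ : ℝ))
  have hω' : 2 * ε ≤ |Fhat ω.1 (T ω.2) - ((i : ℕ) + 1) / (n₂ : ℝ)| := hω
  linarith [hnot.1, hnot.2]
end
end
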